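/- Let m, n ≥ 1 be integers with m ≤ n и let α > 0. Let h₀ : ℝ → ℝ be a smooth function with period 2mπ/n (hence 2mπ-periodic) satisfying h₀ + h₀'' > 0 everywhere (the support function of a locally convex closed curve of total curvature 2mπ with n-fold rotational symmetry). Then the length-preserving (LP) support-function flow with initial data h₀ admits a smooth solution h on ℝ × [0,∞), 2mπ-periodic in θ with h + h_θθ > 0 for all time, and the curvature κ = (h + h_θθ)^{−1} converges, together with all its θ-derivatives, uniformly to the constant 2mπ/L₀ as t → ∞, where L₀ = ∫₀^{2mπ} h₀ dθ; that is, the flow exists globally and converges in the C^∞ metric to an m-fold circle of length L₀. -/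

import Mathlib

open Real MeasureTheory Filter

/-- Second derivative of the support function in the angle variable. -/
noncomputable def hpp (h : ℝ → ℝ → ℝ) (θ t : ℝ) : ℝ :=
  iteratedDeriv 2 (fun x => h x t) θ

/-- Nonlocal term of the length-preserving support-function flow. -/
noncomputable def lamLP (m : ℕ) (α : ℝ) (h : ℝ → ℝ → ℝ) (t : ℝ) : ℝ :=
  (1 / (2 * m * π)) * ∫ θ in (0:ℝ)..(2 * m * π), (h θ t + hpp h θ t) ^ (-α)

open scoped ContDiff

/-- smooth `p`-periodic functions -/
structure SP (p : ℝ) (u : ℝ → ℝ) : Prop where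
  smooth : ContDiff ℝ ∞ u
  per : Function.Periodic u p

noncomputable def mean (p : ℝ) (u : ℝ → ℝ) : ℝ := (1 / p) * ∫ x in (0:ℝ)..p, u x

noncomputable def Y (p : ℝ) (k : ℕ) (u : ℝ → ℝ) : ℝ := ∫ x in (0:ℝ)..p, (iteratedDeriv k u x) ^ 2

namespace SP
variable {p : ℝ} {u v : ℝ → ℝ}

lemma cont (h : SP p u) : Continuous u := h.smooth.continuous
lemma diff (h : SP p u) : Differentiable ℝ u := h.smooth.differentiable (by simp)
lemma hasDeriv (h : SP p u) (x : ℝ) : HasDerivAt u (deriv u x) x := (h.diff x).hasDerivAt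

lemma der (h : SP p u) : SP p (deriv u) := by
  refine ⟨?_, ?_⟩
  · have := h.smooth
    rw [show (∞ : WithTop ℕ∞) = ∞ + 1 from rfl, contDiff_succ_iff_deriv] at this
    exact this.2.2
  · intro x
    have : u = fun y => u (y + p) := by ext y; exact (h.per y).symm
    conv_rhs => rw [this]
    rw [deriv_comp_add_const]

lemma iter (h : SP p u) (k : ℕ) : SP p (iteratedDeriv k u) := by
  induction k with
  | zero => simpa using h
  | succ k ih => rw [iteratedDeriv_succ]; exact ih.der

lemma add (h : SP p u) (g : SP p v) : SP p (fun x => u x + v x) :=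
  ⟨h.smooth.add g.smooth, fun x => by simp only [h.per x, g.per x]⟩
lemma sub (h : SP p u) (g : SP p v) : SP p (fun x => u x - v x) :=
  ⟨h.smooth.sub g.smooth, fun x => by simp only [h.per x, g.per x]⟩
lemma mul (h : SP p u) (g : SP p v) : SP p (fun x => u x * v x) :=
  ⟨h.smooth.mul g.smooth, fun x => by simp only [h.per x, g.per x]⟩
lemma const (c : ℝ) : SP p (fun _ => c) := ⟨contDiff_const, fun _ => rfl⟩
lemma comp {G : ℝ → ℝ} (hG : ContDiff ℝ ∞ G) (h : SP p u) : SP p (fun x => G (u x)) :=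
  ⟨hG.comp h.smooth, fun x => by simp only [h.per x]⟩

lemma hasDeriv_iter (h : SP p u) (k : ℕ) (x : ℝ) :
    HasDerivAt (iteratedDeriv k u) (iteratedDeriv (k+1) u x) x := by
  have := (h.iter k).hasDeriv x
  rwa [← iteratedDeriv_succ] at this
end SP

lemma Y_nonneg {p : ℝ} (hp : 0 < p) (k : ℕ) (u : ℝ → ℝ) : 0 ≤ Y p k u :=
  intervalIntegral.integral_nonneg hp.le (fun _ _ => sq_nonneg _)

lemma Y_shift (p : ℝ) (k j : ℕ) (u : ℝ → ℝ) : Y p k (iteratedDeriv j u) = Y p (k + j) u := by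
  unfold Y
  congr 1; ext x
  rw [iteratedDeriv_eq_iterate, iteratedDeriv_eq_iterate, iteratedDeriv_eq_iterate, Function.iterate_add_apply]

lemma ii_cont {f : ℝ → ℝ} (hf : Continuous f) (a b : ℝ) : IntervalIntegrable f volume a b :=
  hf.intervalIntegrable a b

/-- integral of derivative of a periodic function vanishes -/
lemma int_deriv_zero {p : ℝ} {u : ℝ → ℝ} (h : SP p u) : ∫ x in (0:ℝ)..p, deriv u x = 0 := by
  rw [intervalIntegral.integral_deriv_eq_sub (fun x _ => h.diff x) (h.der.cont.intervalIntegrable _ _)]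
  have := h.per 0
  simp at this; simp [this]

lemma int_hd_zero {p : ℝ} {u u' : ℝ → ℝ} (h : SP p u) (h' : ∀ x, HasDerivAt u (u' x) x) :
    ∫ x in (0:ℝ)..p, u' x = 0 := by
  have e : u' = deriv u := funext fun x => (h' x).deriv.symm
  rw [e, int_deriv_zero h]

lemma ibp {p : ℝ} {u v : ℝ → ℝ} (hu : SP p u) (hv : SP p v) :
    ∫ x in (0:ℝ)..p, deriv u x * v x = - ∫ x in (0:ℝ)..p, u x * deriv v x := by
  have h0 : ∫ x in (0:ℝ)..p, (deriv u x * v x + u x * deriv v x) = 0 :=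
    int_hd_zero (hu.mul hv) (fun x => (hu.hasDeriv x).mul (hv.hasDeriv x))
  have c1 := hu.cont
  have c2 := hv.cont
  have c3 := hu.der.cont
  have c4 := hv.der.cont
  rw [intervalIntegral.integral_add (ii_cont (by fun_prop) _ _) (ii_cont (by fun_prop) _ _)] at h0
  linarith

lemma cs {f g : ℝ → ℝ} (hf : Continuous f) (hg : Continuous g) {a b : ℝ} (hab : a ≤ b) :
    (∫ x in a..b, f x * g x) ^ 2 ≤ (∫ x in a..b, f x ^ 2) * ∫ x in a..b, g x ^ 2 := by
  have key : ∀ s : ℝ, 0 ≤ (∫ x in a..b, g x ^ 2) * (s * s) + (2 * ∫ x in a..b, f x * g x) * s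
      + ∫ x in a..b, f x ^ 2 := by
    intro s
    have h : 0 ≤ ∫ x in a..b, (f x + s * g x) ^ 2 :=
      intervalIntegral.integral_nonneg hab (fun _ _ => sq_nonneg _)
    have e : ∫ x in a..b, (f x + s * g x) ^ 2 = ∫ x in a..b, (f x ^ 2 + (2 * s) * (f x * g x) + s * s * g x ^ 2) := by
      congr 1; ext x; ring
    rw [e, intervalIntegral.integral_add, intervalIntegral.integral_add,
      intervalIntegral.integral_const_mul, intervalIntegral.integral_const_mul] at h
    · linarith
    all_goals apply ii_cont; fun_prop
  have := discrim_le_zero key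
  unfold discrim at this
  nlinarith

lemma Y_interp {p : ℝ} (hp : 0 < p) {u : ℝ → ℝ} (h : SP p u) (k : ℕ) :
    Y p (k+1) u ^ 2 ≤ Y p k u * Y p (k+2) u := by
  have e : Y p (k+1) u = - ∫ x in (0:ℝ)..p, iteratedDeriv k u x * iteratedDeriv (k+2) u x := by
    have := ibp (h.iter k) (h.iter (k+1))
    rw [← iteratedDeriv_succ, ← iteratedDeriv_succ] at this
    rw [← this]; unfold Y; congr 1; ext x; ring
  rw [e, neg_sq]
  exact cs (h.iter k).cont (h.iter (k+2)).cont hp.le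

lemma osc_sq {p : ℝ} (hp : 0 < p) {u : ℝ → ℝ} (h : SP p u) (x y : ℝ) :
    (u x - u y) ^ 2 ≤ p * Y p 1 u := by
  obtain ⟨z, hz, hxz⟩ := h.per.exists_mem_Ico hp x y
  rw [hxz]
  have e : u z - u y = ∫ s in y..z, 1 * deriv u s := by
    simp only [one_mul]
    rw [intervalIntegral.integral_deriv_eq_sub (fun x _ => h.diff x) (h.der.cont.intervalIntegrable _ _)]
  rw [e]
  refine (cs continuous_const h.der.cont hz.1).trans ?_
  have h1 : ∫ s in y..z, (1:ℝ) ^ 2 = z - y := by simp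
  have h2 : ∫ s in y..z, deriv u s ^ 2 ≤ Y p 1 u := by
    have : Y p 1 u = ∫ s in y..(y+p), deriv u s ^ 2 := by
      have hper : Function.Periodic (fun s => deriv u s ^ 2) p := fun s => by simp only [h.der.per s]
      rw [hper.intervalIntegral_add_eq y 0]; simp [Y]
    rw [this]
    refine intervalIntegral.integral_mono_interval le_rfl hz.1 hz.2.le
      (ae_of_all _ fun s => sq_nonneg _) (ii_cont (h.der.cont.pow 2) _ _)
  rw [h1]
  have h3 : 0 ≤ ∫ s in y..z, deriv u s ^ 2 :=
    intervalIntegral.integral_nonneg hz.1 (fun _ _ => sq_nonneg _)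
  have : z - y ≤ p := by linarith [hz.2]
  have h4 : 0 ≤ z - y := by linarith [hz.1]
  gcongr

lemma abs_mean_le {p : ℝ} (hp : 0 < p) {f : ℝ → ℝ} {C : ℝ} (hC : ∀ x, |f x| ≤ C) :
    |mean p f| ≤ C := by
  have := intervalIntegral.norm_integral_le_of_norm_le_const (a := 0) (b := p) (f := f) (C := C)
    (fun x _ => hC x)
  unfold mean
  rw [abs_mul, abs_of_pos (by positivity : 0 < 1 / p)]
  rw [Real.norm_eq_abs, sub_zero, abs_of_pos hp] at this
  calc _ ≤ 1 / p * (C * p) := by gcongr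
    _ = C := by field_simp

lemma mean_const {p : ℝ} (hp : 0 < p) (c : ℝ) : mean p (fun _ => c) = c := by
  unfold mean; simp; field_simp

lemma mean_sub {p : ℝ} {f g : ℝ → ℝ} (hf : Continuous f) (hg : Continuous g) :
    mean p (fun x => f x - g x) = mean p f - mean p g := by
  unfold mean
  rw [intervalIntegral.integral_sub (ii_cont hf _ _) (ii_cont hg _ _)]; ring

lemma mean_add {p : ℝ} {f g : ℝ → ℝ} (hf : Continuous f) (hg : Continuous g) :
    mean p (fun x => f x + g x) = mean p f + mean p g := by
  unfold mean
  rw [intervalIntegral.integral_add (ii_cont hf _ _) (ii_cont hg _ _)]; ring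

lemma int_eq_mean {p : ℝ} (hp : 0 < p) (f : ℝ → ℝ) : ∫ x in (0:ℝ)..p, f x = p * mean p f := by
  unfold mean; field_simp

lemma sup_dev {p : ℝ} (hp : 0 < p) {u : ℝ → ℝ} (h : SP p u) (x : ℝ) :
    (u x - mean p u) ^ 2 ≤ p * Y p 1 u := by
  have h1 : u x - mean p u = mean p (fun y => u x - u y) := by
    rw [mean_sub continuous_const h.cont, mean_const hp]
  have h2 : |mean p (fun y => u x - u y)| ≤ √(p * Y p 1 u) :=
    abs_mean_le hp fun y => Real.abs_le_sqrt (osc_sq hp h x y)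
  rw [h1, ← sq_abs]
  calc _ ≤ √(p * Y p 1 u) ^ 2 := by gcongr
    _ = _ := Real.sq_sqrt (mul_nonneg hp.le (Y_nonneg hp _ _))

lemma mean_iter {p : ℝ} {u : ℝ → ℝ} (h : SP p u) (k : ℕ) : mean p (iteratedDeriv (k+1) u) = 0 := by
  unfold mean; rw [iteratedDeriv_succ, int_deriv_zero (h.iter k), mul_zero]

lemma sup_iter {p : ℝ} (hp : 0 < p) {u : ℝ → ℝ} (h : SP p u) {k : ℕ} (hk : 1 ≤ k) (x : ℝ) :
    (iteratedDeriv k u x) ^ 2 ≤ p * Y p (k+1) u := by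
  have := sup_dev hp (h.iter k) x
  rw [Y_shift, add_comm 1 k] at this
  obtain ⟨j, rfl⟩ := Nat.exists_eq_add_of_le' hk
  rwa [mean_iter h, sub_zero] at this

lemma int_le_of_le {p : ℝ} (hp : 0 < p) {f g : ℝ → ℝ} (hf : Continuous f) (hg : Continuous g)
    (h : ∀ x, f x ≤ g x) : ∫ x in (0:ℝ)..p, f x ≤ ∫ x in (0:ℝ)..p, g x :=
  intervalIntegral.integral_mono_on hp.le (ii_cont hf _ _) (ii_cont hg _ _) (fun x _ => h x)

lemma int_le_const {p : ℝ} (hp : 0 < p) {f : ℝ → ℝ} (hf : Continuous f) {C : ℝ}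
    (h : ∀ x, f x ≤ C) : ∫ x in (0:ℝ)..p, f x ≤ p * C := by
  have := int_le_of_le hp hf continuous_const h
  simpa using this

lemma poincare0 {p : ℝ} (hp : 0 < p) {u : ℝ → ℝ} (h : SP p u) :
    ∫ x in (0:ℝ)..p, (u x - mean p u) ^ 2 ≤ p ^ 2 * Y p 1 u := by
  have := int_le_const hp (f := fun x => (u x - mean p u) ^ 2) (by have := h.cont; fun_prop) (sup_dev hp h)
  calc _ ≤ _ := this
    _ = _ := by ring

lemma poincare {p : ℝ} (hp : 0 < p) {u : ℝ → ℝ} (h : SP p u) {k : ℕ} (hk : 1 ≤ k) :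
    Y p k u ≤ p ^ 2 * Y p (k+1) u := by
  have := int_le_const hp (f := fun x => (iteratedDeriv k u x) ^ 2)
    (by have := (h.iter k).cont; fun_prop) (sup_iter hp h hk)
  calc _ ≤ _ := this
    _ = _ := by ring

/-- interpolated sup bound for first derivative -/
lemma sup_interp {p : ℝ} (hp : 0 < p) {u : ℝ → ℝ} (h : SP p u) {k : ℕ} (hk : 1 ≤ k) (x : ℝ) :
    ((iteratedDeriv k u x) ^ 2) ^ 2 ≤ 9 * (Y p k u * Y p (k+1) u) := by
  set w := iteratedDeriv k u with hw
  have hwS : SP p w := h.iter k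
  have hY0 : 0 ≤ Y p k u := Y_nonneg hp _ _
  have hY1 : 0 ≤ Y p (k+1) u := Y_nonneg hp _ _
  have hdw : ∀ x, HasDerivAt w (iteratedDeriv (k+1) u x) x := h.hasDeriv_iter k
  have hdc : Continuous (iteratedDeriv (k+1) u) := (h.iter _).cont
  have hwc := hwS.cont
  set S := √(Y p k u * Y p (k+1) u) with hS
  have hS0 : 0 ≤ S := Real.sqrt_nonneg _
  have hSS : S ^ 2 = Y p k u * Y p (k+1) u := Real.sq_sqrt (mul_nonneg hY0 hY1)
  have hosc : ∀ y, w x ^ 2 - w y ^ 2 ≤ 2 * S := by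
    intro y
    obtain ⟨z, hz, hxz⟩ := hwS.per.exists_mem_Ico hp x y
    rw [hxz]
    have e : w z ^ 2 - w y ^ 2 = 2 * ∫ s in y..z, w s * iteratedDeriv (k+1) u s := by
      rw [← intervalIntegral.integral_const_mul]
      rw [← intervalIntegral.integral_eq_sub_of_hasDerivAt (f := fun s => w s ^ 2)
        (f' := fun s => 2 * (w s * iteratedDeriv (k+1) u s))]
      · intro s _; exact ((hdw s).fun_pow 2).congr_deriv (by push_cast; ring)
      · exact ii_cont (by fun_prop) _ _
    have m1 : ∀ f : ℝ → ℝ, SP p f → ∫ s in y..z, f s ^ 2 ≤ ∫ s in (0:ℝ)..p, f s ^ 2 := by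
      intro f hf
      have : ∫ s in (0:ℝ)..p, f s ^ 2 = ∫ s in y..(y+p), f s ^ 2 := by
        have hper : Function.Periodic (fun s => f s ^ 2) p := fun s => by simp only [hf.per s]
        rw [hper.intervalIntegral_add_eq y 0]; simp
      rw [this]
      exact intervalIntegral.integral_mono_interval le_rfl hz.1 hz.2.le
        (ae_of_all _ fun s => sq_nonneg _) (ii_cont (hf.cont.pow 2) _ _)
    have h1 := cs hwc hdc hz.1
    have h2 : (∫ s in y..z, w s * iteratedDeriv (k+1) u s) ^ 2 ≤ S ^ 2 := by
      rw [hSS]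
      refine h1.trans ?_
      have n1 : 0 ≤ ∫ s in y..z, iteratedDeriv (k+1) u s ^ 2 :=
        intervalIntegral.integral_nonneg hz.1 (fun _ _ => sq_nonneg _)
      exact mul_le_mul (m1 _ hwS) (m1 _ (h.iter (k+1))) n1 hY0
    have := abs_le_of_sq_le_sq h2 hS0
    rw [e]; linarith [(abs_le.mp this).2]
  have h3 : p * (w x ^ 2) ≤ Y p k u + p * (2 * S) := by
    have := int_le_of_le hp (f := fun _ => w x ^ 2) (g := fun y => w y ^ 2 + 2 * S) continuous_const
      (by fun_prop) (fun y => by linarith [hosc y])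
    rw [intervalIntegral.integral_add (ii_cont (by fun_prop) _ _) (ii_cont (by fun_prop) _ _)] at this
    simp only [intervalIntegral.integral_const, smul_eq_mul, sub_zero] at this
    exact this
  have h4 : Y p k u ≤ p * S := by
    rw [hS]
    have := poincare hp h hk
    calc Y p k u = √(Y p k u * Y p k u) := (Real.sqrt_mul_self hY0).symm
      _ ≤ √(p ^ 2 * (Y p k u * Y p (k+1) u)) := by
          apply Real.sqrt_le_sqrt; nlinarith
      _ = p * √(Y p k u * Y p (k+1) u) := by
          rw [Real.sqrt_mul (by positivity), Real.sqrt_sq hp.le]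
  have h5 : w x ^ 2 ≤ 3 * S := by
    have : p * (w x ^ 2) ≤ p * (3 * S) := by linarith
    exact le_of_mul_le_mul_left this hp
  calc (w x ^ 2) ^ 2 ≤ (3 * S) ^ 2 := by gcongr
    _ = _ := by rw [mul_pow, hSS]; norm_num

structure Coef (a : ℝ → ℝ) (c C : ℝ) : Prop where
  smooth : ContDiff ℝ ∞ a
  pos : 0 < c
  lo : ∀ x, c ≤ a x
  hi : ∀ x, a x ≤ C
  bd : ∀ j, ∃ K, ∀ x, |iteratedDeriv j a x| ≤ K

noncomputable def Fop (p : ℝ) (a : ℝ → ℝ) (u : ℝ → ℝ) (x : ℝ) : ℝ :=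
  a (u x) * (iteratedDeriv 2 u x + (u x - mean p u))

lemma smooth_iter {a : ℝ → ℝ} (ha : ContDiff ℝ ∞ a) (j : ℕ) : ContDiff ℝ ∞ (iteratedDeriv j a) := by
  induction j with
  | zero => simpa using ha
  | succ k ih =>
    rw [iteratedDeriv_succ]
    have := ih
    rw [show (∞ : WithTop ℕ∞) = ∞ + 1 from rfl, contDiff_succ_iff_deriv] at this
    exact this.2.2

lemma hasDeriv_iter {a : ℝ → ℝ} (ha : ContDiff ℝ ∞ a) (j : ℕ) (x : ℝ) :
    HasDerivAt (iteratedDeriv j a) (iteratedDeriv (j+1) a x) x := by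
  rw [iteratedDeriv_succ]
  exact ((smooth_iter ha j).differentiable (by simp) x).hasDerivAt

/-- local differential expressions of order at most `r` -/
inductive Loc (p : ℝ) (a : ℝ → ℝ) : ℕ → ((ℝ → ℝ) → ℝ → ℝ) → Prop
  | der (r i : ℕ) (h1 : 1 ≤ i) (hr : i ≤ r) : Loc p a r (fun u => iteratedDeriv i u)
  | dev (r : ℕ) : Loc p a r (fun u x => u x - mean p u)
  | coef (r j : ℕ) : Loc p a r (fun u x => iteratedDeriv j a (u x))
  | const (r : ℕ) (c : ℝ) : Loc p a r (fun _ _ => c)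
  | add (r : ℕ) (P Q : (ℝ → ℝ) → ℝ → ℝ) (hP : Loc p a r P) (hQ : Loc p a r Q) :
      Loc p a r (fun u x => P u x + Q u x)
  | mul (r : ℕ) (P Q : (ℝ → ℝ) → ℝ → ℝ) (hP : Loc p a r P) (hQ : Loc p a r Q) :
      Loc p a r (fun u x => P u x * Q u x)

namespace Loc
variable {p : ℝ} {a : ℝ → ℝ}

lemma mono {r s : ℕ} {Q} (hQ : Loc p a r Q) (h : r ≤ s) : Loc p a s Q := by
  induction hQ with
  | der i h1 hr => exact der _ _ h1 (hr.trans h)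
  | dev => exact dev _
  | coef j => exact coef _ _
  | const c => exact const _ _
  | add P Q _ _ h1 h2 => exact add _ _ _ h1 h2
  | mul P Q _ _ h1 h2 => exact mul _ _ _ h1 h2

lemma sp (ha : ContDiff ℝ ∞ a) {r : ℕ} {Q} (hQ : Loc p a r Q) {u : ℝ → ℝ} (hu : SP p u) : SP p (Q u) := by
  induction hQ with
  | der i h1 hr => exact hu.iter i
  | dev => exact hu.sub (SP.const _)
  | coef j => exact SP.comp (smooth_iter ha j) hu
  | const c => exact SP.const _
  | add P Q _ _ h1 h2 => exact h1.add h2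
  | mul P Q _ _ h1 h2 => exact h1.mul h2

lemma bound {c C : ℝ} (hp : 0 < p) (ha : Coef a c C) {r : ℕ} {Q} (hQ : Loc p a r Q) (B : ℝ) :
    ∃ K, 0 ≤ K ∧ ∀ u, SP p u → (∀ j, 1 ≤ j → j ≤ r + 1 → Y p j u ≤ B) → ∀ x, |Q u x| ≤ K := by
  induction hQ with
  | der i h1 hr =>
    refine ⟨√(p * B), Real.sqrt_nonneg _, fun u hu hB x => ?_⟩
    apply Real.abs_le_sqrt
    exact (sup_iter hp hu h1 x).trans (mul_le_mul_of_nonneg_left (hB _ (by omega) (by omega)) hp.le)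
  | dev =>
    refine ⟨√(p * B), Real.sqrt_nonneg _, fun u hu hB x => ?_⟩
    apply Real.abs_le_sqrt
    exact (sup_dev hp hu x).trans (mul_le_mul_of_nonneg_left (hB _ (by omega) (by omega)) hp.le)
  | coef j =>
    obtain ⟨K, hK⟩ := ha.bd j
    exact ⟨K, (abs_nonneg _).trans (hK 0), fun u hu hB x => hK _⟩
  | const c => exact ⟨|c|, abs_nonneg _, fun u hu hB x => le_rfl⟩
  | add P Q _ _ h1 h2 =>
    obtain ⟨K1, n1, h1⟩ := h1
    obtain ⟨K2, n2, h2⟩ := h2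
    exact ⟨K1 + K2, by positivity, fun u hu hB x =>
      (abs_add_le _ _).trans (add_le_add (h1 u hu hB x) (h2 u hu hB x))⟩
  | mul P Q _ _ h1 h2 =>
    obtain ⟨K1, n1, h1⟩ := h1
    obtain ⟨K2, n2, h2⟩ := h2
    exact ⟨K1 * K2, by positivity, fun u hu hB x => by
      rw [abs_mul]; exact mul_le_mul (h1 u hu hB x) (h2 u hu hB x) (abs_nonneg _) n1⟩

lemma deriv_ex (ha : ContDiff ℝ ∞ a) {r : ℕ} {Q} (hQ : Loc p a r Q) :
    ∃ Q', Loc p a (r+1) Q' ∧ ∀ u, SP p u → ∀ x, HasDerivAt (Q u) (Q' u x) x := by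
  induction hQ with
  | der i h1 hr => exact ⟨_, der _ (i+1) (by omega) (by omega), fun u hu x => hu.hasDeriv_iter i x⟩
  | dev =>
    refine ⟨_, der _ 1 le_rfl (by omega), fun u hu x => ?_⟩
    have := (hu.hasDeriv x).sub_const (mean p u)
    simpa using this
  | coef j =>
    refine ⟨_, mul _ _ _ (coef _ (j+1)) (der _ 1 le_rfl (by omega)), fun u hu x => ?_⟩
    simp only [iteratedDeriv_one]
    exact (hasDeriv_iter ha j (u x)).comp x (hu.hasDeriv x)
  | const c => exact ⟨_, const _ 0, fun u hu x => hasDerivAt_const _ _⟩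
  | add P Q _ _ h1 h2 =>
    obtain ⟨P', l1, h1⟩ := h1
    obtain ⟨Q', l2, h2⟩ := h2
    exact ⟨_, add _ _ _ l1 l2, fun u hu x => (h1 u hu x).fun_add (h2 u hu x)⟩
  | mul P Q p1 p2 h1 h2 =>
    obtain ⟨P', l1, h1⟩ := h1
    obtain ⟨Q', l2, h2⟩ := h2
    exact ⟨_, add _ _ _ (mul _ _ _ l1 (p2.mono (by omega))) (mul _ _ _ (p1.mono (by omega)) l2),
      fun u hu x => (h1 u hu x).fun_mul (h2 u hu x)⟩
end Loc

lemma Fop_loc (p : ℝ) (a : ℝ → ℝ) : Loc p a 2 (Fop p a) := by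
  have := Loc.mul 2 _ _ (Loc.coef (p := p) (a := a) 2 0) (Loc.add 2 _ _ (Loc.der 2 2 (by norm_num) le_rfl) (Loc.dev 2))
  simp only [iteratedDeriv_zero] at this
  exact this

lemma Fop_sp {p : ℝ} {a : ℝ → ℝ} (ha : ContDiff ℝ ∞ a) {u : ℝ → ℝ} (hu : SP p u) : SP p (Fop p a u) :=
  (Fop_loc p a).sp ha hu

section explicitDerivs
variable {p : ℝ} {a u : ℝ → ℝ}

noncomputable def F1 (p : ℝ) (a u : ℝ → ℝ) (x : ℝ) : ℝ :=
  a (u x) * iteratedDeriv 3 u x + iteratedDeriv 1 a (u x) * iteratedDeriv 1 u x * iteratedDeriv 2 u x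
  + iteratedDeriv 1 a (u x) * iteratedDeriv 1 u x * (u x - mean p u) + a (u x) * iteratedDeriv 1 u x

noncomputable def F2 (p : ℝ) (a u : ℝ → ℝ) (x : ℝ) : ℝ :=
  a (u x) * iteratedDeriv 4 u x + 2 * iteratedDeriv 1 a (u x) * iteratedDeriv 1 u x * iteratedDeriv 3 u x
  + (iteratedDeriv 1 a (u x) * iteratedDeriv 2 u x ^ 2
  + iteratedDeriv 2 a (u x) * iteratedDeriv 1 u x ^ 2 * iteratedDeriv 2 u x
  + iteratedDeriv 2 a (u x) * iteratedDeriv 1 u x ^ 2 * (u x - mean p u)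
  + iteratedDeriv 1 a (u x) * iteratedDeriv 2 u x * (u x - mean p u)
  + 2 * iteratedDeriv 1 a (u x) * iteratedDeriv 1 u x ^ 2 + a (u x) * iteratedDeriv 2 u x)

noncomputable def F3 (p : ℝ) (a u : ℝ → ℝ) (x : ℝ) : ℝ :=
  a (u x) * iteratedDeriv 5 u x + 3 * (iteratedDeriv 1 a (u x) * iteratedDeriv 1 u x) * iteratedDeriv 4 u x
  + (3 * (iteratedDeriv 2 a (u x) * (iteratedDeriv 1 u x * iteratedDeriv 1 u x)) + 4 * (iteratedDeriv 1 a (u x) * iteratedDeriv 2 u x)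
    + iteratedDeriv 1 a (u x) * (u x - mean p u) + iteratedDeriv 0 a (u x)) * iteratedDeriv 3 u x
  + (3 * (iteratedDeriv 2 a (u x) * (iteratedDeriv 1 u x * (iteratedDeriv 2 u x * iteratedDeriv 2 u x)))
    + iteratedDeriv 3 a (u x) * (iteratedDeriv 1 u x * (iteratedDeriv 1 u x * (iteratedDeriv 1 u x * iteratedDeriv 2 u x)))
    + iteratedDeriv 3 a (u x) * (iteratedDeriv 1 u x * (iteratedDeriv 1 u x * (iteratedDeriv 1 u x * (u x - mean p u))))
    + 3 * (iteratedDeriv 2 a (u x) * (iteratedDeriv 1 u x * (iteratedDeriv 2 u x * (u x - mean p u))))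
    + 3 * (iteratedDeriv 2 a (u x) * (iteratedDeriv 1 u x * (iteratedDeriv 1 u x * iteratedDeriv 1 u x)))
    + 6 * (iteratedDeriv 1 a (u x) * (iteratedDeriv 1 u x * iteratedDeriv 2 u x)))

lemma hd_u (hu : SP p u) (x : ℝ) : HasDerivAt u (iteratedDeriv 1 u x) x := by
  simpa using hu.hasDeriv x
lemma hd_a (ha : ContDiff ℝ ∞ a) (hu : SP p u) (j : ℕ) (x : ℝ) :
    HasDerivAt (fun x => iteratedDeriv j a (u x)) (iteratedDeriv (j+1) a (u x) * iteratedDeriv 1 u x) x :=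
  (hasDeriv_iter ha j (u x)).comp x (hd_u hu x)

lemma hasDeriv_F0 (ha : ContDiff ℝ ∞ a) (hu : SP p u) (x : ℝ) :
    HasDerivAt (Fop p a u) (F1 p a u x) x := by
  have h := (hd_a ha hu 0 x).fun_mul ((hu.hasDeriv_iter 2 x).fun_add ((hd_u hu x).sub_const (mean p u)))
  simp only [iteratedDeriv_zero, zero_add] at h
  refine h.congr_deriv ?_
  unfold F1; ring

lemma hasDeriv_F1 (ha : ContDiff ℝ ∞ a) (hu : SP p u) (x : ℝ) :
    HasDerivAt (F1 p a u) (F2 p a u x) x := by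
  have a0 := hd_a ha hu 0 x
  have a1 := hd_a ha hu 1 x
  have d1 := hu.hasDeriv_iter 1 x
  have d2 := hu.hasDeriv_iter 2 x
  have d3 := hu.hasDeriv_iter 3 x
  have w := (hd_u hu x).sub_const (mean p u)
  have h := (((a0.fun_mul d3).fun_add ((a1.fun_mul d1).fun_mul d2)).fun_add ((a1.fun_mul d1).fun_mul w)).fun_add (a0.fun_mul d1)
  simp only [iteratedDeriv_zero, zero_add] at h
  refine h.congr_deriv ?_
  norm_num
  unfold F2; norm_num; ring

lemma hasDeriv_F2 (ha : ContDiff ℝ ∞ a) (hu : SP p u) (x : ℝ) :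
    HasDerivAt (F2 p a u) (F3 p a u x) x := by
  have a0 := hd_a ha hu 0 x
  have a1 := hd_a ha hu 1 x
  have a2 := hd_a ha hu 2 x
  have d1 := hu.hasDeriv_iter 1 x
  have d2 := hu.hasDeriv_iter 2 x
  have d3 := hu.hasDeriv_iter 3 x
  have d4 := hu.hasDeriv_iter 4 x
  have w := (hd_u hu x).sub_const (mean p u)
  have h := ((a0.fun_mul d4).fun_add (((a1.const_mul 2).fun_mul d1).fun_mul d3)).fun_add
    ((((((a1.fun_mul (d2.fun_pow 2)).fun_add ((a2.fun_mul (d1.fun_pow 2)).fun_mul d2)).fun_add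
      ((a2.fun_mul (d1.fun_pow 2)).fun_mul w)).fun_add ((a1.fun_mul d2).fun_mul w)).fun_add
      ((a1.const_mul 2).fun_mul (d1.fun_pow 2))).fun_add (a0.fun_mul d2))
  simp only [iteratedDeriv_zero, zero_add] at h
  refine h.congr_deriv ?_
  norm_num
  unfold F3; norm_num; ring

lemma iter_F1 (ha : ContDiff ℝ ∞ a) (hu : SP p u) : iteratedDeriv 1 (Fop p a u) = F1 p a u := by
  rw [iteratedDeriv_one]; ext x; exact (hasDeriv_F0 ha hu x).deriv
lemma iter_F2 (ha : ContDiff ℝ ∞ a) (hu : SP p u) : iteratedDeriv 2 (Fop p a u) = F2 p a u := by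
  rw [iteratedDeriv_succ, iter_F1 ha hu]; ext x; exact (hasDeriv_F1 ha hu x).deriv
lemma iter_F3 (ha : ContDiff ℝ ∞ a) (hu : SP p u) : iteratedDeriv 3 (Fop p a u) = F3 p a u := by
  rw [iteratedDeriv_succ, iter_F2 ha hu]; ext x; exact (hasDeriv_F2 ha hu x).deriv
end explicitDerivs

/-- structure of high derivatives: with `k = q + 4` -/
lemma F_struct {p : ℝ} {a : ℝ → ℝ} (ha : ContDiff ℝ ∞ a) (q : ℕ) :
    ∃ P1 P2 P3, Loc p a 1 P1 ∧ Loc p a 2 P2 ∧ Loc p a (q+2) P3 ∧ ∀ u, SP p u → ∀ x,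
      iteratedDeriv (q+3) (Fop p a u) x = a (u x) * iteratedDeriv (q+5) u x
        + P1 u x * iteratedDeriv (q+4) u x + P2 u x * iteratedDeriv (q+3) u x + P3 u x := by
  induction q with
  | zero =>
    have d1 := Loc.der (p := p) (a := a) 2 1 (by norm_num) (by norm_num)
    have d2 := Loc.der (p := p) (a := a) 2 2 (by norm_num) (by norm_num)
    have w := Loc.dev (p := p) (a := a) 2
    have A := fun j => Loc.coef (p := p) (a := a) 2 j
    have c := fun s => Loc.const (p := p) (a := a) 2 s
    refine ⟨_, _, _, Loc.mul _ _ _ (Loc.const 1 3) (Loc.mul _ _ _ (Loc.coef 1 1) (Loc.der 1 1 le_rfl le_rfl)),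
      .add _ _ _ (.add _ _ _ (.add _ _ _ (.mul _ _ _ (c 3) (.mul _ _ _ (A 2) (.mul _ _ _ d1 d1)))
        (.mul _ _ _ (c 4) (.mul _ _ _ (A 1) d2))) (.mul _ _ _ (A 1) w)) (A 0),
      .add _ _ _ (.add _ _ _ (.add _ _ _ (.add _ _ _ (.add _ _ _
        (.mul _ _ _ (c 3) (.mul _ _ _ (A 2) (.mul _ _ _ d1 (.mul _ _ _ d2 d2))))
        (.mul _ _ _ (A 3) (.mul _ _ _ d1 (.mul _ _ _ d1 (.mul _ _ _ d1 d2)))))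
        (.mul _ _ _ (A 3) (.mul _ _ _ d1 (.mul _ _ _ d1 (.mul _ _ _ d1 w)))))
        (.mul _ _ _ (c 3) (.mul _ _ _ (A 2) (.mul _ _ _ d1 (.mul _ _ _ d2 w)))))
        (.mul _ _ _ (c 3) (.mul _ _ _ (A 2) (.mul _ _ _ d1 (.mul _ _ _ d1 d1)))))
        (.mul _ _ _ (c 6) (.mul _ _ _ (A 1) (.mul _ _ _ d1 d2))), ?_⟩
    intro u hu x
    have := congrFun (iter_F3 ha hu) x
    rw [zero_add, this]; unfold F3; ring
  | succ q ih =>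
    obtain ⟨P1, P2, P3, l1, l2, l3, h⟩ := ih
    obtain ⟨P1', l1', h1⟩ := l1.deriv_ex ha
    obtain ⟨P2', l2', h2⟩ := l2.deriv_ex ha
    obtain ⟨P3', l3', h3⟩ := l3.deriv_ex ha
    refine ⟨_, _, _, Loc.add _ _ _ (Loc.mul _ _ _ (Loc.coef 1 1) (Loc.der 1 1 le_rfl le_rfl)) l1,
      Loc.add _ _ _ l1' l2, Loc.add _ _ _ (Loc.mul _ _ _ (l2'.mono (by omega)) (Loc.der _ (q+3) (by omega) (by omega)))
        l3', ?_⟩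
    intro u hu x
    have e : iteratedDeriv (q+3) (Fop p a u) = fun x => a (u x) * iteratedDeriv (q+5) u x
        + P1 u x * iteratedDeriv (q+4) u x + P2 u x * iteratedDeriv (q+3) u x + P3 u x := funext (h u hu)
    rw [show q + 1 + 3 = (q + 3) + 1 by ring, iteratedDeriv_succ, e]
    have a0 := hd_a ha hu 0 x
    simp only [iteratedDeriv_zero, zero_add] at a0
    have := (((a0.fun_mul (hu.hasDeriv_iter (q+5) x)).fun_add ((h1 u hu x).fun_mul (hu.hasDeriv_iter (q+4) x))).fun_add
      ((h2 u hu x).fun_mul (hu.hasDeriv_iter (q+3) x))).fun_add (h3 u hu x)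
    rw [this.deriv]
    rw [show q + 1 + 5 = q+5+1 by ring, show q+1+4 = q+4+1 by ring, show q+3+1 = q+4 by ring, show q+4+1 = q+5 by ring]
    ring

lemma int_add_le {p : ℝ} {f g : ℝ → ℝ} (hf : Continuous f) (hg : Continuous g) :
    ∫ x in (0:ℝ)..p, (f x + g x) = (∫ x in (0:ℝ)..p, f x) + ∫ x in (0:ℝ)..p, g x :=
  intervalIntegral.integral_add (ii_cont hf _ _) (ii_cont hg _ _)

/-- energy inequality at first order -/
lemma energy1 {p c C : ℝ} {a : ℝ → ℝ} (hp : 0 < p) (ha : Coef a c C) {u : ℝ → ℝ} (hu : SP p u) :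
    -(∫ x in (0:ℝ)..p, iteratedDeriv 2 u x * Fop p a u x) ≤ C / 4 * p ^ 2 * Y p 1 u := by
  have c0 := hu.cont
  have c2 := (hu.iter 2).cont
  have cF := (Fop_sp ha.smooth hu).cont
  have hC : 0 ≤ C := ha.pos.le.trans ((ha.lo 0).trans (ha.hi 0))
  rw [← intervalIntegral.integral_neg]
  calc _ ≤ ∫ x in (0:ℝ)..p, C / 4 * (u x - mean p u) ^ 2 := by
        apply int_le_of_le hp (by fun_prop) (by fun_prop)
        intro x
        have h1 := ha.lo (u x)
        have h2 := ha.hi (u x)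
        have h3 := ha.pos
        unfold Fop
        nlinarith [mul_nonneg (h3.le.trans h1) (sq_nonneg (iteratedDeriv 2 u x + (u x - mean p u) / 2)),
          mul_nonneg (sub_nonneg.2 h2) (sq_nonneg (u x - mean p u))]
    _ = C / 4 * ∫ x in (0:ℝ)..p, (u x - mean p u) ^ 2 := by
        rw [intervalIntegral.integral_const_mul]
    _ ≤ C / 4 * (p ^ 2 * Y p 1 u) := mul_le_mul_of_nonneg_left (poincare0 hp hu) (by positivity)
    _ = _ := by ring

lemma energy_of_rem {p c C : ℝ} {a : ℝ → ℝ} (hp : 0 < p) (ha : Coef a c C) {u : ℝ → ℝ} (hu : SP p u)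
    (k : ℕ) {R : ℝ → ℝ} (hR : Continuous R)
    (hF : ∀ x, iteratedDeriv k (Fop p a u) x = a (u x) * iteratedDeriv (k+2) u x + R x) {K : ℝ}
    (hK : ∫ x in (0:ℝ)..p, R x ^ 2 ≤ c ^ 2 / 4 * Y p (k+2) u + K) :
    -(∫ x in (0:ℝ)..p, iteratedDeriv (k+2) u x * iteratedDeriv k (Fop p a u) x)
      ≤ K / c - c / 2 * Y p (k+2) u := by
  have c0 := hu.cont
  have c2 := (hu.iter (k+2)).cont
  have cF := ((Fop_sp ha.smooth hu).iter k).cont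
  have hc := ha.pos
  have h1 : -(∫ x in (0:ℝ)..p, iteratedDeriv (k+2) u x * iteratedDeriv k (Fop p a u) x)
      ≤ ∫ x in (0:ℝ)..p, (-(3 * c / 4) * (iteratedDeriv (k+2) u x) ^ 2 + 1 / c * R x ^ 2) := by
    rw [← intervalIntegral.integral_neg]
    apply int_le_of_le hp (by fun_prop) (by fun_prop)
    intro x
    rw [hF]
    have h1 := ha.lo (u x)
    have e : 1 / c * R x ^ 2 = c * (R x / c) ^ 2 := by field_simp
    have e2 : R x = c * (R x / c) := by field_simp
    rw [e]
    set r := R x / c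
    rw [e2]
    nlinarith [mul_nonneg (sub_nonneg.2 h1) (sq_nonneg (iteratedDeriv (k+2) u x)),
      mul_nonneg hc.le (sq_nonneg (iteratedDeriv (k+2) u x / 2 + r))]
  rw [int_add_le (by fun_prop) (by fun_prop), intervalIntegral.integral_const_mul,
    intervalIntegral.integral_const_mul] at h1
  have h2 := mul_le_mul_of_nonneg_left hK (by positivity : 0 ≤ 1 / c)
  have e : 1 / c * (c ^ 2 / 4 * Y p (k+2) u + K) = c / 4 * Y p (k+2) u + K / c := by field_simp
  have e3 : ∫ x in (0:ℝ)..p, (iteratedDeriv (k+2) u x) ^ 2 = Y p (k+2) u := rfl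
  rw [e3] at h1
  linarith

lemma rem_eps (B S K : ℝ) (hB : 0 ≤ B) (hS : 0 ≤ S) (hK : 0 ≤ K) {e : ℝ} (he : 0 < e) :
    ∃ K', ∀ y z I : ℝ, 0 ≤ y → 0 ≤ z → y ^ 2 ≤ B * z → I ≤ S * y + K → I ≤ e * z + K' := by
  refine ⟨S ^ 2 * B / (4 * e) + K, fun y z I hy hz h1 h2 => ?_⟩
  by_cases hSe : S * y ≤ e * z
  · have : 0 ≤ S ^ 2 * B / (4 * e) := by positivity
    linarith
  · push Not at hSe
    have h3 : (S * y) ^ 2 ≤ S ^ 2 * B * z := by nlinarith [sq_nonneg S]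
    have h4 : S * y ≤ e * z + S ^ 2 * B / (4 * e) := by
      by_contra hh
      push Not at hh
      have h5 : 0 < S * y := lt_of_le_of_lt (by positivity) hSe
      have h6 : (e * z + S ^ 2 * B / (4 * e)) ^ 2 < (S * y) ^ 2 :=
        pow_lt_pow_left₀ hh (by positivity) (by norm_num)
      have h7 : S ^ 2 * B * z ≤ (e * z + S ^ 2 * B / (4 * e)) ^ 2 := by
        have : S ^ 2 * B * z = 4 * (e * z) * (S ^ 2 * B / (4 * e)) := by field_simp
        rw [this]; nlinarith [sq_nonneg (e * z - S ^ 2 * B / (4 * e))]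
      linarith
    linarith

lemma energy2 {p c C : ℝ} {a : ℝ → ℝ} (hp : 0 < p) (ha : Coef a c C) (B : ℝ) (hB : 0 ≤ B) :
    ∃ Φ, ∀ u, SP p u → (∀ j, 1 ≤ j → j ≤ 1 → Y p j u ≤ B) →
      -(∫ x in (0:ℝ)..p, iteratedDeriv 3 u x * iteratedDeriv 1 (Fop p a u) x) ≤ Φ - c / 2 * Y p 3 u := by
  obtain ⟨A, hA⟩ := ha.bd 1
  have hA0 : 0 ≤ A := (abs_nonneg _).trans (hA 0)
  have hC : 0 ≤ C := ha.pos.le.trans ((ha.lo 0).trans (ha.hi 0))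
  have hc := ha.pos
  set η : ℝ := c ^ 2 / 4 / (3 * A ^ 2 + 1) with hη
  have hη0 : 0 < η := by positivity
  set K0 : ℝ := 81 * B ^ 5 / η ^ 3 with hK0
  have hK00 : 0 ≤ K0 := by positivity
  refine ⟨(3 * A ^ 2 * K0 + (3 * A ^ 2 * (p * B) + 3 * C ^ 2) * B) / c, fun u hu hY => ?_⟩
  have hY1 := hY 1 le_rfl le_rfl
  have n1 := Y_nonneg hp 1 u
  have n2 := Y_nonneg hp 2 u
  have n3 := Y_nonneg hp 3 u
  have c0 := hu.cont
  have c1 := (hu.iter 1).cont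
  have c2 := (hu.iter 2).cont
  have ca0 := ha.smooth.continuous
  have ca := (smooth_iter ha.smooth 1).continuous
  refine energy_of_rem hp ha hu 1
    (R := fun x => iteratedDeriv 1 a (u x) * iteratedDeriv 1 u x * iteratedDeriv 2 u x
      + iteratedDeriv 1 a (u x) * iteratedDeriv 1 u x * (u x - mean p u) + a (u x) * iteratedDeriv 1 u x)
    (by fun_prop) (fun x => by rw [iter_F1 ha.smooth hu]; unfold F1; norm_num; ring) ?_
  -- bound of the main term
  set S := √(9 * (B * Y p 2 u)) with hS
  have hSx : ∀ x, iteratedDeriv 1 u x ^ 2 ≤ S := fun x => by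
    apply Real.le_sqrt_of_sq_le
    have := sup_interp hp hu (k := 1) le_rfl x
    refine this.trans ?_
    have := mul_le_mul_of_nonneg_right hY1 n2
    norm_num
    linarith
  have hS0 : 0 ≤ S := Real.sqrt_nonneg _
  have hS2 : S ^ 2 = 9 * (B * Y p 2 u) := Real.sq_sqrt (by positivity)
  have hyInt := Y_interp hp hu 1
  norm_num at hyInt
  have hyInt' : Y p 2 u ^ 2 ≤ B * Y p 3 u := hyInt.trans (mul_le_mul_of_nonneg_right hY1 n3)
  have hX : S * Y p 2 u ≤ η * Y p 3 u + K0 := by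
    by_cases hle : S * Y p 2 u ≤ η * Y p 3 u
    · linarith
    push Not at hle
    set X := S * Y p 2 u with hXdef
    have hXp : 0 < X := lt_of_le_of_lt (by positivity) hle
    have h4 : X ^ 4 ≤ 81 * B ^ 5 * Y p 3 u ^ 3 := by
      have e : X ^ 4 = 81 * B ^ 2 * (Y p 2 u ^ 2) ^ 3 := by
        calc X ^ 4 = (S ^ 2) ^ 2 * Y p 2 u ^ 4 := by rw [hXdef]; ring
          _ = _ := by rw [hS2]; ring
      rw [e]
      calc 81 * B ^ 2 * (Y p 2 u ^ 2) ^ 3 ≤ 81 * B ^ 2 * (B * Y p 3 u) ^ 3 := by gcongr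
        _ = _ := by ring
    have h5 : Y p 3 u ≤ X / η := by rw [le_div_iff₀ hη0]; linarith
    have h6 : X ^ 4 ≤ 81 * B ^ 5 * (X / η) ^ 3 := h4.trans (by gcongr)
    have h7 : X * X ^ 3 ≤ K0 * X ^ 3 := by
      calc X * X ^ 3 = X ^ 4 := by ring
        _ ≤ _ := h6
        _ = K0 * X ^ 3 := by rw [hK0]; field_simp
    have := le_of_mul_le_mul_right h7 (by positivity)
    nlinarith [mul_nonneg hη0.le n3]
  calc ∫ x in (0:ℝ)..p, (iteratedDeriv 1 a (u x) * iteratedDeriv 1 u x * iteratedDeriv 2 u x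
      + iteratedDeriv 1 a (u x) * iteratedDeriv 1 u x * (u x - mean p u) + a (u x) * iteratedDeriv 1 u x) ^ 2
      ≤ ∫ x in (0:ℝ)..p, (3 * A ^ 2 * S * iteratedDeriv 2 u x ^ 2 + (3 * A ^ 2 * (p * B) + 3 * C ^ 2) * iteratedDeriv 1 u x ^ 2) := by
        apply int_le_of_le hp (by fun_prop) (by fun_prop)
        intro x
        set d1 := iteratedDeriv 1 u x
        set d2 := iteratedDeriv 2 u x
        set A1 := iteratedDeriv 1 a (u x)
        set w := u x - mean p u
        have e1 : A1 ^ 2 ≤ A ^ 2 := sq_le_sq' (by linarith [(abs_le.1 (hA (u x))).1]) (abs_le.1 (hA (u x))).2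
        have e2 : w ^ 2 ≤ p * B := (sup_dev hp hu x).trans (mul_le_mul_of_nonneg_left hY1 hp.le)
        have e3 : a (u x) ^ 2 ≤ C ^ 2 := pow_le_pow_left₀ (hc.le.trans (ha.lo _)) (ha.hi _) 2
        have e4 := hSx x
        have g1 : A1 ^ 2 * d1 ^ 2 * d2 ^ 2 ≤ A ^ 2 * S * d2 ^ 2 := by gcongr
        have g2 : A1 ^ 2 * d1 ^ 2 * w ^ 2 ≤ A ^ 2 * d1 ^ 2 * (p * B) := by gcongr
        have g3 : a (u x) ^ 2 * d1 ^ 2 ≤ C ^ 2 * d1 ^ 2 := by gcongr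
        nlinarith [sq_nonneg (A1 * d1 * d2 - A1 * d1 * w), sq_nonneg (A1 * d1 * d2 - a (u x) * d1),
          sq_nonneg (A1 * d1 * w - a (u x) * d1)]
    _ = 3 * A ^ 2 * S * Y p 2 u + (3 * A ^ 2 * (p * B) + 3 * C ^ 2) * Y p 1 u := by
        rw [int_add_le (by fun_prop) (by fun_prop), intervalIntegral.integral_const_mul,
          intervalIntegral.integral_const_mul]; rfl
    _ ≤ 3 * A ^ 2 * (η * Y p 3 u + K0) + (3 * A ^ 2 * (p * B) + 3 * C ^ 2) * B := by
        have g1 := mul_le_mul_of_nonneg_left hX (by positivity : 0 ≤ 3 * A ^ 2)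
        have g2 := mul_le_mul_of_nonneg_left hY1 (by positivity : 0 ≤ 3 * A ^ 2 * (p * B) + 3 * C ^ 2)
        linarith
    _ ≤ c ^ 2 / 4 * Y p (1+2) u + (3 * A ^ 2 * K0 + (3 * A ^ 2 * (p * B) + 3 * C ^ 2) * B) := by
        norm_num
        have : 3 * A ^ 2 * η ≤ c ^ 2 / 4 := by
          rw [hη, mul_div_assoc', div_le_iff₀ (by positivity)]
          nlinarith [sq_nonneg A, sq_nonneg c]
        nlinarith [mul_le_mul_of_nonneg_right this n3]

lemma Loc_cont {p c C : ℝ} {a : ℝ → ℝ} (ha : Coef a c C) {r : ℕ} {Q} (hQ : Loc p a r Q) {u} (hu : SP p u) :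
    Continuous (Q u) := (hQ.sp ha.smooth hu).cont

lemma energy3 {p c C : ℝ} {a : ℝ → ℝ} (hp : 0 < p) (ha : Coef a c C) (B : ℝ) (hB : 0 ≤ B) :
    ∃ Φ, ∀ u, SP p u → (∀ j, 1 ≤ j → j ≤ 2 → Y p j u ≤ B) →
      -(∫ x in (0:ℝ)..p, iteratedDeriv 4 u x * iteratedDeriv 2 (Fop p a u) x) ≤ Φ - c / 2 * Y p 4 u := by
  have d1 := Loc.der (p := p) (a := a) 1 1 (by norm_num) (by norm_num)
  have w := Loc.dev (p := p) (a := a) 1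
  have A := fun j => Loc.coef (p := p) (a := a) 1 j
  have cc := fun s => Loc.const (p := p) (a := a) 1 s
  have hc := ha.pos
  obtain ⟨P, lP, hPe⟩ : ∃ P, Loc p a 1 P ∧ ∀ u x, P u x = 2 * iteratedDeriv 1 a (u x) * iteratedDeriv 1 u x :=
    ⟨_, .mul _ _ _ (cc 2) (.mul _ _ _ (A 1) d1), fun u x => by ring⟩
  obtain ⟨Q, lQ, hQe⟩ : ∃ P, Loc p a 1 P ∧ ∀ u x, P u x = iteratedDeriv 2 a (u x) * iteratedDeriv 1 u x ^ 2
      + iteratedDeriv 1 a (u x) * (u x - mean p u) + a (u x) :=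
    ⟨_, .add _ _ _ (.mul _ _ _ (A 2) (.mul _ _ _ d1 d1)) (.add _ _ _ (.mul _ _ _ (A 1) w) (A 0)), fun u x => by
      simp only [iteratedDeriv_zero]; ring⟩
  obtain ⟨S, lS, hSe⟩ : ∃ P, Loc p a 1 P ∧ ∀ u x, P u x = iteratedDeriv 2 a (u x) * iteratedDeriv 1 u x ^ 2 * (u x - mean p u)
      + 2 * iteratedDeriv 1 a (u x) * iteratedDeriv 1 u x ^ 2 :=
    ⟨_, .add _ _ _ (.mul _ _ _ (A 2) (.mul _ _ _ d1 (.mul _ _ _ d1 w))) (.mul _ _ _ (cc 2) (.mul _ _ _ (A 1) (.mul _ _ _ d1 d1))), fun u x => by ring⟩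
  obtain ⟨kP, nP, bP⟩ := lP.bound hp ha B
  obtain ⟨kQ, nQ, bQ⟩ := lQ.bound hp ha B
  obtain ⟨kS, nS, bS⟩ := lS.bound hp ha B
  obtain ⟨kA, nA, bA⟩ := (A 1).bound hp ha B
  obtain ⟨K', hK'⟩ := rem_eps B (4 * kP ^ 2 + 4 * kA ^ 2 * (p * B)) (4 * kQ ^ 2 * B + p * (4 * kS ^ 2)) hB
    (by positivity) (by positivity) (by positivity : 0 < c ^ 2 / 4)
  refine ⟨K' / c, fun u hu hY => ?_⟩
  have hY' : ∀ j, 1 ≤ j → j ≤ 1 + 1 → Y p j u ≤ B := hY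
  have cP := Loc_cont ha lP hu
  have cQ := Loc_cont ha lQ hu
  have cS := Loc_cont ha lS hu
  have cA := Loc_cont ha (A 1) hu
  have c2 := (hu.iter 2).cont
  have c3 := (hu.iter 3).cont
  refine energy_of_rem hp ha hu 2
    (R := fun x => P u x * iteratedDeriv 3 u x + iteratedDeriv 1 a (u x) * iteratedDeriv 2 u x ^ 2
      + Q u x * iteratedDeriv 2 u x + S u x) (by fun_prop)
    (fun x => by rw [iter_F2 ha.smooth hu, hPe, hQe, hSe]; unfold F2; norm_num; ring) ?_
  have hyInt := Y_interp hp hu 2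
  norm_num at hyInt
  have hY2 := hY 2 (by norm_num) le_rfl
  refine hK' (Y p 3 u) _ _ (Y_nonneg hp _ _) (Y_nonneg hp _ _)
    (hyInt.trans (mul_le_mul_of_nonneg_right hY2 (Y_nonneg hp _ _))) ?_
  calc _ ≤ ∫ x in (0:ℝ)..p, (4 * kP ^ 2 * iteratedDeriv 3 u x ^ 2 + ((4 * kA ^ 2 * (p * Y p 3 u) + 4 * kQ ^ 2) * iteratedDeriv 2 u x ^ 2
          + 4 * kS ^ 2)) := by
        apply int_le_of_le hp (by fun_prop) (by fun_prop)
        intro x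
        have e1 : P u x ^ 2 ≤ kP ^ 2 := sq_le_sq' (by linarith [(abs_le.1 (bP u hu hY' x)).1]) (abs_le.1 (bP u hu hY' x)).2
        have e2 : Q u x ^ 2 ≤ kQ ^ 2 := sq_le_sq' (by linarith [(abs_le.1 (bQ u hu hY' x)).1]) (abs_le.1 (bQ u hu hY' x)).2
        have e3 : S u x ^ 2 ≤ kS ^ 2 := sq_le_sq' (by linarith [(abs_le.1 (bS u hu hY' x)).1]) (abs_le.1 (bS u hu hY' x)).2
        have e4 : iteratedDeriv 1 a (u x) ^ 2 ≤ kA ^ 2 := sq_le_sq' (by linarith [(abs_le.1 (bA u hu hY' x)).1]) (abs_le.1 (bA u hu hY' x)).2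
        have e5 := sup_iter hp hu (k := 2) (by norm_num) x
        norm_num at e5
        set a1 := iteratedDeriv 1 a (u x)
        set d2 := iteratedDeriv 2 u x
        set d3 := iteratedDeriv 3 u x
        have g1 : P u x ^ 2 * d3 ^ 2 ≤ kP ^ 2 * d3 ^ 2 := by gcongr
        have g2 : a1 ^ 2 * d2 ^ 2 * d2 ^ 2 ≤ kA ^ 2 * (p * Y p 3 u) * d2 ^ 2 := by gcongr
        have g3 : Q u x ^ 2 * d2 ^ 2 ≤ kQ ^ 2 * d2 ^ 2 := by gcongr
        nlinarith [sq_nonneg (P u x * d3 - a1 * d2 ^ 2), sq_nonneg (P u x * d3 - Q u x * d2), sq_nonneg (P u x * d3 - S u x),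
          sq_nonneg (a1 * d2 ^ 2 - Q u x * d2), sq_nonneg (a1 * d2 ^ 2 - S u x), sq_nonneg (Q u x * d2 - S u x)]
    _ = 4 * kP ^ 2 * Y p 3 u + ((4 * kA ^ 2 * (p * Y p 3 u) + 4 * kQ ^ 2) * Y p 2 u + p * (4 * kS ^ 2)) := by
        rw [int_add_le (by fun_prop) (by fun_prop), int_add_le (by fun_prop) (by fun_prop), intervalIntegral.integral_const_mul,
          intervalIntegral.integral_const_mul]
        simp only [intervalIntegral.integral_const, smul_eq_mul, sub_zero]; rfl
    _ ≤ _ := by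
        have := mul_le_mul_of_nonneg_left hY2 (by have := Y_nonneg hp 3 u; positivity : 0 ≤ 4 * kA ^ 2 * (p * Y p 3 u) + 4 * kQ ^ 2)
        linarith

lemma energy4 {p c C : ℝ} {a : ℝ → ℝ} (hp : 0 < p) (ha : Coef a c C) (q : ℕ) (B : ℝ) (hB : 0 ≤ B) :
    ∃ Φ, ∀ u, SP p u → (∀ j, 1 ≤ j → j ≤ q + 3 → Y p j u ≤ B) →
      -(∫ x in (0:ℝ)..p, iteratedDeriv (q+5) u x * iteratedDeriv (q+3) (Fop p a u) x) ≤ Φ - c / 2 * Y p (q+5) u := by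
  have hc := ha.pos
  obtain ⟨P, Q, S, lP, lQ, lS, h⟩ := F_struct (p := p) ha.smooth q
  obtain ⟨kP, nP, bP⟩ := lP.bound hp ha B
  obtain ⟨kQ, nQ, bQ⟩ := lQ.bound hp ha B
  obtain ⟨kS, nS, bS⟩ := lS.bound hp ha B
  obtain ⟨K', hK'⟩ := rem_eps B (3 * kP ^ 2) (3 * kQ ^ 2 * B + p * (3 * kS ^ 2)) hB
    (by positivity) (by positivity) (by positivity : 0 < c ^ 2 / 4)
  refine ⟨K' / c, fun u hu hY => ?_⟩
  have cP := Loc_cont ha lP hu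
  have cQ := Loc_cont ha lQ hu
  have cS := Loc_cont ha lS hu
  have c2 := (hu.iter (q+3)).cont
  have c3 := (hu.iter (q+4)).cont
  refine energy_of_rem hp ha hu (q+3)
    (R := fun x => P u x * iteratedDeriv (q+4) u x + Q u x * iteratedDeriv (q+3) u x + S u x) (by fun_prop)
    (fun x => by rw [h u hu]; ring) ?_
  have hY2 := hY (q+3) (by omega) le_rfl
  refine hK' (Y p (q+4) u) _ _ (Y_nonneg hp _ _) (Y_nonneg hp _ _)
    ((Y_interp hp hu (q+3)).trans (mul_le_mul_of_nonneg_right hY2 (Y_nonneg hp _ _))) ?_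
  calc _ ≤ ∫ x in (0:ℝ)..p, (3 * kP ^ 2 * iteratedDeriv (q+4) u x ^ 2 + (3 * kQ ^ 2 * iteratedDeriv (q+3) u x ^ 2
          + 3 * kS ^ 2)) := by
        apply int_le_of_le hp (by fun_prop) (by fun_prop)
        intro x
        have b1 := abs_le.1 (bP u hu (fun j h1 h2 => hY j h1 (by omega)) x)
        have b2 := abs_le.1 (bQ u hu (fun j h1 h2 => hY j h1 (by omega)) x)
        have b3 := abs_le.1 (bS u hu (fun j h1 h2 => hY j h1 (by omega)) x)
        have e1 : P u x ^ 2 ≤ kP ^ 2 := sq_le_sq' (by linarith) b1.2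
        have e2 : Q u x ^ 2 ≤ kQ ^ 2 := sq_le_sq' (by linarith) b2.2
        have e3 : S u x ^ 2 ≤ kS ^ 2 := sq_le_sq' (by linarith) b3.2
        set d2 := iteratedDeriv (q+3) u x
        set d3 := iteratedDeriv (q+4) u x
        have g1 : P u x ^ 2 * d3 ^ 2 ≤ kP ^ 2 * d3 ^ 2 := by gcongr
        have g3 : Q u x ^ 2 * d2 ^ 2 ≤ kQ ^ 2 * d2 ^ 2 := by gcongr
        nlinarith [sq_nonneg (P u x * d3 - Q u x * d2), sq_nonneg (P u x * d3 - S u x),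
          sq_nonneg (Q u x * d2 - S u x)]
    _ = 3 * kP ^ 2 * Y p (q+4) u + (3 * kQ ^ 2 * Y p (q+3) u + p * (3 * kS ^ 2)) := by
        rw [int_add_le (by fun_prop) (by fun_prop), int_add_le (by fun_prop) (by fun_prop), intervalIntegral.integral_const_mul,
          intervalIntegral.integral_const_mul]
        simp only [intervalIntegral.integral_const, smul_eq_mul, sub_zero]; rfl
    _ ≤ _ := by
        have := mul_le_mul_of_nonneg_left hY2 (by positivity : 0 ≤ 3 * kQ ^ 2)
        linarith

/-- energy inequality at order `k + 2` -/
lemma energy {p c C : ℝ} {a : ℝ → ℝ} (hp : 0 < p) (ha : Coef a c C) (k : ℕ) (B : ℝ) (hB : 0 ≤ B) :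
    ∃ Φ, ∀ u, SP p u → (∀ j, 1 ≤ j → j ≤ k + 1 → Y p j u ≤ B) →
      -(∫ x in (0:ℝ)..p, iteratedDeriv (k+3) u x * iteratedDeriv (k+1) (Fop p a u) x) ≤ Φ - c / 2 * Y p (k+3) u := by
  match k with
  | 0 => exact energy2 hp ha B hB
  | 1 => exact energy3 hp ha B hB
  | q + 2 => exact energy4 hp ha q B hB

lemma int_dev_le {p : ℝ} (hp : 0 < p) {d : ℝ → ℝ} (hd : Continuous d) :
    ∫ x in (0:ℝ)..p, (d x - mean p d) ^ 2 ≤ ∫ x in (0:ℝ)..p, d x ^ 2 := by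
  have e : ∀ x, (d x - mean p d) ^ 2 = d x ^ 2 + ((-2 * mean p d) * d x + (mean p d) ^ 2) := fun x => by ring
  simp_rw [e]
  rw [int_add_le (by fun_prop) (by fun_prop), int_add_le (by fun_prop) (by fun_prop), intervalIntegral.integral_const_mul,
    int_eq_mean hp d, intervalIntegral.integral_const]
  simp only [smul_eq_mul, sub_zero]
  nlinarith [mul_nonneg hp.le (sq_nonneg (mean p d))]

lemma coef_lip {a : ℝ → ℝ} {c C A : ℝ} (ha : Coef a c C) (hA : ∀ x, |iteratedDeriv 1 a x| ≤ A) (s t : ℝ) :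
    |a s - a t| ≤ A * |s - t| := by
  have := Convex.norm_image_sub_le_of_norm_hasDerivWithin_le (f := a) (f' := iteratedDeriv 1 a) (s := Set.univ) (C := A)
    (x := t) (y := s)
    (fun x _ => by
      have := hasDeriv_iter ha.smooth 0 x
      simp only [iteratedDeriv_zero, zero_add] at this
      exact this.hasDerivWithinAt) (fun x _ => hA x) convex_univ
    (Set.mem_univ _) (Set.mem_univ _)
  simpa using this

lemma diff_est {p c C : ℝ} {a : ℝ → ℝ} (hp : 0 < p) (ha : Coef a c C) (B : ℝ) :
    ∃ K, 0 ≤ K ∧ ∀ u v, SP p u → SP p v → (∀ j, 1 ≤ j → j ≤ 3 → Y p j u ≤ B) →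
      (∀ j, 1 ≤ j → j ≤ 3 → Y p j v ≤ B) →
      ∫ x in (0:ℝ)..p, (u x - v x) * (Fop p a u x - Fop p a v x) ≤ K * ∫ x in (0:ℝ)..p, (u x - v x) ^ 2 := by
  have hc := ha.pos
  have hC : 0 ≤ C := ha.pos.le.trans ((ha.lo 0).trans (ha.hi 0))
  obtain ⟨A, hA⟩ := ha.bd 1
  have hA0 : 0 ≤ A := (abs_nonneg _).trans (hA 0)
  obtain ⟨k1, n1, b1⟩ := (Loc.mul 2 _ _ (Loc.coef (p := p) (a := a) 2 1) (Loc.der 2 1 le_rfl (by norm_num))).bound hp ha B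
  obtain ⟨k2, n2, b2⟩ := (Loc.add 2 _ _ (Loc.der (p := p) (a := a) 2 2 (by norm_num) le_rfl) (Loc.dev 2)).bound hp ha B
  refine ⟨k1 ^ 2 / (4 * c) + C / 2 + C / 2 + A * k2, by positivity, fun u v hu hv hYu hYv => ?_⟩
  set d : ℝ → ℝ := fun x => u x - v x with hd
  have hdS : SP p d := hu.sub hv
  have hmean : mean p d = mean p u - mean p v := mean_sub hu.cont hv.cont
  have hd2 : ∀ x, iteratedDeriv 2 d x = iteratedDeriv 2 u x - iteratedDeriv 2 v x := fun x => by
    have := iteratedDeriv_sub (n := 2) (f := u) (g := v) (x := x) (hu.smooth.of_le (by norm_cast)).contDiffAt (hv.smooth.of_le (by norm_cast)).contDiffAt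
    exact this
  -- integration by parts
  have c0 := hu.cont
  have c0' := hv.cont
  have cd := hdS.cont
  have cd1 := (hdS.iter 1).cont
  have cd2 := (hdS.iter 2).cont
  have cu1 := (hu.iter 1).cont
  have cv2 := (hv.iter 2).cont
  have ca := ha.smooth.continuous
  have ca1 := (smooth_iter ha.smooth 1).continuous
  have hib := ibp (hdS.iter 1) ((SP.comp ha.smooth hu).mul hdS)
  have hder : ∀ x, deriv (fun x => a (u x) * d x) x = iteratedDeriv 1 a (u x) * iteratedDeriv 1 u x * d x + a (u x) * iteratedDeriv 1 d x := fun x => by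
    have h1 := hd_a ha.smooth hu 0 x
    simp only [iteratedDeriv_zero, zero_add] at h1
    exact (h1.fun_mul (hd_u hdS x)).deriv
  simp_rw [hder] at hib
  rw [← iteratedDeriv_succ] at hib
  norm_num at hib
  set I := ∫ x in (0:ℝ)..p, d x ^ 2 with hI
  have e1 : ∀ x, (u x - v x) * (Fop p a u x - Fop p a v x) = deriv^[2] d x * (a (u x) * d x)
      + (a (u x) * d x * (d x - mean p d) + (a (u x) - a (v x)) * d x * (iteratedDeriv 2 v x + (v x - mean p v))) := fun x => by
    rw [← iteratedDeriv_eq_iterate, hd2, hmean]; unfold Fop; simp only [hd]; ring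
  simp_rw [e1, ← iteratedDeriv_eq_iterate]
  rw [int_add_le (by fun_prop) (by fun_prop), int_add_le (by fun_prop) (by fun_prop)]
  have t1 : ∫ x in (0:ℝ)..p, iteratedDeriv 2 d x * (a (u x) * d x) ≤ k1 ^ 2 / (4 * c) * I := by
    rw [hib, ← intervalIntegral.integral_neg, hI, ← intervalIntegral.integral_const_mul]
    simp_rw [← iteratedDeriv_one]
    apply int_le_of_le hp (by fun_prop) (by fun_prop)
    intro x
    have hb := b1 u hu hYu x
    have hb2 : (iteratedDeriv 1 a (u x) * iteratedDeriv 1 u x) ^ 2 ≤ k1 ^ 2 := by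
      rw [← sq_abs]; exact pow_le_pow_left₀ (abs_nonneg _) hb 2
    set P := iteratedDeriv 1 a (u x) * iteratedDeriv 1 u x
    have hlo := ha.lo (u x)
    set D := iteratedDeriv 1 d x
    have g1 : c * D ^ 2 ≤ a (u x) * D ^ 2 := by gcongr
    have g2 : P ^ 2 / (4 * c) * d x ^ 2 ≤ k1 ^ 2 / (4 * c) * d x ^ 2 := by gcongr
    have g3 : -(D * P * d x) ≤ c * D ^ 2 + P ^ 2 / (4 * c) * d x ^ 2 := by
      have e : c * D ^ 2 + P ^ 2 / (4 * c) * d x ^ 2 + D * P * d x = c * (D + P * d x / (2 * c)) ^ 2 := by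
        field_simp; ring
      have : 0 ≤ c * (D + P * d x / (2 * c)) ^ 2 := by positivity
      linarith
    nlinarith
  have t2 : ∫ x in (0:ℝ)..p, a (u x) * d x * (d x - mean p d) ≤ (C / 2 + C / 2) * I := by
    have := int_dev_le hp cd
    calc _ ≤ ∫ x in (0:ℝ)..p, (C / 2 * d x ^ 2 + C / 2 * (d x - mean p d) ^ 2) := by
          apply int_le_of_le hp (by fun_prop) (by fun_prop)
          intro x
          have h1 : d x * (d x - mean p d) ≤ (d x ^ 2 + (d x - mean p d) ^ 2) / 2 := by nlinarith [sq_nonneg (d x - (d x - mean p d))]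
          have h2 := ha.hi (u x)
          have h3 := hc.le.trans (ha.lo (u x))
          have h4 : 0 ≤ (d x ^ 2 + (d x - mean p d) ^ 2) / 2 := by positivity
          nlinarith [mul_le_mul_of_nonneg_left h1 h3, mul_le_mul_of_nonneg_right h2 h4]
      _ = C / 2 * I + C / 2 * ∫ x in (0:ℝ)..p, (d x - mean p d) ^ 2 := by
          rw [int_add_le (by fun_prop) (by fun_prop), intervalIntegral.integral_const_mul, intervalIntegral.integral_const_mul]
      _ ≤ _ := by nlinarith
  have t3 : ∫ x in (0:ℝ)..p, (a (u x) - a (v x)) * d x * (iteratedDeriv 2 v x + (v x - mean p v)) ≤ A * k2 * I := by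
    rw [hI, ← intervalIntegral.integral_const_mul]
    apply int_le_of_le hp (by fun_prop) (by fun_prop)
    intro x
    refine (le_abs_self _).trans ?_
    rw [abs_mul, abs_mul, ← sq_abs (d x)]
    have h1 := coef_lip ha hA (u x) (v x)
    have h2 := b2 v hv hYv x
    calc _ ≤ (A * |d x|) * |d x| * k2 := by gcongr
      _ = _ := by ring
  nlinarith

/-- differential inequality, linear Gronwall -/
lemma gron {f f' : ℝ → ℝ} {K T : ℝ} (hf : ∀ t, 0 ≤ t → t ≤ T → HasDerivAt f (f' t) t)
    (h : ∀ t, 0 ≤ t → t ≤ T → f' t ≤ K * f t) {t : ℝ} (h0 : 0 ≤ t) (hT : t ≤ T) :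
    f t ≤ f 0 * Real.exp (K * t) := by
  have hd : ∀ s, 0 ≤ s → s ≤ T → HasDerivAt (fun s => Real.exp (-K * s) * f s)
      (Real.exp (-K * s) * (f' s - K * f s)) s := fun s h1 h2 => by
    have e : HasDerivAt (fun s => Real.exp (-K * s)) (Real.exp (-K * s) * (-K)) s := by
      have := ((hasDerivAt_id s).const_mul (-K)).exp
      simpa using this
    exact (e.fun_mul (hf s h1 h2)).congr_deriv (by ring)
  have hanti : AntitoneOn (fun s => Real.exp (-K * s) * f s) (Set.Icc 0 T) := by
    apply antitoneOn_of_deriv_nonpos (convex_Icc 0 T)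
    · exact fun s hs => (hd s hs.1 hs.2).continuousAt.continuousWithinAt
    · intro s hs; rw [interior_Icc] at hs
      exact (hd s hs.1.le hs.2.le).differentiableAt.differentiableWithinAt
    · intro s hs; rw [interior_Icc] at hs
      rw [(hd s hs.1.le hs.2.le).deriv]
      have := h s hs.1.le hs.2.le
      have e := Real.exp_pos (-K * s)
      nlinarith
  have := hanti ⟨le_rfl, h0.trans hT⟩ ⟨h0, hT⟩ h0
  simp only [mul_zero, Real.exp_zero, one_mul] at this
  have e : Real.exp (-K * t) * Real.exp (K * t) = 1 := by rw [← Real.exp_add]; simp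
  calc f t = Real.exp (-K * t) * f t * Real.exp (K * t) := by
        rw [mul_right_comm, e, one_mul]
    _ ≤ _ := mul_le_mul_of_nonneg_right this (Real.exp_pos _).le

lemma gron' {f f' : ℝ → ℝ} {K T e : ℝ} (hK : 0 < K) (hf : ∀ t, 0 ≤ t → t ≤ T → HasDerivAt f (f' t) t)
    (h : ∀ t, 0 ≤ t → t ≤ T → f' t ≤ K * f t + e) {t : ℝ} (h0 : 0 ≤ t) (hT : t ≤ T) :
    f t ≤ (f 0 + e / K) * Real.exp (K * t) - e / K := by
  have := gron (f := fun t => f t + e / K) (f' := f') (K := K) (T := T) (fun t h1 h2 => (hf t h1 h2).add_const _)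
    (fun t h1 h2 => by
      have := h t h1 h2
      have e : K * (f t + e / K) = K * f t + e := by field_simp
      linarith) h0 hT
  linarith

/-- derivative bounded above by a constant -/
lemma grow_le {f f' : ℝ → ℝ} {T e : ℝ} (hf : ∀ t, 0 ≤ t → t ≤ T → HasDerivAt f (f' t) t)
    (h : ∀ t, 0 ≤ t → t ≤ T → f' t ≤ e) {t : ℝ} (h0 : 0 ≤ t) (hT : t ≤ T) :
    f t ≤ f 0 + e * t := by
  have := gron (f := fun t => f t - e * t) (f' := fun t => f' t - e) (K := 0) (T := T)
    (fun t h1 h2 => by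
      have := (hf t h1 h2).fun_sub ((hasDerivAt_id t).const_mul e)
      simpa using this)
    (fun t h1 h2 => by
      have := h t h1 h2
      simp; linarith) h0 hT
  simp at this
  linarith

/-- global existence for ODEs with linear growth and locally Lipschitz right hand side -/
lemma ode_global {E : Type*} [NormedAddCommGroup E] [NormedSpace ℝ E] [CompleteSpace E] (N : E → E) (K : ℝ) (hK : 0 ≤ K)
    (hg : ∀ v, ‖N v‖ ≤ K * ‖v‖) (hl : ∀ R, 0 ≤ R → ∃ L, 0 ≤ L ∧ ∀ u v, ‖u‖ ≤ R → ‖v‖ ≤ R → ‖N u - N v‖ ≤ L * ‖u - v‖)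
    (v0 : E) (T : ℝ) (hT : 0 ≤ T) :
    ∃ α : ℝ → E, α 0 = v0 ∧ ∀ t ∈ Set.Icc 0 T, HasDerivWithinAt α (N (α t)) (Set.Icc 0 T) t := by
  set R : ℝ := ‖v0‖ * Real.exp (K * T) + 1 with hR
  have hR1 : 1 ≤ R := by rw [hR]; have : 0 ≤ ‖v0‖ * Real.exp (K * T) := by positivity
                         linarith
  have hR0 : 0 < R := by linarith
  obtain ⟨L, hL0, hL⟩ := hl (2 * R) (by linarith)
  set χ : E → ℝ := fun v => max 0 (min 1 (2 - ‖v‖ / R)) with hχ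
  have χ0 : ∀ v, 0 ≤ χ v := fun v => le_max_left _ _
  have χ1 : ∀ v, χ v ≤ 1 := fun v => max_le (by norm_num) (min_le_left _ _)
  have χl : ∀ u v, |χ u - χ v| ≤ ‖u - v‖ / R := fun u v => by
    have h1 : |χ u - χ v| ≤ |min 1 (2 - ‖u‖ / R) - min 1 (2 - ‖v‖ / R)| := by
      have := abs_max_sub_max_le_max 0 (min 1 (2 - ‖u‖ / R)) 0 (min 1 (2 - ‖v‖ / R))
      simpa using this
    have h2 : |min 1 (2 - ‖u‖ / R) - min 1 (2 - ‖v‖ / R)| ≤ |(2 - ‖u‖ / R) - (2 - ‖v‖ / R)| := by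
      have := abs_min_sub_min_le_max 1 (2 - ‖u‖ / R) 1 (2 - ‖v‖ / R)
      simpa using this
    refine h1.trans (h2.trans ?_)
    have e : (2 - ‖u‖ / R) - (2 - ‖v‖ / R) = (‖v‖ - ‖u‖) / R := by ring
    rw [e, abs_div, abs_of_pos hR0]
    have := abs_norm_sub_norm_le v u
    rw [norm_sub_rev] at this
    gcongr
  have χz : ∀ v, 2 * R ≤ ‖v‖ → χ v = 0 := fun v hv => by
    have : 2 - ‖v‖ / R ≤ 0 := by
      have : 2 ≤ ‖v‖ / R := by rw [le_div_iff₀ hR0]; exact hv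
      linarith
    simp only [hχ]
    exact max_eq_left ((min_le_right _ _).trans this)
  have χo : ∀ v, ‖v‖ ≤ R → χ v = 1 := fun v hv => by
    have : 1 ≤ 2 - ‖v‖ / R := by
      have : ‖v‖ / R ≤ 1 := by rw [div_le_iff₀ hR0]; linarith
      linarith
    simp only [hχ]
    rw [min_eq_left this]; norm_num
  set M : E → E := fun v => χ v • N v with hM
  have Mg : ∀ v, ‖M v‖ ≤ K * ‖v‖ := fun v => by
    simp only [hM]; rw [norm_smul, Real.norm_eq_abs, abs_of_nonneg (χ0 v)]
    calc χ v * ‖N v‖ ≤ 1 * (K * ‖v‖) := mul_le_mul (χ1 v) (hg v) (norm_nonneg _) zero_le_one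
      _ = _ := one_mul _
  have Mb : ∀ v, ‖M v‖ ≤ K * (2 * R) := fun v => by
    by_cases h : 2 * R ≤ ‖v‖
    · simp only [hM]; rw [χz v h, zero_smul, norm_zero]; positivity
    · push Not at h
      exact (Mg v).trans (by gcongr)
  have Ml0 : ∀ u v, ‖u‖ ≤ 2 * R → ‖M u - M v‖ ≤ (L + 2 * K) * ‖u - v‖ := fun u v hu => by
    by_cases h : 2 * R ≤ ‖v‖
    · have e : M u - M v = (χ u - χ v) • N u := by simp only [hM]; rw [χz v h]; simp
      rw [e, norm_smul, Real.norm_eq_abs]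
      calc |χ u - χ v| * ‖N u‖ ≤ (‖u - v‖ / R) * (K * (2 * R)) := by
            gcongr
            · exact χl u v
            · exact (hg u).trans (by gcongr)
        _ = 2 * K * ‖u - v‖ := by field_simp
        _ ≤ _ := by gcongr; linarith
    · push Not at h
      have e : M u - M v = χ v • (N u - N v) + (χ u - χ v) • N u := by simp only [hM]; module
      rw [e]
      refine (norm_add_le _ _).trans ?_
      rw [norm_smul, norm_smul, Real.norm_eq_abs, Real.norm_eq_abs, abs_of_nonneg (χ0 v)]
      have h1 : χ v * ‖N u - N v‖ ≤ 1 * (L * ‖u - v‖) := mul_le_mul (χ1 v) (hL u v hu h.le) (norm_nonneg _) zero_le_one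
      have h2 : |χ u - χ v| * ‖N u‖ ≤ (‖u - v‖ / R) * (K * (2 * R)) := by
            gcongr
            · exact χl u v
            · exact (hg u).trans (by gcongr)
      have e3 : (‖u - v‖ / R) * (K * (2 * R)) = 2 * K * ‖u - v‖ := by field_simp
      rw [e3] at h2
      linarith
  have Ml : ∀ u v, ‖M u - M v‖ ≤ (L + 2 * K) * ‖u - v‖ := fun u v => by
    by_cases hu : ‖u‖ ≤ 2 * R
    · exact Ml0 u v hu
    by_cases hv : ‖v‖ ≤ 2 * R
    · have := Ml0 v u hv
      rwa [norm_sub_rev, norm_sub_rev v u] at this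
    · push Not at hu hv
      have e : M u - M v = 0 := by simp only [hM]; rw [χz v hv.le, χz u hu.le]; simp
      rw [e, norm_zero]; positivity
  have hPL : IsPicardLindelof (fun _ => M) (⟨0, le_rfl, hT⟩ : Set.Icc (0:ℝ) T) v0
      (⟨K * (2 * R) * T, by positivity⟩ : NNReal) 0 (⟨K * (2 * R), by positivity⟩ : NNReal)
      (⟨L + 2 * K, by positivity⟩ : NNReal) := by
    refine ⟨fun t _ => ?_, fun x _ => continuousOn_const, fun t _ x _ => Mb x, ?_⟩
    · apply LipschitzWith.lipschitzOnWith
      apply LipschitzWith.of_dist_le_mul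
      intro x y
      rw [dist_eq_norm, dist_eq_norm]
      exact Ml x y
    · simp [hT]
      exact le_rfl
  obtain ⟨α, h1, h2⟩ := hPL.exists_eq_forall_mem_Icc_hasDerivWithinAt₀
  refine ⟨α, h1, fun t ht => ?_⟩
  have hcont : ContinuousOn α (Set.Icc 0 T) := fun t ht => (h2 t ht).continuousWithinAt
  have hgr := norm_le_gronwallBound_of_norm_deriv_right_le (f := α) (f' := fun t => M (α t)) (δ := ‖v0‖) (K := K) (ε := 0)
    (a := 0) (b := T) hcont (fun x hx => ((h2 x ⟨hx.1, hx.2.le⟩).mono_of_mem_nhdsWithin (Icc_mem_nhdsGE_of_mem hx)))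
    (by simp only at h1; rw [h1]) (fun x hx => by simpa using Mg (α x)) t ht
  rw [gronwallBound_ε0, sub_zero] at hgr
  have hle : ‖α t‖ ≤ R := by
    refine hgr.trans ?_
    have : Real.exp (K * t) ≤ Real.exp (K * T) := Real.exp_le_exp.2 (mul_le_mul_of_nonneg_left ht.2 hK)
    have := mul_le_mul_of_nonneg_left this (norm_nonneg v0)
    rw [hR]; linarith
  have := h2 t ht
  simp only [hM] at this
  rwa [χo _ hle, one_smul] at this

/-- differentiation under the integral sign, continuous setting -/
lemma hasDeriv_param {f f' : ℝ → ℝ → ℝ} (hf : Continuous (Function.uncurry f)) (hf' : Continuous (Function.uncurry f'))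
    (h : ∀ x y, HasDerivAt (fun x => f x y) (f' x y) x) (a b x : ℝ) :
    HasDerivAt (fun x => ∫ y in a..b, f x y) (∫ y in a..b, f' x y) x := by
  have hK : IsCompact (Set.Icc (x-1) (x+1) ×ˢ Set.uIcc a b) := isCompact_Icc.prod isCompact_uIcc
  obtain ⟨C, hC⟩ := hK.exists_bound_of_continuousOn hf'.continuousOn
  refine (intervalIntegral.hasDerivAt_integral_of_dominated_loc_of_deriv_le (μ := volume) (F := f) (F' := f') (x₀ := x)
    (s := Set.Icc (x-1) (x+1)) (bound := fun _ => C) (Icc_mem_nhds (by linarith) (by linarith)) ?_ ?_ ?_ ?_ ?_ ?_).2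
  · refine Eventually.of_forall fun z => ?_
    exact (hf.comp (Continuous.prodMk_right z)).aestronglyMeasurable
  · exact ii_cont (hf.comp (Continuous.prodMk_right x)) _ _
  · exact (hf'.comp (Continuous.prodMk_right x)).aestronglyMeasurable
  · refine Eventually.of_forall fun z hz w hw => ?_
    exact hC (w, z) ⟨hw, Set.uIoc_subset_uIcc hz⟩
  · exact intervalIntegrable_const
  · exact Eventually.of_forall fun z hz w hw => h w z

/-- smoothness from an explicit sequence of derivatives -/
lemma ladder_iter {D : ℕ → ℝ → ℝ} (h : ∀ k x, HasDerivAt (D k) (D (k+1) x) x) (k : ℕ) :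
    iteratedDeriv k (D 0) = D k := by
  induction k with
  | zero => simp
  | succ k ih => rw [iteratedDeriv_succ, ih]; ext x; exact (h k x).deriv

lemma ladder_smooth {D : ℕ → ℝ → ℝ} (h : ∀ k x, HasDerivAt (D k) (D (k+1) x) x) : ContDiff ℝ ∞ (D 0) := by
  apply contDiff_of_differentiable_iteratedDeriv
  intro m _
  rw [ladder_iter h]
  exact fun x => (h m x).differentiableAt

/-- families (time, space) smooth in space with jointly continuous space derivatives -/
structure XS (p : ℝ) (f : ℝ → ℝ → ℝ) : Prop where
  sp : ∀ t, SP p (f t)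
  ct : ∀ k, Continuous fun q : ℝ × ℝ => iteratedDeriv k (f q.1) q.2

lemma XS.ct0 {p : ℝ} {f : ℝ → ℝ → ℝ} (h : XS p f) : Continuous fun q : ℝ × ℝ => f q.1 q.2 := by
  simpa using h.ct 0

lemma XS.time {p : ℝ} {f : ℝ → ℝ → ℝ} (h : XS p f) {τ : ℝ → ℝ} (hτ : Continuous τ) : XS p (fun t => f (τ t)) :=
  ⟨fun t => h.sp _, fun k => (h.ct k).comp (by fun_prop : Continuous fun q : ℝ × ℝ => (τ q.1, q.2))⟩

lemma cont_mean {X : Type*} [TopologicalSpace X] [FirstCountableTopology X] {p : ℝ} {f : X → ℝ → ℝ} (h : Continuous fun q : X × ℝ => f q.1 q.2) :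
    Continuous fun t => mean p (f t) := by
  unfold mean
  exact continuous_const.mul (intervalIntegral.continuous_parametric_intervalIntegral_of_continuous' h 0 p)

lemma Loc.xcont {p : ℝ} {a : ℝ → ℝ} (ha : ContDiff ℝ ∞ a) {r : ℕ} {Q} (hQ : Loc p a r Q) {V : ℝ → ℝ → ℝ} (hV : XS p V) :
    Continuous fun q : ℝ × ℝ => Q (V q.1) q.2 := by
  induction hQ with
  | der i h1 hr => exact hV.ct i
  | dev => exact hV.ct0.sub ((cont_mean hV.ct0).comp continuous_fst)
  | coef j => exact (smooth_iter ha j).continuous.comp hV.ct0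
  | const c => exact continuous_const
  | add P Q _ _ h1 h2 => exact h1.add h2
  | mul P Q _ _ h1 h2 => exact h1.mul h2

lemma Loc.iter_ex {p : ℝ} {a : ℝ → ℝ} (ha : ContDiff ℝ ∞ a) {r : ℕ} {Q} (hQ : Loc p a r Q) (k : ℕ) :
    ∃ Q', Loc p a (r+k) Q' ∧ ∀ u, SP p u → iteratedDeriv k (Q u) = Q' u := by
  induction k with
  | zero => exact ⟨Q, hQ, fun u _ => iteratedDeriv_zero⟩
  | succ k ih =>
    obtain ⟨Q1, l1, h1⟩ := ih
    obtain ⟨Q2, l2, h2⟩ := l1.deriv_ex ha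
    refine ⟨Q2, l2, fun u hu => ?_⟩
    rw [iteratedDeriv_succ, h1 u hu]; ext x; exact (h2 u hu x).deriv

lemma Loc.xs {p : ℝ} {a : ℝ → ℝ} (ha : ContDiff ℝ ∞ a) {r : ℕ} {Q} (hQ : Loc p a r Q) {V : ℝ → ℝ → ℝ} (hV : XS p V) :
    XS p (fun t => Q (V t)) := by
  refine ⟨fun t => hQ.sp ha (hV.sp t), fun k => ?_⟩
  obtain ⟨Q', l, h⟩ := hQ.iter_ex ha k
  have : (fun q : ℝ × ℝ => iteratedDeriv k (Q (V q.1)) q.2) = fun q => Q' (V q.1) q.2 := by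
    ext q; rw [h _ (hV.sp _)]
  rw [this]
  exact l.xcont ha hV

lemma XS.der {p : ℝ} {f : ℝ → ℝ → ℝ} (h : XS p f) (k : ℕ) : XS p (fun t => iteratedDeriv k (f t)) := by
  refine ⟨fun t => (h.sp t).iter k, fun j => ?_⟩
  have := h.ct (j + k)
  simpa only [iteratedDeriv_eq_iterate, Function.iterate_add_apply] using this

/-- time primitive -/
noncomputable def tint (v0 : ℝ → ℝ) (g : ℝ → ℝ → ℝ) (t x : ℝ) : ℝ := v0 x + ∫ s in (0:ℝ)..t, g s x

section tint
variable {p : ℝ} {v0 : ℝ → ℝ} {g : ℝ → ℝ → ℝ}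

lemma tint_ladder (h0 : SP p v0) (hg : XS p g) (t : ℝ) (k : ℕ) (x : ℝ) :
    HasDerivAt (tint (iteratedDeriv k v0) (fun s => iteratedDeriv k (g s)) t)
      (tint (iteratedDeriv (k+1) v0) (fun s => iteratedDeriv (k+1) (g s)) t x) x := by
  refine (h0.hasDeriv_iter k x).fun_add ?_
  exact hasDeriv_param (f := fun x s => iteratedDeriv k (g s) x) (f' := fun x s => iteratedDeriv (k+1) (g s) x)
    ((hg.ct k).comp continuous_swap) ((hg.ct (k+1)).comp continuous_swap) (fun x s => (hg.sp s).hasDeriv_iter k x) 0 t x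

lemma tint_iter (h0 : SP p v0) (hg : XS p g) (t : ℝ) (k : ℕ) :
    iteratedDeriv k (tint v0 g t) = tint (iteratedDeriv k v0) (fun s => iteratedDeriv k (g s)) t := by
  have := ladder_iter (tint_ladder h0 hg t) k
  simpa only [iteratedDeriv_zero] using this

lemma tint_xs (h0 : SP p v0) (hg : XS p g) : XS p (tint v0 g) := by
  refine ⟨fun t => ⟨?_, fun x => ?_⟩, fun k => ?_⟩
  · have := ladder_smooth (tint_ladder h0 hg t)
    simpa only [iteratedDeriv_zero] using this
  · unfold tint
    rw [h0.per x]
    simp_rw [(hg.sp _).per x]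
  · simp_rw [tint_iter h0 hg]
    unfold tint
    have h1 : Continuous fun q : ℝ × ℝ => ∫ s in (0:ℝ)..q.1, iteratedDeriv k (g s) q.2 :=
      intervalIntegral.continuous_parametric_intervalIntegral_of_continuous
        (f := fun (q : ℝ × ℝ) s => iteratedDeriv k (g s) q.2) (s := fun q : ℝ × ℝ => q.1)
        ((hg.ct k).comp (by fun_prop : Continuous fun z : (ℝ × ℝ) × ℝ => (z.2, z.1.2))) continuous_fst
    exact ((h0.iter k).cont.comp continuous_snd).add h1

lemma tint_t (h0 : SP p v0) (hg : XS p g) (k : ℕ) (x t : ℝ) :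
    HasDerivAt (fun t => iteratedDeriv k (tint v0 g t) x) (iteratedDeriv k (g t) x) t := by
  simp_rw [tint_iter h0 hg]
  unfold tint
  have c : Continuous fun s => iteratedDeriv k (g s) x := (hg.ct k).comp (Continuous.prodMk_left x)
  exact (intervalIntegral.integral_hasDerivAt_right (ii_cont c _ _) c.aestronglyMeasurable.stronglyMeasurableAtFilter
    c.continuousAt).const_add _

lemma tint_t0 (h0 : SP p v0) (hg : XS p g) (x t : ℝ) : HasDerivAt (fun t => tint v0 g t x) (g t x) t := by
  simpa only [iteratedDeriv_zero] using tint_t h0 hg 0 x t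

lemma tint_zero : tint v0 g 0 = v0 := by ext x; simp [tint]

lemma Y_t (h0 : SP p v0) (hg : XS p g) (k : ℕ) (t : ℝ) :
    HasDerivAt (fun t => Y p k (tint v0 g t))
      (2 * ∫ x in (0:ℝ)..p, iteratedDeriv k (tint v0 g t) x * iteratedDeriv k (g t) x) t := by
  have hv := tint_xs h0 hg
  have c1 := hv.ct k
  have c2 := hg.ct k
  have := hasDeriv_param (f := fun t x => (iteratedDeriv k (tint v0 g t) x) ^ 2)
    (f' := fun t x => 2 * (iteratedDeriv k (tint v0 g t) x * iteratedDeriv k (g t) x))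
    (by change Continuous fun q : ℝ × ℝ => (iteratedDeriv k (tint v0 g q.1) q.2) ^ 2; fun_prop)
    (by change Continuous fun q : ℝ × ℝ => 2 * (iteratedDeriv k (tint v0 g q.1) q.2 * iteratedDeriv k (g q.1) q.2); fun_prop)
    (fun t x => ((tint_t h0 hg k x t).fun_pow 2).congr_deriv (by norm_num; ring)) 0 p t
  rw [intervalIntegral.integral_const_mul] at this
  exact this
end tint

lemma ibp_iter {p : ℝ} {u w : ℝ → ℝ} (hu : SP p u) (hw : SP p w) (k : ℕ) :
    ∫ x in (0:ℝ)..p, iteratedDeriv (k+1) u x * iteratedDeriv (k+1) w x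
      = -∫ x in (0:ℝ)..p, iteratedDeriv (k+2) u x * iteratedDeriv k w x := by
  have := ibp (hu.iter (k+1)) (hw.iter k)
  rw [← iteratedDeriv_succ, ← iteratedDeriv_succ] at this
  rw [this]; simp

lemma Fop_xs {p : ℝ} {a : ℝ → ℝ} (ha : ContDiff ℝ ∞ a) {V : ℝ → ℝ → ℝ} (hV : XS p V) :
    XS p (fun t => Fop p a (V t)) := (Fop_loc p a).xs ha hV

noncomputable def Jop (p : ℝ) (Φ f : ℝ → ℝ) (x : ℝ) : ℝ := ∫ y in (0:ℝ)..p, Φ (x - y) * f y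

structure Kern (p : ℝ) (Φ : ℝ → ℝ) (ε : ℝ) : Prop where
  sp : SP p Φ
  even : ∀ x, Φ (-x) = Φ x
  nn : ∀ x, 0 ≤ Φ x
  int1 : ∫ y in (0:ℝ)..p, Φ y = 1
  e0 : 0 ≤ ε
  mom : ∀ f, SP p f → ∀ L, (∀ x, |iteratedDeriv 1 f x| ≤ L) → ∀ x, |Jop p Φ f x - f x| ≤ ε * L

section Jop
variable {p : ℝ} {Φ f g : ℝ → ℝ}

lemma Jop_ladder (hΦ : SP p Φ) (hf : Continuous f) (k : ℕ) (x : ℝ) :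
    HasDerivAt (Jop p (iteratedDeriv k Φ) f) (Jop p (iteratedDeriv (k+1) Φ) f x) x := by
  have c1 := (hΦ.iter k).cont
  have c2 := (hΦ.iter (k+1)).cont
  refine hasDeriv_param (f := fun x y => iteratedDeriv k Φ (x - y) * f y)
    (f' := fun x y => iteratedDeriv (k+1) Φ (x - y) * f y) ?_ ?_ (fun x y => ?_) 0 p x
  · change Continuous fun q : ℝ × ℝ => iteratedDeriv k Φ (q.1 - q.2) * f q.2
    fun_prop
  · change Continuous fun q : ℝ × ℝ => iteratedDeriv (k+1) Φ (q.1 - q.2) * f q.2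
    fun_prop
  · have h1 := (hΦ.hasDeriv_iter k (x - y)).comp x ((hasDerivAt_id x).sub_const y)
    rw [mul_one] at h1
    exact h1.mul_const (f y)

lemma Jop_iter (hΦ : SP p Φ) (hf : Continuous f) (k : ℕ) :
    iteratedDeriv k (Jop p Φ f) = Jop p (iteratedDeriv k Φ) f := by
  have := ladder_iter (D := fun k => Jop p (iteratedDeriv k Φ) f) (Jop_ladder hΦ hf) k
  simpa only [iteratedDeriv_zero] using this

lemma Jop_sp (hΦ : SP p Φ) (hf : Continuous f) : SP p (Jop p Φ f) := by
  refine ⟨?_, fun x => ?_⟩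
  · have := ladder_smooth (D := fun k => Jop p (iteratedDeriv k Φ) f) (Jop_ladder hΦ hf)
    simpa only [iteratedDeriv_zero] using this
  · unfold Jop
    congr 1; ext y
    rw [show x + p - y = (x - y) + p by ring, hΦ.per]

lemma Jop_shift (hΦ : SP p Φ) (hf : SP p f) (x : ℝ) : Jop p Φ f x = ∫ y in (0:ℝ)..p, Φ y * f (x - y) := by
  unfold Jop
  have h1 := intervalIntegral.integral_comp_sub_left (a := 0) (b := p) (fun y => Φ y * f (x - y)) x
  simp only [sub_sub_cancel, sub_zero] at h1
  rw [h1]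
  have hper : Function.Periodic (fun y => Φ y * f (x - y)) p := fun y => by
    simp only [hΦ.per y]
    rw [show x - y = (x - (y + p)) + p by ring, hf.per]
  have := hper.intervalIntegral_add_eq (x - p) 0
  simpa using this

lemma Jop_iter' (hΦ : SP p Φ) (hf : SP p f) (k : ℕ) :
    iteratedDeriv k (Jop p Φ f) = Jop p Φ (iteratedDeriv k f) := by
  have h0 : ∀ k x, HasDerivAt (Jop p Φ (iteratedDeriv k f)) (Jop p Φ (iteratedDeriv (k+1) f) x) x := fun k x => by
    have e : Jop p Φ (iteratedDeriv k f) = fun x => ∫ y in (0:ℝ)..p, Φ y * iteratedDeriv k f (x - y) :=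
      funext (Jop_shift hΦ (hf.iter k))
    rw [Jop_shift hΦ (hf.iter (k+1)), e]
    have c0 := hΦ.cont
    have c1 := (hf.iter k).cont
    have c2 := (hf.iter (k+1)).cont
    refine hasDeriv_param (f := fun x y => Φ y * iteratedDeriv k f (x - y))
      (f' := fun x y => Φ y * iteratedDeriv (k+1) f (x - y)) ?_ ?_ (fun x y => ?_) 0 p x
    · change Continuous fun q : ℝ × ℝ => Φ q.2 * iteratedDeriv k f (q.1 - q.2)
      fun_prop
    · change Continuous fun q : ℝ × ℝ => Φ q.2 * iteratedDeriv (k+1) f (q.1 - q.2)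
      fun_prop
    · have h1 := (hf.hasDeriv_iter k (x - y)).comp x ((hasDerivAt_id x).sub_const y)
      rw [mul_one] at h1
      exact h1.const_mul (Φ y)
  have := ladder_iter h0 k
  simpa only [iteratedDeriv_zero] using this

lemma Jop_adj (hΦ : Continuous Φ) (he : ∀ x, Φ (-x) = Φ x) (hf : Continuous f) (hg : Continuous g) :
    ∫ x in (0:ℝ)..p, Jop p Φ f x * g x = ∫ x in (0:ℝ)..p, f x * Jop p Φ g x := by
  unfold Jop
  simp_rw [← intervalIntegral.integral_const_mul, ← intervalIntegral.integral_mul_const]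
  rw [intervalIntegral_intervalIntegral_swap]
  · congr 1; ext y; congr 1; ext x
    rw [← he (y - x), neg_sub]; ring
  · have hc : Continuous (Function.uncurry fun x y => Φ (x - y) * f y * g x) := by
      change Continuous fun q : ℝ × ℝ => Φ (q.1 - q.2) * f q.2 * g q.1
      fun_prop
    exact (hc.continuousOn.integrableOn_compact (isCompact_uIcc.prod isCompact_uIcc)).mono_set
      (Set.prod_mono Set.uIoc_subset_uIcc Set.uIoc_subset_uIcc)

lemma Jop_sub (hΦ : Continuous Φ) (hf : Continuous f) (hg : Continuous g) (x : ℝ) :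
    Jop p Φ (fun y => f y - g y) x = Jop p Φ f x - Jop p Φ g x := by
  unfold Jop
  rw [← intervalIntegral.integral_sub (ii_cont (by fun_prop) _ _) (ii_cont (by fun_prop) _ _)]
  congr 1; ext y; ring

lemma Jop_bound (hp : 0 < p) {S B : ℝ} (hΦ : ∀ x, |Φ x| ≤ S) (hf : ∀ y ∈ Set.Icc 0 p, |f y| ≤ B) (x : ℝ) :
    |Jop p Φ f x| ≤ p * (S * B) := by
  have := intervalIntegral.norm_integral_le_of_norm_le_const (a := 0) (b := p) (f := fun y => Φ (x - y) * f y) (C := S * B)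
    (fun y hy => by
      rw [Set.uIoc_of_le hp.le] at hy
      rw [Real.norm_eq_abs, abs_mul]
      exact mul_le_mul (hΦ _) (hf y ⟨hy.1.le, hy.2⟩) (abs_nonneg _) ((abs_nonneg _).trans (hΦ 0)))
  rw [sub_zero, abs_of_pos hp, Real.norm_eq_abs] at this
  unfold Jop; linarith

lemma Jop_one {ε : ℝ} (h : Kern p Φ ε) (x : ℝ) : Jop p Φ (fun _ => 1) x = 1 := by
  rw [Jop_shift h.sp (SP.const 1)]; simpa using h.int1

lemma jensen {ε : ℝ} (hp : 0 < p) (h : Kern p Φ ε) (hf : Continuous f) (x : ℝ) :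
    (Jop p Φ f x) ^ 2 ≤ Jop p Φ (fun y => f y ^ 2) x := by
  have cΦ := h.sp.cont
  set m := Jop p Φ f x with hm
  have h0 : 0 ≤ ∫ y in (0:ℝ)..p, Φ (x - y) * (f y - m) ^ 2 :=
    intervalIntegral.integral_nonneg hp.le fun y _ => mul_nonneg (h.nn _) (sq_nonneg _)
  have e : ∀ y, Φ (x - y) * (f y - m) ^ 2 = Φ (x - y) * f y ^ 2 + (-2 * m * (Φ (x - y) * f y) + m ^ 2 * (Φ (x - y) * 1)) := fun y => by ring
  simp_rw [e] at h0
  rw [int_add_le (by fun_prop) (by fun_prop), int_add_le (by fun_prop) (by fun_prop), intervalIntegral.integral_const_mul,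
    intervalIntegral.integral_const_mul] at h0
  have e1 := Jop_one h x
  unfold Jop at e1
  rw [e1] at h0
  have e2 : ∫ y in (0:ℝ)..p, Φ (x - y) * f y = m := rfl
  rw [e2] at h0
  unfold Jop
  nlinarith

lemma Y_Jop {ε : ℝ} (hp : 0 < p) (h : Kern p Φ ε) (hf : SP p f) (k : ℕ) : Y p k (Jop p Φ f) ≤ Y p k f := by
  have c := (hf.iter k).cont
  have cJ := (Jop_sp h.sp c).cont
  have cJ2 := (Jop_sp h.sp (f := fun y => iteratedDeriv k f y ^ 2) (by fun_prop)).cont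
  unfold Y
  rw [Jop_iter' h.sp hf]
  calc _ ≤ ∫ x in (0:ℝ)..p, Jop p Φ (fun y => iteratedDeriv k f y ^ 2) x * 1 := by
        apply int_le_of_le hp (by fun_prop) (by fun_prop)
        intro x; rw [mul_one]; exact jensen hp h c x
    _ = ∫ x in (0:ℝ)..p, iteratedDeriv k f x ^ 2 * Jop p Φ (fun _ => 1) x :=
        Jop_adj h.sp.cont h.even (by fun_prop) continuous_const
    _ = _ := by simp_rw [Jop_one h, mul_one]
end Jop

section kernel
variable {p : ℝ}

noncomputable def kf (p : ℝ) (N : ℕ) (x : ℝ) : ℝ := (1 + Real.cos (2 * π / p * x)) ^ N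

lemma kf_sp (hp : 0 < p) (N : ℕ) : SP p (kf p N) := by
  refine ⟨?_, fun x => ?_⟩
  · unfold kf; fun_prop
  · unfold kf
    rw [show 2 * π / p * (x + p) = 2 * π / p * x + 2 * π by field_simp, Real.cos_add_two_pi]

lemma cosw_sp (hp : 0 < p) : SP p (fun x => Real.cos (2 * π / p * x)) := by
  refine ⟨by fun_prop, fun x => ?_⟩
  change _ = _
  beta_reduce
  rw [show 2 * π / p * (x + p) = 2 * π / p * x + 2 * π by field_simp, Real.cos_add_two_pi]

lemma sinw_sp (hp : 0 < p) : SP p (fun x => Real.sin (2 * π / p * x)) := by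
  refine ⟨by fun_prop, fun x => ?_⟩
  change _ = _
  beta_reduce
  rw [show 2 * π / p * (x + p) = 2 * π / p * x + 2 * π by field_simp, Real.sin_add_two_pi]

lemma hd_cosw (w x : ℝ) : HasDerivAt (fun x => Real.cos (w * x)) (-(w * Real.sin (w * x))) x := by
  have := ((hasDerivAt_id x).const_mul w).cos
  simp only [id, mul_one] at this
  exact this.congr_deriv (by ring)

lemma hd_sinw (w x : ℝ) : HasDerivAt (fun x => Real.sin (w * x)) (w * Real.cos (w * x)) x := by
  have := ((hasDerivAt_id x).const_mul w).sin
  simp only [id, mul_one] at this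
  exact this.congr_deriv (by ring)

lemma kf_nn (N : ℕ) (x : ℝ) : 0 ≤ kf p N x :=
  pow_nonneg (by linarith [Real.neg_one_le_cos (2 * π / p * x)]) _

lemma kf_int_pos (hp : 0 < p) (N : ℕ) : 0 < ∫ x in (0:ℝ)..p, kf p N x := by
  have c := (kf_sp hp N).cont
  refine intervalIntegral.integral_pos hp c.continuousOn (fun x _ => kf_nn N x) ⟨0, ⟨le_rfl, hp.le⟩, ?_⟩
  simp [kf]

/-- the second moment identity -/
lemma kf_mom (hp : 0 < p) (N : ℕ) :
    ∫ x in (0:ℝ)..p, kf p (N+1) x * (1 - Real.cos (2 * π / p * x))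
      = 1 / (N + 2) * ∫ x in (0:ℝ)..p, kf p (N+1) x := by
  set w := 2 * π / p with hw
  have hw0 : w ≠ 0 := by rw [hw]; positivity
  have hS := (kf_sp hp (N+1)).mul (sinw_sp hp)
  have c := (kf_sp hp (N+1)).cont
  have hd : ∀ x, HasDerivAt (fun x => kf p (N+1) x * Real.sin (w * x))
      (w * (kf p (N+1) x - (N + 2) * (kf p (N+1) x * (1 - Real.cos (w * x))))) x := fun x => by
    have h1 : HasDerivAt (kf p (N+1)) (((N+1:ℕ):ℝ) * (1 + Real.cos (w * x)) ^ N * (-(w * Real.sin (w * x)))) x := by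
      have := ((hd_cosw w x).const_add 1).fun_pow (N+1)
      have e : kf p (N+1) = fun x => (1 + Real.cos (w * x)) ^ (N+1) := rfl
      rw [e]
      simpa using this
    refine (h1.fun_mul (hd_sinw w x)).congr_deriv ?_
    have hsc := Real.sin_sq_add_cos_sq (w * x)
    unfold kf
    rw [← hw]
    push_cast
    have : Real.sin (w * x) * Real.sin (w * x) = (1 - Real.cos (w * x)) * (1 + Real.cos (w * x)) := by nlinarith
    calc _ = -(N + 1) * (1 + Real.cos (w * x)) ^ N * w * (Real.sin (w * x) * Real.sin (w * x))
          + (1 + Real.cos (w * x)) ^ (N+1) * (w * Real.cos (w * x)) := by ring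
      _ = _ := by rw [this]; ring
  have h0 := int_hd_zero hS hd
  rw [intervalIntegral.integral_const_mul, intervalIntegral.integral_sub (ii_cont (by fun_prop) _ _) (ii_cont (by fun_prop) _ _),
    intervalIntegral.integral_const_mul] at h0
  have h1 := (mul_eq_zero.1 h0).resolve_left hw0
  have : (N:ℝ) + 2 ≠ 0 := by positivity
  field_simp
  linarith

lemma lip_cos (hp : 0 < p) {f : ℝ → ℝ} (hf : SP p f) {L : ℝ} (hL : ∀ x, |iteratedDeriv 1 f x| ≤ L) (x y : ℝ) :
    (f y - f x) ^ 2 ≤ L ^ 2 * p ^ 2 * (1 - Real.cos (2 * π / p * (x - y))) := by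
  have hL0 : 0 ≤ L := (abs_nonneg _).trans (hL 0)
  -- shift y near x
  obtain ⟨k, hz, -⟩ := existsUnique_add_zsmul_mem_Ico hp y (x - p / 2)
  have hyz : f y = f (y + k • p) := ((hf.per.zsmul k) y).symm
  have hcos : Real.cos (2 * π / p * (x - y)) = Real.cos (2 * π / p * (x - (y + k • p))) := by
    have := (cosw_sp hp).per.sub_zsmul_eq (x := x - y) k
    rw [← sub_sub]; exact this.symm
  rw [hyz, hcos]
  generalize y + k • p = z at hz
  have h1 : |f z - f x| ≤ L * |z - x| := by
    have := Convex.norm_image_sub_le_of_norm_hasDerivWithin_le (f := f) (f' := iteratedDeriv 1 f) (s := Set.univ) (C := L)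
      (x := x) (y := z) (fun x _ => (hd_u hf x).hasDerivWithinAt) (fun x _ => hL x) convex_univ
      (Set.mem_univ _) (Set.mem_univ _)
    simpa using this
  have h2 : (f z - f x) ^ 2 ≤ L ^ 2 * (z - x) ^ 2 := by
    rw [← sq_abs (f z - f x), ← sq_abs (z - x), ← mul_pow]
    exact pow_le_pow_left₀ (abs_nonneg _) h1 2
  have h3 : |z - x| ≤ p / 2 := by rw [abs_le]; constructor <;> linarith [hz.1, hz.2]
  have h4 : |2 * π / p * (x - z)| ≤ π := by
    rw [abs_mul, abs_of_pos (by positivity), abs_sub_comm]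
    calc _ ≤ 2 * π / p * (p / 2) := by gcongr
      _ = π := by field_simp
  have h5 := Real.cos_le_one_sub_mul_cos_sq h4
  have h6 : 2 / π ^ 2 * (2 * π / p * (x - z)) ^ 2 = 8 / p ^ 2 * (z - x) ^ 2 := by field_simp; ring
  have h7 : (z - x) ^ 2 ≤ p ^ 2 * (1 - Real.cos (2 * π / p * (x - z))) := by
    have h8 : 8 / p ^ 2 * (z - x) ^ 2 ≤ 1 - Real.cos (2 * π / p * (x - z)) := by linarith
    have h9 : p ^ 2 * (8 / p ^ 2 * (z - x) ^ 2) = 8 * (z - x) ^ 2 := by field_simp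
    nlinarith [mul_le_mul_of_nonneg_left h8 (sq_nonneg p), sq_nonneg (z - x)]
  calc _ ≤ _ := h2
    _ ≤ L ^ 2 * (p ^ 2 * (1 - Real.cos (2 * π / p * (x - z)))) := by gcongr
    _ = _ := by ring

lemma kern_ex (hp : 0 < p) (N : ℕ) : ∃ Φ, Kern p Φ (p / √(N + 2)) := by
  set I := ∫ x in (0:ℝ)..p, kf p (N+1) x with hI
  have hI0 : 0 < I := kf_int_pos hp _
  have c := (kf_sp hp (N+1)).cont
  have hsp : SP p (fun x => 1 / I * kf p (N+1) x) := (SP.const (1 / I)).mul (kf_sp hp (N+1))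
  have hev : ∀ x, 1 / I * kf p (N+1) (-x) = 1 / I * kf p (N+1) x := fun x => by
    unfold kf; rw [mul_neg, Real.cos_neg]
  have hnn : ∀ x, 0 ≤ 1 / I * kf p (N+1) x := fun x => mul_nonneg (by positivity) (kf_nn _ _)
  have hi1 : ∫ y in (0:ℝ)..p, 1 / I * kf p (N+1) y = 1 := by
    rw [intervalIntegral.integral_const_mul, ← hI]; field_simp
  refine ⟨fun x => 1 / I * kf p (N+1) x, hsp, hev, hnn, hi1, by positivity, ?_⟩
  intro f hf L hL x
  have hL0 : 0 ≤ L := (abs_nonneg _).trans (hL 0)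
  set Φ : ℝ → ℝ := fun x => 1 / I * kf p (N+1) x with hΦ
  have cΦ := hsp.cont
  have cf := hf.cont
  -- a fake kernel with trivial moment to reuse Jensen
  have hone : Jop p Φ (fun _ => 1) x = 1 := by
    rw [Jop_shift hsp (SP.const 1)]; simpa using hi1
  have hJ : Jop p Φ f x - f x = Jop p Φ (fun y => f y - f x) x := by
    rw [Jop_sub cΦ cf continuous_const]
    congr 1
    have : Jop p Φ (fun _ => f x) x = Jop p Φ (fun _ => 1) x * f x := by
      unfold Jop; rw [← intervalIntegral.integral_mul_const]; congr 1; ext y; ring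
    rw [this, hone, one_mul]
  have hjen : (Jop p Φ (fun y => f y - f x) x) ^ 2 ≤ Jop p Φ (fun y => (f y - f x) ^ 2) x := by
    have := cs (f := fun y => √(Φ (x - y))) (g := fun y => √(Φ (x - y)) * (f y - f x)) (by fun_prop) (by fun_prop) hp.le
    have e1 : ∀ y, √(Φ (x - y)) * (√(Φ (x - y)) * (f y - f x)) = Φ (x - y) * (f y - f x) := fun y => by
      rw [← mul_assoc, Real.mul_self_sqrt (hnn _)]
    have e2 : ∀ y, √(Φ (x - y)) ^ 2 = Φ (x - y) * 1 := fun y => by rw [Real.sq_sqrt (hnn _), mul_one]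
    have e3 : ∀ y, (√(Φ (x - y)) * (f y - f x)) ^ 2 = Φ (x - y) * (f y - f x) ^ 2 := fun y => by
      rw [mul_pow, Real.sq_sqrt (hnn _)]
    simp_rw [e1, e2, e3] at this
    have e4 : ∫ y in (0:ℝ)..p, Φ (x - y) * 1 = 1 := hone
    rw [e4, one_mul] at this
    exact this
  have hmom : Jop p Φ (fun y => (f y - f x) ^ 2) x ≤ L ^ 2 * p ^ 2 / (N + 2) := by
    calc Jop p Φ (fun y => (f y - f x) ^ 2) x
        ≤ ∫ y in (0:ℝ)..p, L ^ 2 * p ^ 2 * (Φ (x - y) * (1 - Real.cos (2 * π / p * (x - y)))) := by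
          unfold Jop
          apply int_le_of_le hp (by fun_prop) (by fun_prop)
          intro y
          have := mul_le_mul_of_nonneg_left (lip_cos hp hf hL x y) (hnn (x - y))
          calc _ ≤ _ := this
            _ = _ := by ring
      _ = L ^ 2 * p ^ 2 * Jop p (fun z => Φ z * (1 - Real.cos (2 * π / p * z))) (fun _ => 1) x := by
          rw [intervalIntegral.integral_const_mul]; unfold Jop; simp only [mul_one]
      _ = L ^ 2 * p ^ 2 * (1 / (N + 2)) := by
          rw [Jop_shift (hsp.mul ((SP.const 1).sub (cosw_sp hp))) (SP.const 1)]
          simp only [mul_one, hΦ]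
          simp_rw [mul_assoc (1 / I)]
          rw [intervalIntegral.integral_const_mul, kf_mom hp N, ← hI]; field_simp
      _ = _ := by ring
  rw [hJ]
  apply abs_le_of_sq_le_sq
  · refine (hjen.trans hmom).trans (le_of_eq ?_)
    rw [mul_pow, div_pow, Real.sq_sqrt (by positivity)]; ring
  · positivity
end kernel

lemma SP.bdd {p : ℝ} {u : ℝ → ℝ} (hp : 0 < p) (h : SP p u) : ∃ S, 0 ≤ S ∧ ∀ x, |u x| ≤ S := by
  refine ⟨|u 0| + √(p * Y p 1 u), by positivity, fun x => ?_⟩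
  have h1 : |u x - u 0| ≤ √(p * Y p 1 u) := Real.abs_le_sqrt (osc_sq hp h x 0)
  have h2 : |u x| ≤ |u x - u 0| + |u 0| := by
    have := abs_add_le (u x - u 0) (u 0)
    simpa using this
  linarith

lemma Jop_xs {p : ℝ} {Φ : ℝ → ℝ} (hΦ : SP p Φ) {W : ℝ → ℝ → ℝ} (hW : Continuous fun q : ℝ × ℝ => W q.1 q.2) :
    XS p (fun t => Jop p Φ (W t)) := by
  have c1 : ∀ t, Continuous (W t) := fun t => hW.comp (Continuous.prodMk_right t)
  refine ⟨fun t => Jop_sp hΦ (c1 t), fun k => ?_⟩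
  simp_rw [Jop_iter hΦ (c1 _)]
  unfold Jop
  have c2 := (hΦ.iter k).cont
  refine intervalIntegral.continuous_parametric_intervalIntegral_of_continuous'
    (f := fun (q : ℝ × ℝ) y => iteratedDeriv k Φ (q.2 - y) * W q.1 y) ?_ 0 p
  have c3 : Continuous fun z : (ℝ × ℝ) × ℝ => W z.1.1 z.2 :=
    hW.comp (by fun_prop : Continuous fun z : (ℝ × ℝ) × ℝ => (z.1.1, z.2))
  change Continuous fun z : (ℝ × ℝ) × ℝ => iteratedDeriv k Φ (z.1.2 - z.2) * W z.1.1 z.2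
  fun_prop

noncomputable def zJ (p : ℝ) (Φ w : ℝ → ℝ) (x : ℝ) : ℝ :=
  Jop p (iteratedDeriv 2 Φ) w x + (Jop p Φ w x - mean p (Jop p Φ w))

section
variable {p : ℝ} {Φ : ℝ → ℝ}

lemma Fop_J (hΦ : SP p Φ) {w : ℝ → ℝ} (hw : Continuous w) (a : ℝ → ℝ) (x : ℝ) :
    Fop p a (Jop p Φ w) x = a (Jop p Φ w x) * zJ p Φ w x := by
  unfold Fop zJ
  rw [Jop_iter hΦ hw]

lemma zJ_sub (hΦ : SP p Φ) {w1 w2 : ℝ → ℝ} (h1 : Continuous w1) (h2 : Continuous w2) (x : ℝ) :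
    zJ p Φ (fun y => w1 y - w2 y) x = zJ p Φ w1 x - zJ p Φ w2 x := by
  unfold zJ
  have e : Jop p Φ (fun y => w1 y - w2 y) = fun x => Jop p Φ w1 x - Jop p Φ w2 x :=
    funext (Jop_sub hΦ.cont h1 h2)
  rw [Jop_sub (hΦ.iter 2).cont h1 h2, e, mean_sub (Jop_sp hΦ h1).cont (Jop_sp hΦ h2).cont]
  ring

lemma FJ_est {c C : ℝ} {a : ℝ → ℝ} (hp : 0 < p) (hΦ : SP p Φ) (ha : Coef a c C) :
    ∃ K, 0 ≤ K ∧ (∀ w R, Continuous w → (∀ y ∈ Set.Icc 0 p, |w y| ≤ R) → ∀ x, |Fop p a (Jop p Φ w) x| ≤ K * R) ∧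
      (∀ w1 w2 R d, 0 ≤ R → Continuous w1 → Continuous w2 → (∀ y ∈ Set.Icc 0 p, |w1 y| ≤ R) →
        (∀ y ∈ Set.Icc 0 p, |w1 y - w2 y| ≤ d) →
        ∀ x, |Fop p a (Jop p Φ w1) x - Fop p a (Jop p Φ w2) x| ≤ K * (1 + R) * d) := by
  obtain ⟨S, hS0, hS⟩ := hΦ.bdd hp
  obtain ⟨S2, hS20, hS2⟩ := (hΦ.iter 2).bdd hp
  obtain ⟨A, hA⟩ := ha.bd 1
  have hA0 : 0 ≤ A := (abs_nonneg _).trans (hA 0)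
  have hC : 0 ≤ C := ha.pos.le.trans ((ha.lo 0).trans (ha.hi 0))
  have haC : ∀ s, |a s| ≤ C := fun s => by
    rw [abs_of_nonneg (ha.pos.le.trans (ha.lo s))]; exact ha.hi s
  set Q := p * S2 + (p * S + p * S) with hQ
  have hQ0 : 0 ≤ Q := by positivity
  have hz : ∀ w R, (∀ y ∈ Set.Icc 0 p, |w y| ≤ R) → ∀ x, |zJ p Φ w x| ≤ Q * R := by
    intro w R hw x
    have h1 := Jop_bound hp hS hw
    have h2 := Jop_bound hp hS2 hw x
    have h3 := abs_mean_le hp h1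
    unfold zJ
    calc _ ≤ _ := abs_add_le _ _
      _ ≤ p * (S2 * R) + (p * (S * R) + p * (S * R)) :=
          add_le_add h2 ((show |Jop p Φ w x - mean p (Jop p Φ w)| ≤ |Jop p Φ w x| + |mean p (Jop p Φ w)| from
            by simpa only [Real.norm_eq_abs] using norm_sub_le (Jop p Φ w x) (mean p (Jop p Φ w))).trans (add_le_add (h1 x) h3))
      _ = _ := by rw [hQ]; ring
  refine ⟨C * Q + A * (p * S) * Q, by positivity, ?_, ?_⟩
  · intro w R hw hwR x
    have hR : 0 ≤ R := (abs_nonneg _).trans (hwR 0 ⟨le_rfl, hp.le⟩)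
    rw [Fop_J hΦ hw, abs_mul]
    calc _ ≤ C * (Q * R) := mul_le_mul (haC _) (hz w R hwR x) (abs_nonneg _) hC
      _ ≤ C * (Q * R) + A * (p * S) * Q * R := le_add_of_nonneg_right (by positivity)
      _ = _ := by ring
  · intro w1 w2 R d hR h1 h2 hw1 hd x
    have hd0 : 0 ≤ d := (abs_nonneg _).trans (hd 0 ⟨le_rfl, hp.le⟩)
    rw [Fop_J hΦ h1, Fop_J hΦ h2]
    have e : a (Jop p Φ w1 x) * zJ p Φ w1 x - a (Jop p Φ w2 x) * zJ p Φ w2 x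
        = (a (Jop p Φ w1 x) - a (Jop p Φ w2 x)) * zJ p Φ w1 x + a (Jop p Φ w2 x) * zJ p Φ (fun y => w1 y - w2 y) x := by
      rw [zJ_sub hΦ h1 h2]; ring
    have hJ : |Jop p Φ w1 x - Jop p Φ w2 x| ≤ p * (S * d) := by
      rw [← Jop_sub hΦ.cont h1 h2]; exact Jop_bound hp hS hd x
    have hl : |a (Jop p Φ w1 x) - a (Jop p Φ w2 x)| ≤ A * (p * (S * d)) :=
      (coef_lip ha hA _ _).trans (mul_le_mul_of_nonneg_left hJ hA0)
    rw [e]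
    calc _ ≤ _ := abs_add_le _ _
      _ ≤ A * (p * (S * d)) * (Q * R) + C * (Q * d) := by
          rw [abs_mul, abs_mul]
          exact add_le_add (mul_le_mul hl (hz _ _ hw1 x) (abs_nonneg _) (by positivity))
            (mul_le_mul (haC _) (hz _ _ hd x) (abs_nonneg _) hC)
      _ ≤ A * (p * (S * d)) * (Q * R) + C * (Q * d) + (C * Q * R * d + A * (p * S) * Q * d) :=
          le_add_of_nonneg_right (by positivity)
      _ = _ := by ring

lemma approx_exists {c C T : ℝ} {a v0 : ℝ → ℝ} (hp : 0 < p) (hΦ : SP p Φ) (ha : Coef a c C) (hv0 : SP p v0) (hT : 0 ≤ T) :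
    ∃ g, XS p g ∧ ∀ t, 0 ≤ t → t ≤ T → g t = Jop p Φ (Fop p a (Jop p Φ (tint v0 g t))) := by
  obtain ⟨K, hK0, hK1, hK2⟩ := FJ_est hp hΦ ha
  obtain ⟨S, hS0, hS⟩ := hΦ.bdd hp
  let E := C(Set.Icc (0:ℝ) p, ℝ)
  let ex : E → ℝ → ℝ := fun v y => v (Set.projIcc 0 p hp.le y)
  have exc : ∀ v, Continuous (ex v) := fun v => v.continuous.comp continuous_projIcc
  have exb : ∀ v y, |ex v y| ≤ ‖v‖ := fun v y => v.norm_coe_le_norm _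
  have exd : ∀ v w y, |ex v y - ex w y| ≤ ‖v - w‖ := fun v w y => (v - w).norm_coe_le_norm _
  have hF : ∀ w, Continuous w → SP p (Fop p a (Jop p Φ w)) := fun w hw => Fop_sp ha.smooth (Jop_sp hΦ hw)
  let N : E → E := fun v => ⟨fun x => Jop p Φ (Fop p a (Jop p Φ (ex v))) x,
    (Jop_sp hΦ (hF _ (exc v)).cont).cont.comp continuous_subtype_val⟩
  obtain ⟨β, hβ0, hβ⟩ := ode_global N (p * (S * K)) (by positivity)
    (fun v => by
      rw [ContinuousMap.norm_le _ (by positivity)]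
      intro x
      have := Jop_bound hp hS (fun y _ => hK1 (ex v) ‖v‖ (exc v) (fun y _ => exb v y) y) x
      calc _ ≤ _ := this
        _ = _ := by ring)
    (fun R hR => ⟨p * (S * (K * (1 + R))), by positivity, fun u v hu hv => by
      rw [ContinuousMap.norm_le _ (by positivity)]
      intro x
      have := Jop_bound hp hS (fun y _ => hK2 (ex u) (ex v) R ‖u - v‖ hR (exc u) (exc v)
        (fun y _ => (exb u y).trans hu) (fun y _ => exd u v y) y) x
      rw [Jop_sub hΦ.cont (hF _ (exc u)).cont (hF _ (exc v)).cont] at this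
      calc _ ≤ _ := this
        _ = _ := by ring⟩)
    (⟨fun x => v0 x, hv0.cont.comp continuous_subtype_val⟩ : E) T hT
  have hβc : ContinuousOn β (Set.Icc 0 T) := fun t ht => (hβ t ht).continuousWithinAt
  let β' : ℝ → E := fun t => β (Set.projIcc 0 T hT t)
  have hβ'c : Continuous β' := (continuousOn_iff_continuous_domRestrict.1 hβc).comp continuous_projIcc
  have hβ' : ∀ t ∈ Set.Icc 0 T, β' t = β t := fun t ht => by
    change β (Set.projIcc 0 T hT t) = β t
    rw [Set.projIcc_of_mem hT ht]
  have hWc : Continuous fun q : ℝ × ℝ => ex (β' q.1) q.2 := by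
    have h1 : Continuous fun q : ℝ × ℝ => (β' q.1, Set.projIcc 0 p hp.le q.2) :=
      (hβ'c.comp continuous_fst).prodMk (continuous_projIcc.comp continuous_snd)
    exact continuous_eval.comp h1
  have hu := Jop_xs (W := fun t y => ex (β' t) y) hΦ hWc
  have hFx := Fop_xs ha.smooth hu
  have hg := Jop_xs (W := fun t => Fop p a (Jop p Φ (fun y => ex (β' t) y))) hΦ hFx.ct0
  refine ⟨_, hg, fun t h1 h2 => ?_⟩
  set g := fun t => Jop p Φ (Fop p a (Jop p Φ (fun y => ex (β' t) y))) with hgd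
  have key : ∀ t ∈ Set.Icc 0 T, ∀ x (hx : x ∈ Set.Icc 0 p), β t ⟨x, hx⟩ = tint v0 g t x := by
    intro t ht x hx
    have hd : ∀ s ∈ Set.Icc 0 T, HasDerivWithinAt (fun s => β s ⟨x, hx⟩ - tint v0 g s x) 0 (Set.Icc 0 T) s := by
      intro s hs
      have d1 : HasDerivWithinAt (fun s => β s ⟨x, hx⟩) (N (β s) ⟨x, hx⟩) (Set.Icc 0 T) s := by
        let ev : E →L[ℝ] ℝ := ContinuousMap.evalCLM ℝ (⟨x, hx⟩ : Set.Icc (0:ℝ) p)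
        exact ev.hasFDerivAt.comp_hasDerivWithinAt s (hβ s hs)
      have d2 := (tint_t0 hv0 hg x s).hasDerivWithinAt (s := Set.Icc 0 T)
      refine (d1.fun_sub d2).congr_deriv ?_
      change Jop p Φ (Fop p a (Jop p Φ (ex (β s)))) x - Jop p Φ (Fop p a (Jop p Φ (ex (β' s)))) x = 0
      rw [hβ' s hs, sub_self]
    have := Convex.norm_image_sub_le_of_norm_hasDerivWithin_le (C := 0) hd (fun s _ => by simp) (convex_Icc 0 T)
      (Set.left_mem_Icc.2 hT) ht
    rw [zero_mul, norm_le_zero_iff] at this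
    have e0 : β 0 ⟨x, hx⟩ = v0 x := by rw [hβ0]; rfl
    rw [e0, tint_zero] at this
    linarith
  have e1 : Jop p Φ (fun y => ex (β' t) y) = Jop p Φ (tint v0 g t) := by
    ext x
    unfold Jop
    apply intervalIntegral.integral_congr
    intro y hy
    rw [Set.uIcc_of_le hp.le] at hy
    have := key t ⟨h1, h2⟩ y hy
    simp only
    rw [← this, hβ' t ⟨h1, h2⟩]
    congr 1
    change β t (Set.projIcc 0 p hp.le y) = _
    rw [Set.projIcc_of_mem hp.le hy]
  change Jop p Φ (Fop p a (Jop p Φ (fun y => ex (β' t) y))) = _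
  rw [e1]
end

structure Appr (p : ℝ) (a v0 : ℝ → ℝ) (T : ℝ) (Φ : ℝ → ℝ) (ε : ℝ) (g : ℝ → ℝ → ℝ) : Prop where
  kern : Kern p Φ ε
  hv : SP p v0
  xs : XS p g
  eq : ∀ t, 0 ≤ t → t ≤ T → g t = Jop p Φ (Fop p a (Jop p Φ (tint v0 g t)))

section
variable {p c C T ε : ℝ} {a v0 Φ : ℝ → ℝ} {g : ℝ → ℝ → ℝ}

lemma Appr.vsp (A : Appr p a v0 T Φ ε g) (t : ℝ) : SP p (tint v0 g t) := (tint_xs A.hv A.xs).sp t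
lemma Appr.usp (A : Appr p a v0 T Φ ε g) (t : ℝ) : SP p (Jop p Φ (tint v0 g t)) := Jop_sp A.kern.sp (A.vsp t).cont

lemma Appr.Yt (A : Appr p a v0 T Φ ε g) (ha : Coef a c C) (k : ℕ) (t : ℝ) (h0 : 0 ≤ t) (hT : t ≤ T) :
    HasDerivAt (fun t => Y p (k+1) (tint v0 g t))
      (2 * -∫ x in (0:ℝ)..p, iteratedDeriv (k+2) (Jop p Φ (tint v0 g t)) x *
        iteratedDeriv k (Fop p a (Jop p Φ (tint v0 g t))) x) t := by
  refine (Y_t A.hv A.xs (k+1) t).congr_deriv ?_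
  congr 1
  have hF : SP p (Fop p a (Jop p Φ (tint v0 g t))) := Fop_sp ha.smooth (A.usp t)
  rw [← ibp_iter (A.usp t) hF, A.eq t h0 hT, Jop_iter' A.kern.sp hF, Jop_iter' A.kern.sp (A.vsp t)]
  exact (Jop_adj A.kern.sp.cont A.kern.even ((A.vsp t).iter _).cont (hF.iter _).cont).symm

lemma appr_bounds (hp : 0 < p) (ha : Coef a c C) (hT : 0 ≤ T) (v0 : ℝ → ℝ) (k : ℕ) :
    ∃ B, 0 ≤ B ∧ ∀ Φ ε g, Appr p a v0 T Φ ε g → ∀ t, 0 ≤ t → t ≤ T → ∀ j, 1 ≤ j → j ≤ k → Y p j (tint v0 g t) ≤ B := by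
  have hC : 0 ≤ C := ha.pos.le.trans ((ha.lo 0).trans (ha.hi 0))
  induction k with
  | zero => exact ⟨0, le_rfl, fun Φ ε g A t _ _ j h1 h2 => by omega⟩
  | succ k ih =>
    obtain ⟨B, hB0, hB⟩ := ih
    match k, B, hB0, hB with
    | 0, B, hB0, hB =>
      refine ⟨Y p 1 v0 * Real.exp (2 * (C / 4 * p ^ 2) * T), by have := Y_nonneg hp 1 v0; positivity, ?_⟩
      intro Φ ε g A t h0 hT' j h1 h2
      obtain rfl : j = 1 := by omega
      have := gron (f := fun t => Y p 1 (tint v0 g t)) (K := 2 * (C / 4 * p ^ 2)) (fun t h1 h2 => A.Yt ha 0 t h1 h2)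
        (fun t h1 h2 => by
          have e1 := energy1 hp ha (A.usp t)
          have e2 := Y_Jop hp A.kern (A.vsp t) 1
          have e3 : C / 4 * p ^ 2 * Y p 1 (Jop p Φ (tint v0 g t)) ≤ C / 4 * p ^ 2 * Y p 1 (tint v0 g t) := by gcongr
          simp only [zero_add, iteratedDeriv_zero]
          linarith) h0 hT'
      simp only [tint_zero] at this
      refine this.trans ?_
      have := Y_nonneg hp 1 v0
      gcongr
    | k+1, B, hB0, hB =>
      obtain ⟨Ψ, hΨ⟩ := energy hp ha k B hB0
      refine ⟨max B (Y p (k+2) v0 + 2 * |Ψ| * T), le_max_of_le_left hB0, ?_⟩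
      intro Φ ε g A t h0 hT' j h1 h2
      rcases Nat.lt_or_ge j (k+2) with h | h
      · exact (hB Φ ε g A t h0 hT' j h1 (by omega)).trans (le_max_left _ _)
      obtain rfl : j = k + 2 := by omega
      have := grow_le (f := fun t => Y p (k+2) (tint v0 g t)) (e := 2 * |Ψ|) (fun t h1 h2 => A.Yt ha (k+1) t h1 h2)
        (fun t h1 h2 => by
          have e1 := hΨ _ (A.usp t) (fun j hj1 hj2 => (Y_Jop hp A.kern (A.vsp t) j).trans (hB Φ ε g A t h1 h2 j hj1 hj2))
          have e2 : 0 ≤ c / 2 * Y p (k+3) (Jop p Φ (tint v0 g t)) := mul_nonneg (by linarith [ha.pos]) (Y_nonneg hp _ _)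
          have e3 := le_abs_self Ψ
          have e4 : k + 1 + 2 = k + 3 := rfl
          rw [e4]
          linarith) h0 hT'
      simp only [tint_zero] at this
      refine this.trans (le_max_of_le_right ?_)
      gcongr
end

lemma int_sq_le {p : ℝ} (hp : 0 < p) {f : ℝ → ℝ} (hf : Continuous f) {b : ℝ} (hb : ∀ x, |f x| ≤ b) :
    ∫ x in (0:ℝ)..p, f x ^ 2 ≤ p * b ^ 2 :=
  int_le_const hp (by fun_prop) fun x => by
    rw [← sq_abs]; exact pow_le_pow_left₀ (abs_nonneg _) (hb x) 2

/-- L² comparison of two approximations -/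
lemma appr_compare {p c C T : ℝ} {a v0 : ℝ → ℝ} (hp : 0 < p) (ha : Coef a c C) (hT : 0 ≤ T) :
    ∃ E, 0 ≤ E ∧ ∀ Φ1 ε1 g1 Φ2 ε2 g2, Appr p a v0 T Φ1 ε1 g1 → Appr p a v0 T Φ2 ε2 g2 → ε1 ≤ p → ε2 ≤ p →
      ∀ t, 0 ≤ t → t ≤ T → ∫ x in (0:ℝ)..p, (tint v0 g1 t x - tint v0 g2 t x) ^ 2 ≤ E * (ε1 + ε2) := by
  obtain ⟨B, hB0, hB⟩ := appr_bounds hp ha hT v0 3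
  obtain ⟨K, hK0, hK⟩ := diff_est hp ha B
  obtain ⟨L, hL0, hL⟩ := (Loc.der (p := p) (a := a) 1 1 le_rfl le_rfl).bound hp ha B
  obtain ⟨M, hM0, hM⟩ := (Fop_loc p a).bound hp ha B
  set K1 := 4 * K + 1 with hK1
  have hK1p : 0 < K1 := by positivity
  set K2 := 2 * (K * (2 * (p * (2 * p * L ^ 2))) + p * (L * M) + p * (L * M)) with hK2
  have hK20 : 0 ≤ K2 := by positivity
  refine ⟨K2 / K1 * Real.exp (K1 * T), by positivity, ?_⟩
  intro Φ1 ε1 g1 Φ2 ε2 g2 A1 A2 hε1 hε2 t h0 hT'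
  set e := ε1 + ε2 with he
  have he0 : 0 ≤ e := add_nonneg A1.kern.e0 A2.kern.e0
  have he2 : e ^ 2 ≤ 2 * p * e := by nlinarith
  have hder : ∀ t, 0 ≤ t → t ≤ T → HasDerivAt (fun t => ∫ x in (0:ℝ)..p, (tint v0 g1 t x - tint v0 g2 t x) ^ 2)
      (∫ x in (0:ℝ)..p, 2 * ((tint v0 g1 t x - tint v0 g2 t x) * (g1 t x - g2 t x))) t := by
    intro t _ _
    have c1 := (tint_xs A1.hv A1.xs).ct0
    have c2 := (tint_xs A2.hv A2.xs).ct0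
    have c3 := A1.xs.ct0
    have c4 := A2.xs.ct0
    refine hasDeriv_param (f := fun t x => (tint v0 g1 t x - tint v0 g2 t x) ^ 2)
      (f' := fun t x => 2 * ((tint v0 g1 t x - tint v0 g2 t x) * (g1 t x - g2 t x))) ?_ ?_ ?_ 0 p t
    · change Continuous fun q : ℝ × ℝ => (tint v0 g1 q.1 q.2 - tint v0 g2 q.1 q.2) ^ 2
      fun_prop
    · change Continuous fun q : ℝ × ℝ => 2 * ((tint v0 g1 q.1 q.2 - tint v0 g2 q.1 q.2) * (g1 q.1 q.2 - g2 q.1 q.2))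
      fun_prop
    · intro t x
      exact (((tint_t0 A1.hv A1.xs x t).fun_sub (tint_t0 A2.hv A2.xs x t)).fun_pow 2).congr_deriv (by norm_num; ring)
  have hest : ∀ t, 0 ≤ t → t ≤ T → ∫ x in (0:ℝ)..p, 2 * ((tint v0 g1 t x - tint v0 g2 t x) * (g1 t x - g2 t x))
      ≤ K1 * (∫ x in (0:ℝ)..p, (tint v0 g1 t x - tint v0 g2 t x) ^ 2) + K2 * e := by
    intro t h0 hT
    have s1 := A1.vsp t
    have s2 := A2.vsp t
    have hB1 := hB _ _ _ A1 t h0 hT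
    have hB2 := hB _ _ _ A2 t h0 hT
    have eg1 := A1.eq t h0 hT
    have eg2 := A2.eq t h0 hT
    set v1 := tint v0 g1 t with hv1
    set v2 := tint v0 g2 t with hv2
    have su1 : SP p (Jop p Φ1 v1) := A1.usp t
    have su2 : SP p (Jop p Φ2 v2) := A2.usp t
    have s12 : SP p (Jop p Φ1 v2) := Jop_sp A1.kern.sp s2.cont
    have s21 : SP p (Jop p Φ2 v1) := Jop_sp A2.kern.sp s1.cont
    have bu1 : ∀ j, 1 ≤ j → j ≤ 3 → Y p j (Jop p Φ1 v1) ≤ B := fun j h1 h2 => (Y_Jop hp A1.kern s1 j).trans (hB1 j h1 h2)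
    have bu2 : ∀ j, 1 ≤ j → j ≤ 3 → Y p j (Jop p Φ2 v2) ≤ B := fun j h1 h2 => (Y_Jop hp A2.kern s2 j).trans (hB2 j h1 h2)
    set F1 := Fop p a (Jop p Φ1 v1) with hF1
    set F2 := Fop p a (Jop p Φ2 v2) with hF2
    have sF1 : SP p F1 := Fop_sp ha.smooth su1
    have sF2 : SP p F2 := Fop_sp ha.smooth su2
    have bF1 : ∀ x, |F1 x| ≤ M := hM _ su1 bu1
    have bF2 : ∀ x, |F2 x| ≤ M := hM _ su2 bu2
    have bL1 : ∀ x, |iteratedDeriv 1 v1 x| ≤ L := hL _ s1 fun j h1 h2 => hB1 j h1 (by omega)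
    have bL2 : ∀ x, |iteratedDeriv 1 v2 x| ≤ L := hL _ s2 fun j h1 h2 => hB2 j h1 (by omega)
    have be2 : ∀ x, |Jop p Φ1 v2 x - Jop p Φ2 v2 x| ≤ e * L := fun x => by
      have h1 := A1.kern.mom _ s2 L bL2 x
      have h2 := A2.kern.mom _ s2 L bL2 x
      have := abs_sub_le (Jop p Φ1 v2 x) (v2 x) (Jop p Φ2 v2 x)
      rw [abs_sub_comm (v2 x)] at this
      rw [he]; linarith
    have be1 : ∀ x, |Jop p Φ2 v1 x - Jop p Φ1 v1 x| ≤ e * L := fun x => by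
      have h1 := A1.kern.mom _ s1 L bL1 x
      have h2 := A2.kern.mom _ s1 L bL1 x
      have := abs_sub_le (Jop p Φ2 v1 x) (v1 x) (Jop p Φ1 v1 x)
      rw [abs_sub_comm (v1 x)] at this
      rw [he]; linarith
    have c1 := s1.cont
    have c2 := s2.cont
    have cu1 := su1.cont
    have cu2 := su2.cont
    have c12 := s12.cont
    have c21 := s21.cont
    have cF1 := sF1.cont
    have cF2 := sF2.cont
    have cg1 : Continuous (g1 t) := (A1.xs.sp t).cont
    have cg2 : Continuous (g2 t) := (A2.xs.sp t).cont
    -- main identity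
    have hid : ∫ x in (0:ℝ)..p, (v1 x - v2 x) * (g1 t x - g2 t x)
        = (∫ x in (0:ℝ)..p, (Jop p Φ1 v1 x - Jop p Φ2 v2 x) * (F1 x - F2 x))
          + ((∫ x in (0:ℝ)..p, -((Jop p Φ1 v2 x - Jop p Φ2 v2 x) * F1 x))
          + ∫ x in (0:ℝ)..p, -((Jop p Φ2 v1 x - Jop p Φ1 v1 x) * F2 x)) := by
      have a1 := Jop_adj (p := p) A1.kern.sp.cont A1.kern.even (f := fun x => v1 x - v2 x) (g := F1) (by fun_prop) cF1
      have a2 := Jop_adj (p := p) A2.kern.sp.cont A2.kern.even (f := fun x => v1 x - v2 x) (g := F2) (by fun_prop) cF2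
      simp_rw [Jop_sub A1.kern.sp.cont c1 c2] at a1
      simp_rw [Jop_sub A2.kern.sp.cont c1 c2] at a2
      rw [← eg1] at a1
      rw [← eg2] at a2
      have e1 : ∫ x in (0:ℝ)..p, (v1 x - v2 x) * (g1 t x - g2 t x)
          = (∫ x in (0:ℝ)..p, (v1 x - v2 x) * g1 t x) + ∫ x in (0:ℝ)..p, -((v1 x - v2 x) * g2 t x) := by
        rw [← int_add_le (by fun_prop) (by fun_prop)]; congr 1; ext x; ring
      rw [e1, intervalIntegral.integral_neg, ← a1, ← a2, ← intervalIntegral.integral_neg,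
        ← int_add_le (by fun_prop) (by fun_prop), ← int_add_le (by fun_prop) (by fun_prop),
        ← int_add_le (by fun_prop) (by fun_prop)]
      congr 1; ext x; ring
    have i1 := hK _ _ su1 su2 bu1 bu2
    have i2 : ∫ x in (0:ℝ)..p, -((Jop p Φ1 v2 x - Jop p Φ2 v2 x) * F1 x) ≤ p * (e * L * M) :=
      int_le_const hp (by fun_prop) fun x => (neg_le_abs _).trans (by
        rw [abs_mul]; exact mul_le_mul (be2 x) (bF1 x) (abs_nonneg _) (by positivity))
    have i3 : ∫ x in (0:ℝ)..p, -((Jop p Φ2 v1 x - Jop p Φ1 v1 x) * F2 x) ≤ p * (e * L * M) :=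
      int_le_const hp (by fun_prop) fun x => (neg_le_abs _).trans (by
        rw [abs_mul]; exact mul_le_mul (be1 x) (bF2 x) (abs_nonneg _) (by positivity))
    have i4 : ∫ x in (0:ℝ)..p, (Jop p Φ1 v1 x - Jop p Φ2 v2 x) ^ 2
        ≤ 2 * (∫ x in (0:ℝ)..p, (v1 x - v2 x) ^ 2) + 2 * (p * (e * L) ^ 2) := by
      have j1 : ∫ x in (0:ℝ)..p, (Jop p Φ1 v1 x - Jop p Φ1 v2 x) ^ 2 ≤ ∫ x in (0:ℝ)..p, (v1 x - v2 x) ^ 2 := by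
        have := Y_Jop hp A1.kern (s1.sub s2) 0
        unfold Y at this
        simpa only [iteratedDeriv_zero, Jop_sub A1.kern.sp.cont c1 c2] using this
      have j2 := int_sq_le hp (f := fun x => Jop p Φ1 v2 x - Jop p Φ2 v2 x) (by fun_prop) be2
      have j3 : ∫ x in (0:ℝ)..p, (Jop p Φ1 v1 x - Jop p Φ2 v2 x) ^ 2
          ≤ ∫ x in (0:ℝ)..p, (2 * (Jop p Φ1 v1 x - Jop p Φ1 v2 x) ^ 2 + 2 * (Jop p Φ1 v2 x - Jop p Φ2 v2 x) ^ 2) := by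
        apply int_le_of_le hp (by fun_prop) (by fun_prop)
        intro x
        nlinarith [sq_nonneg ((Jop p Φ1 v1 x - Jop p Φ1 v2 x) - (Jop p Φ1 v2 x - Jop p Φ2 v2 x))]
      rw [int_add_le (by fun_prop) (by fun_prop), intervalIntegral.integral_const_mul, intervalIntegral.integral_const_mul] at j3
      linarith
    rw [intervalIntegral.integral_const_mul, hid]
    have hy : 0 ≤ ∫ x in (0:ℝ)..p, (v1 x - v2 x) ^ 2 := intervalIntegral.integral_nonneg hp.le fun _ _ => sq_nonneg _
    have i5 := mul_le_mul_of_nonneg_left i4 hK0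
    have i6 : K * (2 * (p * (e * L) ^ 2)) ≤ K * (2 * (p * (2 * p * L ^ 2))) * e := by
      have : (e * L) ^ 2 ≤ 2 * p * L ^ 2 * e := by
        calc (e * L) ^ 2 = e ^ 2 * L ^ 2 := by ring
          _ ≤ 2 * p * e * L ^ 2 := by gcongr
          _ = _ := by ring
      calc K * (2 * (p * (e * L) ^ 2)) ≤ K * (2 * (p * (2 * p * L ^ 2 * e))) := by gcongr
        _ = _ := by ring
    rw [hK1, hK2]
    nlinarith
  have := gron' hK1p hder hest h0 hT'
  simp only [tint_zero, sub_self] at this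
  have e0 : ∫ x in (0:ℝ)..p, (0:ℝ) ^ 2 = 0 := by simp
  rw [e0, zero_add] at this
  have h1 : 0 ≤ K2 * e / K1 := by positivity
  calc _ ≤ _ := this
    _ ≤ K2 * e / K1 * Real.exp (K1 * t) := by linarith
    _ ≤ K2 * e / K1 * Real.exp (K1 * T) := by gcongr
    _ = _ := by ring

lemma iter_sub {p : ℝ} {u v : ℝ → ℝ} (hu : SP p u) (hv : SP p v) (k : ℕ) :
    iteratedDeriv k (fun x => u x - v x) = fun x => iteratedDeriv k u x - iteratedDeriv k v x := by
  have := ladder_iter (D := fun k x => iteratedDeriv k u x - iteratedDeriv k v x)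
    (fun k x => (hu.hasDeriv_iter k x).fun_sub (hv.hasDeriv_iter k x)) k
  simpa only [iteratedDeriv_zero] using this

lemma Y_sub_le {p : ℝ} (hp : 0 < p) {u v : ℝ → ℝ} (hu : SP p u) (hv : SP p v) (k : ℕ) :
    Y p k (fun x => u x - v x) ≤ 2 * Y p k u + 2 * Y p k v := by
  unfold Y
  have c1 := (hu.iter k).cont
  have c2 := (hv.iter k).cont
  rw [iter_sub hu hv, ← intervalIntegral.integral_const_mul, ← intervalIntegral.integral_const_mul,
    ← int_add_le (by fun_prop) (by fun_prop)]
  apply int_le_of_le hp (by fun_prop) (by fun_prop)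
  intro x
  nlinarith [sq_nonneg (iteratedDeriv k u x + iteratedDeriv k v x)]

lemma mean_sq_le {p : ℝ} (hp : 0 < p) {u : ℝ → ℝ} (hu : SP p u) : (mean p u) ^ 2 ≤ 1 / p * Y p 0 u := by
  have := cs (f := u) (g := fun _ => 1) hu.cont continuous_const hp.le
  simp only [mul_one, one_pow, intervalIntegral.integral_const, sub_zero, smul_eq_mul] at this
  unfold mean Y
  simp only [iteratedDeriv_zero]
  rw [mul_pow]
  calc _ ≤ (1 / p) ^ 2 * ((∫ x in (0:ℝ)..p, u x ^ 2) * p) := by gcongr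
    _ = _ := by field_simp

/-- interpolation for a two-parameter family -/
lemma interp_small {p : ℝ} (hp : 0 < p) {ι : Type*} {S : ι → Prop} (l : Filter ι) (w : ι → ℝ → ℝ → ℝ) {τ : Set ℝ}
    (hsp : ∀ i, S i → ∀ t ∈ τ, SP p (w i t)) (hS : ∀ᶠ i in l, S i) (k0 : ℕ)
    (hbd : ∀ k, k0 ≤ k → ∃ B, 0 ≤ B ∧ ∀ i, S i → ∀ t ∈ τ, Y p (k+1) (w i t) ≤ B)
    (h0 : ∀ η > 0, ∀ᶠ i in l, ∀ t ∈ τ, Y p k0 (w i t) ≤ η) (k : ℕ) (hk : k0 ≤ k) :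
    ∀ η > 0, ∀ᶠ i in l, ∀ t ∈ τ, Y p k (w i t) ≤ η := by
  induction k, hk using Nat.le_induction with
  | base => exact h0
  | succ k hk ih =>
    intro η hη
    obtain ⟨B, hB0, hB⟩ := hbd (k+1) (by omega)
    filter_upwards [ih (η ^ 2 / (B + 1)) (by positivity), hS] with i hi hSi t ht
    have h1 := Y_interp hp (hsp i hSi t ht) k
    have h2 := hi t ht
    have h3 := hB i hSi t ht
    have h4 : Y p k (w i t) * Y p (k+2) (w i t) ≤ η ^ 2 / (B + 1) * (B + 1) :=
      mul_le_mul h2 (by linarith) (Y_nonneg hp _ _) (by positivity)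
    rw [div_mul_cancel₀ _ (by positivity)] at h4
    exact (pow_le_pow_iff_left₀ (Y_nonneg hp _ _) hη.le two_ne_zero).1 (h1.trans h4)

lemma sup_le_Y {p : ℝ} (hp : 0 < p) {u : ℝ → ℝ} (hu : SP p u) (k : ℕ) (x : ℝ) :
    (iteratedDeriv k u x) ^ 2 ≤ 2 * p * Y p (k+1) u + 2 / p * Y p 0 u := by
  have h0 := Y_nonneg hp 0 u
  have h1 := Y_nonneg hp (k+1) u
  rcases Nat.eq_zero_or_pos k with rfl | h
  · have a1 := sup_dev hp hu x
    have a2 := mean_sq_le hp hu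
    simp only [iteratedDeriv_zero, zero_add]
    have e : 2 / p * Y p 0 u = 2 * (1 / p * Y p 0 u) := by ring
    rw [e]
    nlinarith [sq_nonneg (u x - 2 * mean p u)]
  · have a1 := sup_iter hp hu h x
    have : 0 ≤ 2 / p * Y p 0 u := by positivity
    nlinarith [mul_nonneg hp.le h1]

lemma unif_lim {X : Type*} (f : ℕ → X → ℝ) (h : ∀ η > 0, ∃ N, ∀ i ≥ N, ∀ j ≥ N, ∀ x, |f i x - f j x| ≤ η) :
    ∃ F : X → ℝ, TendstoUniformly f F atTop := by
  have hc : ∀ x, ∃ l, Tendsto (fun n => f n x) atTop (nhds l) := fun x => by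
    apply cauchySeq_tendsto_of_complete
    rw [Metric.cauchySeq_iff]
    intro η hη
    obtain ⟨N, hN⟩ := h (η / 2) (by linarith)
    exact ⟨N, fun i hi j hj => by rw [Real.dist_eq]; linarith [hN i hi j hj x]⟩
  choose F hF using hc
  refine ⟨F, ?_⟩
  rw [Metric.tendstoUniformly_iff]
  intro η hη
  obtain ⟨N, hN⟩ := h (η / 2) (by linarith)
  filter_upwards [eventually_ge_atTop N] with i hi x
  have h1 : Tendsto (fun j => |f i x - f j x|) atTop (nhds |f i x - F x|) := (tendsto_const_nhds.sub (hF x)).abs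
  have := le_of_tendsto h1 (eventually_atTop.2 ⟨N, fun j hj => hN i hi j hj x⟩)
  rw [dist_comm, Real.dist_eq]; linarith

lemma mean_Jop {p ε : ℝ} {Φ v : ℝ → ℝ} (h : Kern p Φ ε) (hv : Continuous v) : mean p (Jop p Φ v) = mean p v := by
  have := Jop_adj (p := p) h.sp.cont h.even hv (g := fun _ => 1) continuous_const
  unfold mean
  simp only [mul_one, Jop_one h] at this
  rw [this]

noncomputable def clamp (T t : ℝ) : ℝ := max 0 (min t T)
lemma clamp_cont (T : ℝ) : Continuous (clamp T) := by unfold clamp; fun_prop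
lemma clamp_nn (T t : ℝ) : 0 ≤ clamp T t := le_max_left _ _
lemma clamp_le {T : ℝ} (hT : 0 ≤ T) (t : ℝ) : clamp T t ≤ T := max_le hT (min_le_right _ _)
lemma clamp_eq {T t : ℝ} (h0 : 0 ≤ t) (h1 : t ≤ T) : clamp T t = t := by
  unfold clamp; rw [min_eq_left h1, max_eq_right h0]

lemma exists_T {p c C T : ℝ} {a v0 : ℝ → ℝ} (hp : 0 < p) (ha : Coef a c C) (hv0 : SP p v0) (hT : 0 ≤ T) :
    ∃ g, XS p g ∧ ∀ t, 0 ≤ t → t ≤ T → g t = Fop p a (tint v0 g t) := by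
  have hex : ∀ n : ℕ, ∃ Φ g, Appr p a v0 T Φ (p / √(n + 2)) g := fun n => by
    obtain ⟨Φ, hΦ⟩ := kern_ex hp n
    obtain ⟨g, h1, h2⟩ := approx_exists hp hΦ.sp ha hv0 hT
    exact ⟨Φ, g, hΦ, hv0, h1, h2⟩
  choose Φ g A using hex
  set ε : ℕ → ℝ := fun n => p / √(n + 2) with hε
  have hε0 : Tendsto ε atTop (nhds 0) := by
    have h1 : Tendsto (fun n : ℕ => √((n:ℝ) + 2)) atTop atTop :=
      Real.tendsto_sqrt_atTop.comp (tendsto_atTop_add_const_right _ _ tendsto_natCast_atTop_atTop)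
    exact h1.const_div_atTop p
  have hεp : ∀ n, ε n ≤ p := fun n => by
    apply div_le_self hp.le
    rw [Real.one_le_sqrt]; have : (0:ℝ) ≤ n := Nat.cast_nonneg n
    linarith
  set v : ℕ → ℝ → ℝ → ℝ := fun n t => tint v0 (g n) t with hv
  have vsp : ∀ n t, SP p (v n t) := fun n t => (A n).vsp t
  have hB : ∀ k, ∃ B, 0 ≤ B ∧ ∀ n t, 0 ≤ t → t ≤ T → ∀ j, 1 ≤ j → j ≤ k → Y p j (v n t) ≤ B := fun k => by
    obtain ⟨B, h0, h⟩ := appr_bounds hp ha hT v0 k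
    exact ⟨B, h0, fun n t h1 h2 => h _ _ _ (A n) t h1 h2⟩
  obtain ⟨E, hE0, hE⟩ := appr_compare (v0 := v0) hp ha hT
  -- all Y seminorms of differences are small
  have hYs : ∀ k, ∀ η > 0, ∀ᶠ q : ℕ × ℕ in atTop, ∀ t ∈ Set.Icc 0 T, Y p k (fun x => v q.1 t x - v q.2 t x) ≤ η := by
    intro k
    refine interp_small hp (S := fun _ => True) atTop (fun (q : ℕ × ℕ) t x => v q.1 t x - v q.2 t x)
      (fun q _ t _ => (vsp _ t).sub (vsp _ t)) (Eventually.of_forall fun _ => trivial) 0 ?_ ?_ k (Nat.zero_le _)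
    · intro k _
      obtain ⟨B, hB0, hB⟩ := hB (k+1)
      refine ⟨2 * B + 2 * B, by positivity, fun q _ t ht => ?_⟩
      have := Y_sub_le hp (vsp q.1 t) (vsp q.2 t) (k+1)
      have b1 := hB q.1 t ht.1 ht.2 (k+1) (by omega) le_rfl
      have b2 := hB q.2 t ht.1 ht.2 (k+1) (by omega) le_rfl
      linarith
    · intro η hη
      have h1 : ∀ᶠ n in atTop, ε n < η / (2 * (E + 1)) := hε0.eventually_lt_const (by positivity)
      rw [← prod_atTop_atTop_eq]
      filter_upwards [h1.prod_mk h1] with q hq t ht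
      have := hE _ _ _ _ _ _ (A q.1) (A q.2) (hεp _) (hεp _) t ht.1 ht.2
      unfold Y; simp only [iteratedDeriv_zero]
      refine this.trans ?_
      have e0 : 0 ≤ ε q.1 + ε q.2 := add_nonneg (A q.1).kern.e0 (A q.2).kern.e0
      calc E * (ε q.1 + ε q.2) ≤ (E + 1) * (η / (2 * (E + 1)) + η / (2 * (E + 1))) :=
            mul_le_mul (by linarith) (add_le_add hq.1.le hq.2.le) e0 (by positivity)
        _ = η := by field_simp; norm_num
  have hsup : ∀ k, ∃ F : ℝ × ℝ → ℝ, TendstoUniformly (fun n (q : ℝ × ℝ) => iteratedDeriv k (v n (clamp T q.1)) q.2) F atTop := by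
    intro k
    apply unif_lim
    intro η hη
    have h1 := hYs (k+1) (η ^ 2 / (4 * p)) (by positivity)
    have h2 := hYs 0 (p * η ^ 2 / 4) (by positivity)
    obtain ⟨N, hN⟩ := eventually_atTop_prod_self.1 (h1.and h2)
    refine ⟨N, fun i hi j hj x => ?_⟩
    have ht : clamp T x.1 ∈ Set.Icc 0 T := ⟨clamp_nn _ _, clamp_le hT _⟩
    have h3 := (hN i j hi hj).1 _ ht
    have h4 := (hN i j hi hj).2 _ ht
    have h5 := sup_le_Y hp ((vsp i (clamp T x.1)).sub (vsp j (clamp T x.1))) k x.2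
    rw [iter_sub (vsp _ _) (vsp _ _)] at h5
    apply abs_le_of_sq_le_sq _ hη.le
    have h6 := mul_le_mul_of_nonneg_left h3 (by positivity : 0 ≤ 2 * p)
    have h7 := mul_le_mul_of_nonneg_left h4 (by positivity : 0 ≤ 2 / p)
    have e1 : 2 * p * (η ^ 2 / (4 * p)) = η ^ 2 / 2 := by field_simp; norm_num
    have e2 : 2 / p * (p * η ^ 2 / 4) = η ^ 2 / 2 := by field_simp; norm_num
    simp only at h5 h6 h7
    linarith
  choose D hD using hsup
  have hxs : ∀ n, XS p (fun t => v n (clamp T t)) := fun n => (tint_xs (A n).hv (A n).xs).time (clamp_cont T)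
  have hDc : ∀ k, Continuous (D k) := fun k => (hD k).continuous (Frequently.of_forall fun n => (hxs n).ct k)
  have hDd : ∀ t k x, HasDerivAt (fun x => D k (t, x)) (D (k+1) (t, x)) x := by
    intro t k x
    refine hasDerivAt_of_tendstoUniformly (l := atTop) (f := fun n x => iteratedDeriv k (v n (clamp T t)) x)
      (f' := fun n x => iteratedDeriv (k+1) (v n (clamp T t)) x) (g' := fun x => D (k+1) (t, x)) ?_ ?_ ?_ x
    · exact (hD (k+1)).comp (fun x => (t, x))
    · exact Eventually.of_forall fun n x => (vsp n _).hasDeriv_iter k x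
    · intro x; exact (hD k).tendsto_at (t, x)
  set V : ℝ → ℝ → ℝ := fun t x => D 0 (t, x) with hVd
  have hVi : ∀ k t, iteratedDeriv k (V t) = fun x => D k (t, x) := fun k t =>
    ladder_iter (D := fun k x => D k (t, x)) (hDd t) k
  have hp0 : ∀ k t x, Tendsto (fun n => iteratedDeriv k (v n (clamp T t)) x) atTop (nhds (iteratedDeriv k (V t) x)) := by
    intro k t x
    rw [hVi]; exact (hD k).tendsto_at (t, x)
  have hVx : XS p V := by
    refine ⟨fun t => ⟨ladder_smooth (D := fun k x => D k (t, x)) (hDd t), fun x => ?_⟩, fun k => ?_⟩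
    · have h1 := (hD 0).tendsto_at (t, x)
      have h2 := (hD 0).tendsto_at (t, x + p)
      simp only [iteratedDeriv_zero, (vsp _ _).per x] at h1 h2
      exact tendsto_nhds_unique h2 h1
    · simp_rw [hVi]; exact hDc k
  have hVclamp : ∀ t, 0 ≤ t → t ≤ T → V (clamp T t) = V t := fun t h0 h1 => by rw [clamp_eq h0 h1]
  have hmean : ∀ t, Tendsto (fun n => mean p (v n (clamp T t))) atTop (nhds (mean p (V t))) := by
    intro t
    rw [Metric.tendsto_nhds]
    intro η hη
    have := Metric.tendstoUniformly_iff.1 (hD 0) (η / 2) (by linarith)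
    filter_upwards [this] with n hn
    rw [dist_comm, Real.dist_eq, ← mean_sub (hVx.sp t).cont (vsp n _).cont]
    refine (abs_mean_le hp (C := η / 2) fun x => ?_).trans_lt (by linarith)
    have := (hn (t, x)).le
    rw [Real.dist_eq, iteratedDeriv_zero] at this
    exact this
  -- limits of the approximating right hand sides
  obtain ⟨B, hB0, hB4⟩ := hB 4
  obtain ⟨L1, hL10, hL1⟩ := (Loc.der (p := p) (a := a) 1 1 le_rfl le_rfl).bound hp ha B
  obtain ⟨L3, hL30, hL3⟩ := (Loc.der (p := p) (a := a) 3 3 (by norm_num) le_rfl).bound hp ha B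
  obtain ⟨M, hM0, hM⟩ := (Fop_loc p a).bound hp ha B
  obtain ⟨Q, lQ, hQ⟩ := (Fop_loc p a).iter_ex ha.smooth 1
  obtain ⟨M1, hM10, hM1⟩ := lQ.bound hp ha B
  have hFb : ∀ n t, 0 ≤ t → t ≤ T → ∀ x, |g n t x - Fop p a (Jop p (Φ n) (v n t)) x| ≤ ε n * M1 ∧
      |Fop p a (Jop p (Φ n) (v n t)) x| ≤ M := by
    intro n t h0 h1 x
    have bu : ∀ j, 1 ≤ j → j ≤ 4 → Y p j (Jop p (Φ n) (v n t)) ≤ B := fun j h2 h3 =>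
      (Y_Jop hp (A n).kern (vsp n t) j).trans (hB4 n t h0 h1 j h2 h3)
    have su : SP p (Jop p (Φ n) (v n t)) := (A n).usp t
    refine ⟨?_, hM _ su (fun j h2 h3 => bu j h2 (by omega)) x⟩
    rw [(A n).eq t h0 h1]
    apply (A n).kern.mom _ (Fop_sp ha.smooth su)
    intro y
    rw [hQ _ su]
    exact hM1 _ su bu y
  have hclose : ∀ k L t x, 0 ≤ t → t ≤ T → (∀ n x, |iteratedDeriv (k+1) (v n t) x| ≤ L) →
      Tendsto (fun n => iteratedDeriv k (Jop p (Φ n) (v n t)) x) atTop (nhds (iteratedDeriv k (V t) x)) := by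
    intro k L t x h0 h1 hL
    have h2 := hp0 k t x
    rw [clamp_eq h0 h1] at h2
    have h3 : Tendsto (fun n => iteratedDeriv k (Jop p (Φ n) (v n t)) x - iteratedDeriv k (v n t) x) atTop (nhds 0) := by
      apply squeeze_zero_norm (a := fun n => ε n * L) _ (by simpa using hε0.mul_const L)
      intro n
      rw [Real.norm_eq_abs, Jop_iter' (A n).kern.sp (vsp n t)]
      apply (A n).kern.mom _ ((vsp n t).iter k)
      intro y
      have : iteratedDeriv 1 (iteratedDeriv k (v n t)) y = iteratedDeriv (k+1) (v n t) y := by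
        rw [iteratedDeriv_one, ← iteratedDeriv_succ]
      rw [this]; exact hL n y
    have := h3.add h2
    simpa using this
  have hglim : ∀ t, 0 ≤ t → t ≤ T → ∀ x, Tendsto (fun n => g n t x) atTop (nhds (Fop p a (V t) x)) := by
    intro t h0 h1 x
    have a0 := hclose 0 L1 t x h0 h1 (fun n => hL1 _ (vsp n t) fun j h2 h3 => hB4 n t h0 h1 j h2 (by omega))
    have a2 := hclose 2 L3 t x h0 h1 (fun n => hL3 _ (vsp n t) fun j h2 h3 => hB4 n t h0 h1 j h2 (by omega))
    have am : Tendsto (fun n => mean p (Jop p (Φ n) (v n t))) atTop (nhds (mean p (V t))) := by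
      have := hmean t
      rw [clamp_eq h0 h1] at this
      simp_rw [mean_Jop (A _).kern (vsp _ t).cont]
      exact this
    simp only [iteratedDeriv_zero] at a0
    have hF : Tendsto (fun n => Fop p a (Jop p (Φ n) (v n t)) x) atTop (nhds (Fop p a (V t) x)) :=
      ((ha.smooth.continuous.tendsto _).comp a0).mul (a2.add (a0.sub am))
    have hz : Tendsto (fun n => g n t x - Fop p a (Jop p (Φ n) (v n t)) x) atTop (nhds 0) := by
      apply squeeze_zero_norm (a := fun n => ε n * M1) _ (by simpa using hε0.mul_const M1)
      intro n; exact (hFb n t h0 h1 x).1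
    have := hz.add hF
    simpa using this
  have hgx : XS p (fun t => Fop p a (V t)) := Fop_xs ha.smooth hVx
  refine ⟨fun t => Fop p a (V t), hgx, fun t h0 h1 => ?_⟩
  have : V t = tint v0 (fun t => Fop p a (V t)) t := by
    ext x
    have l1 := hp0 0 t x
    simp only [iteratedDeriv_zero] at l1
    rw [clamp_eq h0 h1] at l1
    refine tendsto_nhds_unique l1 ?_
    change Tendsto (fun n => v0 x + ∫ s in (0:ℝ)..t, g n s x) atTop (nhds (v0 x + ∫ s in (0:ℝ)..t, Fop p a (V s) x))
    apply Tendsto.const_add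
    apply intervalIntegral.tendsto_integral_filter_of_dominated_convergence (fun _ => p * M1 + M)
    · refine Eventually.of_forall fun n => ?_
      have : Continuous fun s => g n s x := (A n).xs.ct0.comp (Continuous.prodMk_left x)
      exact this.aestronglyMeasurable
    · refine Eventually.of_forall fun n => Eventually.of_forall fun s hs => ?_
      rw [Set.uIoc_of_le h0] at hs
      have hb := hFb n s hs.1.le (hs.2.trans h1) x
      have := abs_add_le (g n s x - Fop p a (Jop p (Φ n) (v n s)) x) (Fop p a (Jop p (Φ n) (v n s)) x)
      rw [sub_add_cancel] at this
      rw [Real.norm_eq_abs]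
      have h3 : ε n * M1 ≤ p * M1 := mul_le_mul_of_nonneg_right (hεp n) hM10
      linarith [hb.1, hb.2]
    · simp
    · refine Eventually.of_forall fun s hs => ?_
      rw [Set.uIoc_of_le h0] at hs
      exact hglim s hs.1.le (hs.2.trans h1) x
  rw [← this]

section
variable {p c C T : ℝ} {a v0 : ℝ → ℝ}

lemma Y_bdd {g : ℝ → ℝ → ℝ} (hv0 : SP p v0) (hg : XS p g) (T : ℝ) (k : ℕ) :
    ∃ B, ∀ t, 0 ≤ t → t ≤ T → ∀ j, j ≤ k → Y p j (tint v0 g t) ≤ B := by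
  have h1 : ∀ j, ∃ B, ∀ t, 0 ≤ t → t ≤ T → Y p j (tint v0 g t) ≤ B := fun j => by
    have hc : Continuous fun t => Y p j (tint v0 g t) :=
      continuous_iff_continuousAt.2 fun t => (Y_t hv0 hg j t).continuousAt
    obtain ⟨B, hB⟩ := (isCompact_Icc (a := (0:ℝ)) (b := T)).exists_bound_of_continuousOn hc.continuousOn
    exact ⟨B, fun t h0 h1 => (le_abs_self _).trans (hB t ⟨h0, h1⟩)⟩
  choose B hB using h1
  refine ⟨∑ j ∈ Finset.range (k+1), |B j|, fun t h0 h1 j hj => ?_⟩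
  calc _ ≤ |B j| := (hB j t h0 h1).trans (le_abs_self _)
    _ ≤ _ := Finset.single_le_sum (f := fun j => |B j|) (fun i _ => abs_nonneg _) (Finset.mem_range.2 (by omega))

lemma sq_int_zero (hp : 0 < p) {u : ℝ → ℝ} (hu : SP p u) (h : ∫ x in (0:ℝ)..p, u x ^ 2 ≤ 0) (x : ℝ) : u x = 0 := by
  have c := hu.cont
  by_contra hx
  obtain ⟨y, hy, hxy⟩ := hu.per.exists_mem_Ico₀ hp x
  have : 0 < ∫ x in (0:ℝ)..p, u x ^ 2 :=
    intervalIntegral.integral_pos hp (by fun_prop) (fun _ _ => sq_nonneg _) ⟨y, ⟨hy.1, hy.2.le⟩, by rw [← hxy]; positivity⟩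
  linarith

lemma unique_T (hp : 0 < p) (ha : Coef a c C) (hv0 : SP p v0) {g1 g2 : ℝ → ℝ → ℝ} (h1 : XS p g1) (h2 : XS p g2)
    (e1 : ∀ t, 0 ≤ t → t ≤ T → g1 t = Fop p a (tint v0 g1 t))
    (e2 : ∀ t, 0 ≤ t → t ≤ T → g2 t = Fop p a (tint v0 g2 t)) {t : ℝ} (h0 : 0 ≤ t) (hT : t ≤ T) :
    tint v0 g1 t = tint v0 g2 t := by
  obtain ⟨B1, hB1⟩ := Y_bdd hv0 h1 T 3
  obtain ⟨B2, hB2⟩ := Y_bdd hv0 h2 T 3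
  obtain ⟨K, hK0, hK⟩ := diff_est hp ha (max B1 B2)
  have x1 := tint_xs hv0 h1
  have x2 := tint_xs hv0 h2
  have hder : ∀ t, 0 ≤ t → t ≤ T → HasDerivAt (fun t => ∫ x in (0:ℝ)..p, (tint v0 g1 t x - tint v0 g2 t x) ^ 2)
      (∫ x in (0:ℝ)..p, 2 * ((tint v0 g1 t x - tint v0 g2 t x) * (g1 t x - g2 t x))) t := by
    intro t _ _
    have c1 := x1.ct0
    have c2 := x2.ct0
    have c3 := h1.ct0
    have c4 := h2.ct0
    refine hasDeriv_param (f := fun t x => (tint v0 g1 t x - tint v0 g2 t x) ^ 2)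
      (f' := fun t x => 2 * ((tint v0 g1 t x - tint v0 g2 t x) * (g1 t x - g2 t x))) ?_ ?_ ?_ 0 p t
    · change Continuous fun q : ℝ × ℝ => (tint v0 g1 q.1 q.2 - tint v0 g2 q.1 q.2) ^ 2
      fun_prop
    · change Continuous fun q : ℝ × ℝ => 2 * ((tint v0 g1 q.1 q.2 - tint v0 g2 q.1 q.2) * (g1 q.1 q.2 - g2 q.1 q.2))
      fun_prop
    · intro t x
      exact (((tint_t0 hv0 h1 x t).fun_sub (tint_t0 hv0 h2 x t)).fun_pow 2).congr_deriv (by norm_num; ring)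
  have := gron (K := 2 * K) hder (fun t h0 hT => by
    rw [intervalIntegral.integral_const_mul, e1 t h0 hT, e2 t h0 hT]
    have := hK _ _ (x1.sp t) (x2.sp t) (fun j _ hj => (hB1 t h0 hT j hj).trans (le_max_left _ _))
      (fun j _ hj => (hB2 t h0 hT j hj).trans (le_max_right _ _))
    linarith) h0 hT
  simp only [tint_zero, sub_self] at this
  have e0 : ∫ x in (0:ℝ)..p, (0:ℝ) ^ 2 = 0 := by simp
  rw [e0, zero_mul] at this
  ext x
  have := sq_int_zero hp ((x1.sp t).sub (x2.sp t)) this x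
  linarith

lemma exists_global (hp : 0 < p) (ha : Coef a c C) (hv0 : SP p v0) :
    ∃ g, XS p g ∧ ∀ t, 0 ≤ t → g t = Fop p a (tint v0 g t) := by
  have hex : ∀ n : ℕ, ∃ g, XS p g ∧ ∀ t : ℝ, 0 ≤ t → t ≤ (n:ℝ) → g t = Fop p a (tint v0 g t) := fun n =>
    exists_T hp ha hv0 (Nat.cast_nonneg n)
  choose G hG1 hG2 using hex
  set V : ℝ → ℝ → ℝ := fun t => tint v0 (G ⌈t⌉₊) (max t 0) with hV
  have key : ∀ (n : ℕ) (t : ℝ), t ≤ (n:ℝ) → V t = tint v0 (G n) (max t 0) := by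
    intro n t ht
    have h1 : max t 0 ≤ (⌈t⌉₊ : ℝ) := max_le (Nat.le_ceil t) (Nat.cast_nonneg _)
    have h2 : max t 0 ≤ (n : ℝ) := max_le ht (Nat.cast_nonneg _)
    exact unique_T (T := max t 0) hp ha hv0 (hG1 _) (hG1 _) (fun s h3 h4 => hG2 _ s h3 (h4.trans h1))
      (fun s h3 h4 => hG2 _ s h3 (h4.trans h2)) (le_max_right _ _) le_rfl
  have hVx : XS p V := by
    refine ⟨fun t => (tint_xs hv0 (hG1 _)).sp _, fun k => ?_⟩
    rw [continuous_iff_continuousAt]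
    intro q
    obtain ⟨n, hn⟩ := exists_nat_gt q.1
    have hx := (tint_xs hv0 (hG1 n)).time (τ := fun t => max t 0) (by fun_prop)
    refine ((hx.ct k).continuousAt (x := q)).congr ?_
    have : ∀ᶠ q' : ℝ × ℝ in nhds q, q'.1 < n := continuous_fst.continuousAt.eventually_lt continuousAt_const hn
    filter_upwards [this] with q' hq'
    rw [key n q'.1 hq'.le]
  refine ⟨fun t => Fop p a (V t), Fop_xs ha.smooth hVx, fun t h0 => ?_⟩
  have : V t = tint v0 (fun t => Fop p a (V t)) t := by
    rw [key ⌈t⌉₊ t (Nat.le_ceil t), max_eq_left h0]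
    ext x
    unfold tint
    congr 1
    apply intervalIntegral.integral_congr
    intro s hs
    rw [Set.uIcc_of_le h0] at hs
    have h3 : s ≤ (⌈t⌉₊:ℝ) := hs.2.trans (Nat.le_ceil t)
    simp only
    rw [hG2 _ s hs.1 h3, key _ s h3, max_eq_left hs.1]
  rw [← this]
end

lemma memLp_cont {p : ℝ} {f : ℝ → ℝ} (hf : Continuous f) :
    MemLp (fun x => (f x : ℂ)) 2 (volume.restrict (Set.Ioc 0 p)) := by
  have hc : Continuous (fun x => (f x : ℂ)) := by fun_prop
  obtain ⟨C, hC⟩ := isCompact_Icc.exists_bound_of_continuousOn (s := Set.Icc 0 p) hc.continuousOn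
  refine MemLp.of_bound hc.aestronglyMeasurable C ?_
  refine (ae_restrict_iff' measurableSet_Ioc).2 (ae_of_all _ fun x hx => hC x ⟨hx.1.le, hx.2⟩)

lemma parseval {p : ℝ} (hp : 0 < p) {f : ℝ → ℝ} (hf : Continuous f) :
    HasSum (fun i : ℤ => ‖fourierCoeffOn hp (fun x => (f x : ℂ)) i‖ ^ 2)
      (p⁻¹ * ∫ x in (0:ℝ)..p, f x ^ 2) := by
  have := hasSum_sq_fourierCoeffOn hp (memLp_cont (p := p) hf)
  simpa using this

lemma coeff_deriv {p : ℝ} (hp : 0 < p) {f : ℝ → ℝ} (h : SP p f) (n : ℤ) :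
    ‖fourierCoeffOn hp (fun x => ((deriv f x : ℝ) : ℂ)) n‖ ^ 2
      = (2 * π / p * n) ^ 2 * ‖fourierCoeffOn hp (fun x => (f x : ℂ)) n‖ ^ 2 := by
  have hp0 : f p = f 0 := by simpa using h.per 0
  rcases eq_or_ne n 0 with rfl | hn
  · have : fourierCoeffOn hp (fun x => ((deriv f x : ℝ) : ℂ)) 0 = 0 := by
      rw [fourierCoeffOn_eq_integral]
      simp only [neg_zero, fourier_zero, one_smul]
      rw [intervalIntegral.integral_ofReal, int_deriv_zero h]; simp
    simp [this]
  · have hc := h.der.cont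
    have := fourierCoeffOn_of_hasDerivAt hp (f := fun x => (f x : ℂ)) (f' := fun x => ((deriv f x : ℝ) : ℂ)) hn
      (fun x _ => (h.hasDeriv x).ofReal_comp) (Continuous.intervalIntegrable (by fun_prop) _ _)
    rw [this, hp0]
    simp only [sub_self, mul_zero, zero_sub, Complex.ofReal_zero, sub_zero]
    rw [norm_mul, norm_neg, norm_mul]
    simp only [norm_div, norm_mul, norm_neg, norm_one, Complex.norm_I, Complex.norm_real, Complex.norm_intCast,
      Complex.norm_ofNat, Real.norm_eq_abs, abs_of_pos hp, abs_of_pos pi_pos, mul_one]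
    have hn' : (n:ℝ)^2 ≠ 0 := by positivity
    have := pi_pos.ne'
    simp only [mul_pow, div_pow, sq_abs]
    field_simp

lemma wirt {p : ℝ} (hp : 0 < p) {f : ℝ → ℝ} (h : SP p f) (N : ℕ)
    (hz : ∀ n : ℤ, |n| < N → fourierCoeffOn hp (fun x => (f x : ℂ)) n = 0) :
    (2 * π / p * N) ^ 2 * Y p 0 f ≤ Y p 1 f := by
  have s1 := (parseval hp h.cont).mul_left ((2 * π / p * N) ^ 2)
  have s2 := parseval hp h.der.cont
  have := hasSum_le (fun n => ?_) s1 s2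
  · have e : (2 * π / p * N) ^ 2 * Y p 0 f = p * ((2 * π / p * N) ^ 2 * (p⁻¹ * ∫ x in (0:ℝ)..p, f x ^ 2)) := by
      simp only [Y, iteratedDeriv_zero]; field_simp
    have e2 : Y p 1 f = p * (p⁻¹ * ∫ x in (0:ℝ)..p, deriv f x ^ 2) := by
      simp only [Y, iteratedDeriv_one]; field_simp
    rw [e, e2]; gcongr
  · show _ * _ ≤ _
    rw [coeff_deriv hp h]
    by_cases hn : |n| < N
    · simp [hz n hn]
    · push Not at hn
      have : (N:ℝ) ≤ |(n:ℝ)| := by exact_mod_cast hn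
      have : (N:ℝ)^2 ≤ (n:ℝ)^2 := by
        rw [← sq_abs (n:ℝ)]; gcongr
      rw [mul_pow, mul_pow]
      gcongr

lemma wirt1 {p : ℝ} (hp : 0 < p) {f : ℝ → ℝ} (h : SP p f) (h0 : ∫ x in (0:ℝ)..p, f x = 0) :
    (2 * π / p) ^ 2 * Y p 0 f ≤ Y p 1 f := by
  have := wirt hp h 1 (fun n hn => ?_)
  · simpa using this
  · have : n = 0 := by
      have := abs_lt.1 hn; norm_num at this; omega
    subst this
    rw [fourierCoeffOn_eq_integral]
    simp only [neg_zero, fourier_zero, one_smul]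
    rw [intervalIntegral.integral_ofReal, h0]; simp

lemma wirt2 {f : ℝ → ℝ} (h : SP (2 * π) f) (h0 : ∫ x in (0:ℝ)..(2*π), f x = 0)
    (hc : ∫ x in (0:ℝ)..(2*π), f x * cos x = 0) (hs : ∫ x in (0:ℝ)..(2*π), f x * sin x = 0) :
    4 * Y (2 * π) 0 f ≤ Y (2 * π) 1 f := by
  have hp : (0:ℝ) < 2 * π := by positivity
  have := wirt hp h 2 (fun n hn => ?_)
  · have e : (2 * π / (2 * π) * ((2:ℕ):ℝ)) ^ 2 = 4 := by
      rw [div_self hp.ne']; norm_num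
    rwa [e] at this
  · rw [fourierCoeffOn_eq_integral]
    have key : ∀ x : ℝ, (fourier (-n) (x : AddCircle (2 * π - 0)) • (f x : ℂ))
        = ((f x * cos (n * x) : ℝ) : ℂ) - Complex.I * ((f x * sin (n * x) : ℝ) : ℂ) := by
      intro x
      rw [fourier_coe_apply]
      have : 2 * (π:ℂ) * Complex.I * ((-n : ℤ) : ℂ) * x / ((2 * π - 0 : ℝ) : ℂ) = -((n * x : ℝ) : ℂ) * Complex.I := by
        have : (π : ℂ) ≠ 0 := by exact_mod_cast pi_pos.ne'
        push_cast; rw [sub_zero]; field_simp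
      rw [this, ← Complex.ofReal_neg, Complex.exp_mul_I, ← Complex.ofReal_cos, ← Complex.ofReal_sin, cos_neg, sin_neg]
      push_cast
      simp only [smul_eq_mul]; ring
    simp only [key]
    have c := h.cont
    rw [intervalIntegral.integral_sub, intervalIntegral.integral_const_mul, intervalIntegral.integral_ofReal,
      intervalIntegral.integral_ofReal]
    · have h3 : n = 0 ∨ n = 1 ∨ n = -1 := by
        have := abs_lt.1 hn; norm_num at this; omega
      rcases h3 with rfl | rfl | rfl
      · simp [h0]
      · simp [hc, hs]
      · simp [hc, hs]
    all_goals apply Continuous.intervalIntegrable; fun_prop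

noncomputable def Dd (p : ℝ) (v : ℝ → ℝ) : ℝ := Y p 1 v - ∫ x in (0:ℝ)..p, (v x - mean p v) ^ 2

lemma int_cos2 : ∫ x in (0:ℝ)..(2*π), cos x * cos x = π := by
  have : ∫ x in (0:ℝ)..(2*π), cos x * cos x = ∫ x in (0:ℝ)..(2*π), cos x ^ 2 := by
    congr 1; ext x; ring
  rw [this, integral_cos_sq]; simp
lemma int_sin2 : ∫ x in (0:ℝ)..(2*π), sin x * sin x = π := by
  have : ∫ x in (0:ℝ)..(2*π), sin x * sin x = ∫ x in (0:ℝ)..(2*π), sin x ^ 2 := by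
    congr 1; ext x; ring
  rw [this, integral_sin_sq]; simp
lemma int_sincos : ∫ x in (0:ℝ)..(2*π), sin x * cos x = 0 := by
  rw [integral_sin_mul_cos₁]; simp
lemma cos_sp : SP (2*π) cos := ⟨contDiff_cos, cos_periodic⟩
lemma sin_sp : SP (2*π) sin := ⟨contDiff_sin, sin_periodic⟩

lemma SP.cmul {p : ℝ} {u : ℝ → ℝ} (c : ℝ) (h : SP p u) : SP p (fun x => c * u x) := (SP.const c).mul h

lemma int_lin3 {f g k : ℝ → ℝ} (hf : Continuous f) (hg : Continuous g) (hk : Continuous k) (p a b c : ℝ) :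
    ∫ x in (0:ℝ)..p, (a * f x + b * g x + c * k x) =
      a * (∫ x in (0:ℝ)..p, f x) + b * (∫ x in (0:ℝ)..p, g x) + c * ∫ x in (0:ℝ)..p, k x := by
  rw [intervalIntegral.integral_add, intervalIntegral.integral_add, intervalIntegral.integral_const_mul,
    intervalIntegral.integral_const_mul, intervalIntegral.integral_const_mul]
  all_goals apply ii_cont; fun_prop

lemma int_lin2 {f g : ℝ → ℝ} (hf : Continuous f) (hg : Continuous g) (p a b : ℝ) :
    ∫ x in (0:ℝ)..p, (a * f x + b * g x) =
      a * (∫ x in (0:ℝ)..p, f x) + b * (∫ x in (0:ℝ)..p, g x) := by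
  rw [intervalIntegral.integral_add, intervalIntegral.integral_const_mul,
    intervalIntegral.integral_const_mul]
  all_goals apply ii_cont; fun_prop

lemma int_dev_zero {p : ℝ} (hp : 0 < p) {v : ℝ → ℝ} (hv : Continuous v) :
    ∫ x in (0:ℝ)..p, (v x - mean p v) = 0 := by
  rw [intervalIntegral.integral_sub (ii_cont hv _ _) (by simp), int_eq_mean hp v]; simp

lemma deriv_sub_const' {p : ℝ} {v : ℝ → ℝ} (hv : SP p v) (c : ℝ) (k : ℕ) :
    Y p (k+1) (fun x => v x - c) = Y p (k+1) v := by
  unfold Y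
  simp only [iteratedDeriv_succ']
  have : deriv (fun x => v x - c) = deriv v := by ext x; exact ((hv.hasDeriv x).sub_const c).deriv
  rw [this]

lemma dec_lt {p : ℝ} (hp : 0 < p) (hp2 : p < 2 * π) {v : ℝ → ℝ} (hv : SP p v) :
    (1 - (p/(2*π))^2) * Y p 1 v ≤ Dd p v := by
  have h1 := wirt1 hp (hv.sub (SP.const (mean p v))) (int_dev_zero hp hv.cont)
  rw [deriv_sub_const' hv _ 0] at h1
  unfold Dd
  have e : Y p 0 (fun x => v x - mean p v) = ∫ x in (0:ℝ)..p, (v x - mean p v) ^ 2 := by simp [Y]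
  rw [e] at h1
  have : (∫ x in (0:ℝ)..p, (v x - mean p v) ^ 2) ≤ (p/(2*π))^2 * Y p (0+1) v := by
    calc _ = (p/(2*π))^2 * ((2 * π / p) ^ 2 * ∫ x in (0:ℝ)..p, (v x - mean p v) ^ 2) := by
          have := pi_pos.ne'
          field_simp
      _ ≤ _ := by gcongr
  simp only [zero_add] at this
  linarith

lemma dec_eq {v : ℝ → ℝ} (hv : SP (2*π) v) {A B : ℝ} (hA : A * π = ∫ x in (0:ℝ)..(2*π), v x * cos x)
    (hB : B * π = ∫ x in (0:ℝ)..(2*π), v x * sin x) :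
    3/4 * Y (2*π) 1 (fun x => v x - mean (2*π) v - (A * cos x + B * sin x)) ≤ Dd (2*π) v ∧
    mean (2*π) (fun x => v x - mean (2*π) v - (A * cos x + B * sin x)) = 0 := by
  have hp : (0:ℝ) < 2 * π := by positivity
  have cv := hv.cont
  have cd := hv.der.cont
  set l := mean (2*π) v with hl
  set g := fun x => v x - l - (A * cos x + B * sin x) with hg
  have gsp : SP (2*π) g := (hv.sub (SP.const l)).sub ((cos_sp.cmul A).add (sin_sp.cmul B))
  have cg := gsp.cont
  have cgd := gsp.der.cont
  have i0 : ∫ x in (0:ℝ)..(2*π), cos x = 0 := by simp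
  have i1 : ∫ x in (0:ℝ)..(2*π), sin x = 0 := by simp
  have g0 : ∫ x in (0:ℝ)..(2*π), g x = 0 := by
    have : ∀ x, g x = 1 * (v x - l) + (-A) * cos x + (-B) * sin x := fun x => by simp only [hg]; ring
    simp only [this]
    rw [int_lin3 (by fun_prop) (by fun_prop) (by fun_prop), i0, i1, hl, int_dev_zero hp cv]; ring
  have gc : ∫ x in (0:ℝ)..(2*π), g x * cos x = 0 := by
    have : ∀ x, g x * cos x = 1 * (v x * cos x + (-l) * cos x) + (-A) * (cos x * cos x) + (-B) * (sin x * cos x) :=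
      fun x => by simp only [hg]; ring
    simp only [this]
    rw [int_lin3 (by fun_prop) (by fun_prop) (by fun_prop), int_cos2, int_sincos,
      intervalIntegral.integral_add (ii_cont (by fun_prop) _ _) (ii_cont (by fun_prop) _ _), 
      intervalIntegral.integral_const_mul, i0, ← hA]; ring
  have gs : ∫ x in (0:ℝ)..(2*π), g x * sin x = 0 := by
    have : ∀ x, g x * sin x = 1 * (v x * sin x + (-l) * sin x) + (-A) * (sin x * cos x) + (-B) * (sin x * sin x) :=
      fun x => by simp only [hg]; ring
    simp only [this]
    rw [int_lin3 (by fun_prop) (by fun_prop) (by fun_prop), int_sin2, int_sincos,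
      intervalIntegral.integral_add (ii_cont (by fun_prop) _ _) (ii_cont (by fun_prop) _ _), 
      intervalIntegral.integral_const_mul, i1, ← hB]; ring
  have w := wirt2 gsp g0 gc gs
  have dg : ∀ x, deriv v x = deriv g x + (-A * sin x + B * cos x) := by
    intro x
    have h1 := ((hv.hasDeriv x).sub_const l).fun_sub (((hasDerivAt_cos x).const_mul A).fun_add ((hasDerivAt_sin x).const_mul B))
    rw [show deriv g x = _ from h1.deriv]; ring
  have dgc : ∫ x in (0:ℝ)..(2*π), deriv g x * cos x = 0 := by
    rw [ibp gsp cos_sp]; simp only [deriv_cos', mul_neg, intervalIntegral.integral_neg, gs]; simp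
  have dgs : ∫ x in (0:ℝ)..(2*π), deriv g x * sin x = 0 := by
    rw [ibp gsp sin_sp]; simp only [Real.deriv_sin, gc]; simp
  have e1 : Y (2*π) 1 v = Y (2*π) 1 g + (A^2 + B^2) * π := by
    simp only [Y, iteratedDeriv_one]
    have : ∀ x, deriv v x ^ 2 = 1 * (deriv g x ^ 2 + A^2 * (sin x * sin x) + B^2 * (cos x * cos x)) 
       + 2 * ((-A) * (deriv g x * sin x) + B * (deriv g x * cos x)) + (-2 * A * B) * (sin x * cos x) := fun x => by rw [dg]; ring
    simp only [this]
    rw [int_lin3 (by fun_prop) (by fun_prop) (by fun_prop), int_lin2 (by fun_prop) (by fun_prop), dgc, dgs, int_sincos]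
    rw [intervalIntegral.integral_add (ii_cont (by fun_prop) _ _) (ii_cont (by fun_prop) _ _),
      intervalIntegral.integral_add (ii_cont (by fun_prop) _ _) (ii_cont (by fun_prop) _ _)]
    rw [intervalIntegral.integral_const_mul, intervalIntegral.integral_const_mul, int_sin2, int_cos2]; ring
  have e2 : (∫ x in (0:ℝ)..(2*π), (v x - l)^2) = Y (2*π) 0 g + (A^2 + B^2) * π := by
    simp only [Y, iteratedDeriv_zero]
    have : ∀ x, (v x - l) ^ 2 = 1 * (g x ^ 2 + B^2 * (sin x * sin x) + A^2 * (cos x * cos x)) 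
       + 2 * (B * (g x * sin x) + A * (g x * cos x)) + (2 * A * B) * (sin x * cos x) := fun x => by
        have : v x - l = g x + (A * cos x + B * sin x) := by simp only [hg]; ring
        rw [this]; ring
    simp only [this]
    rw [int_lin3 (by fun_prop) (by fun_prop) (by fun_prop), int_lin2 (by fun_prop) (by fun_prop), gc, gs, int_sincos]
    rw [intervalIntegral.integral_add (ii_cont (by fun_prop) _ _) (ii_cont (by fun_prop) _ _),
      intervalIntegral.integral_add (ii_cont (by fun_prop) _ _) (ii_cont (by fun_prop) _ _)]
    rw [intervalIntegral.integral_const_mul, intervalIntegral.integral_const_mul, int_sin2, int_cos2]; ring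
  refine ⟨?_, by simp [mean, g0]⟩
  unfold Dd
  rw [e1, ← hl, e2]
  linarith

lemma AB_bound {v w : ℝ → ℝ} (hv : Continuous v) (hw : Continuous w) {A : ℝ}
    (hw0 : ∫ x in (0:ℝ)..(2*π), w x = 0) (hw2 : ∫ x in (0:ℝ)..(2*π), w x * w x = π)
    (hA : A * π = ∫ x in (0:ℝ)..(2*π), v x * w x) (c : ℝ) :
    A ^ 2 ≤ 4 / (2*π) * ∫ x in (0:ℝ)..(2*π), (v x - c)^2 := by
  have hp : (0:ℝ) < 2 * π := by positivity
  have h1 : A * π = ∫ x in (0:ℝ)..(2*π), (v x - c) * w x := by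
    have : ∀ x, (v x - c) * w x = 1 * (v x * w x) + (-c) * w x := fun x => by ring
    simp only [this]
    rw [int_lin2 (by fun_prop) (by fun_prop), hw0, ← hA]; ring
  have h2 := cs (f := fun x => v x - c) (g := w) (by fun_prop) (by fun_prop) hp.le
  rw [← h1] at h2
  have h3 : ∫ x in (0:ℝ)..(2*π), w x ^ 2 = π := by simp only [pow_two]; exact hw2
  rw [h3] at h2
  have hnn : 0 ≤ ∫ x in (0:ℝ)..(2*π), (v x - c)^2 :=
    intervalIntegral.integral_nonneg hp.le (fun _ _ => sq_nonneg _)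
  have hpi := pi_pos
  have h4 : A^2 * π ≤ ∫ x in (0:ℝ)..(2*π), (v x - c)^2 := by
    have : (A^2 * π) * π ≤ (∫ x in (0:ℝ)..(2*π), (v x - c)^2) * π := by linarith
    exact le_of_mul_le_mul_right this hpi
  rw [div_mul_eq_mul_div, le_div_iff₀ hp]
  nlinarith

lemma static_dec {p : ℝ} (hp : 0 < p) (hp2 : p ≤ 2 * π) : ∃ Cp, 0 ≤ Cp ∧ ∀ v, SP p v → 0 ≤ Dd p v ∧ ∃ A B : ℝ,
    (∀ x, |v x - mean p v - (A * cos x + B * sin x)| ≤ Cp * √(Dd p v)) ∧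
    (∀ c, A^2 ≤ 4 / p * ∫ x in (0:ℝ)..p, (v x - c)^2) ∧ (∀ c, B^2 ≤ 4 / p * ∫ x in (0:ℝ)..p, (v x - c)^2) ∧
    ((A = 0 ∧ B = 0) ∨ p = 2 * π) := by
  have hpi := pi_pos
  rcases hp2.lt_or_eq with hlt | rfl
  · set q := 1 - (p/(2*π))^2 with hq
    have hq0 : 0 < q := by
      have h1 : p/(2*π) < 1 := by rw [div_lt_one (by positivity)]; exact hlt
      have h2 : 0 < p/(2*π) := by positivity
      rw [hq]; nlinarith
    refine ⟨√(p / q), by positivity, fun v hv => ?_⟩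
    have h1 := dec_lt hp hlt hv
    rw [← hq] at h1
    have h2 := Y_nonneg hp 1 v
    have nn : ∀ c, 0 ≤ 4 / p * ∫ x in (0:ℝ)..p, (v x - c)^2 := fun c =>
      mul_nonneg (by positivity) (intervalIntegral.integral_nonneg hp.le (fun _ _ => sq_nonneg _))
    refine ⟨le_trans (by positivity) h1, 0, 0, fun x => ?_, fun c => by simpa using nn c, fun c => by simpa using nn c, Or.inl ⟨rfl, rfl⟩⟩
    rw [← Real.sqrt_mul (by positivity)]
    apply Real.abs_le_sqrt
    have h3 := sup_dev hp hv x
    simp only [zero_mul, add_zero, sub_zero]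
    refine h3.trans ?_
    rw [div_mul_eq_mul_div, le_div_iff₀ hq0]
    nlinarith
  · refine ⟨√(2*π*(4/3)), by positivity, fun v hv => ?_⟩
    set A := (∫ x in (0:ℝ)..(2*π), v x * cos x) / π with hA
    set B := (∫ x in (0:ℝ)..(2*π), v x * sin x) / π with hB
    have hA' : A * π = ∫ x in (0:ℝ)..(2*π), v x * cos x := by rw [hA]; field_simp
    have hB' : B * π = ∫ x in (0:ℝ)..(2*π), v x * sin x := by rw [hB]; field_simp
    obtain ⟨h1, h2⟩ := dec_eq hv hA' hB'
    have h0 := Y_nonneg hp 1 (fun x => v x - mean (2*π) v - (A * cos x + B * sin x))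
    have gsp : SP (2*π) (fun x => v x - mean (2*π) v - (A * cos x + B * sin x)) := (hv.sub (SP.const _)).sub ((cos_sp.cmul A).add (sin_sp.cmul B))
    refine ⟨le_trans (by positivity) h1, A, B, fun x => ?_, AB_bound hv.cont continuous_cos (by simp) int_cos2 hA',
      AB_bound hv.cont continuous_sin (by simp) int_sin2 hB', Or.inr rfl⟩
    rw [← Real.sqrt_mul (by positivity)]
    apply Real.abs_le_sqrt
    have h3 := sup_dev hp gsp x
    rw [h2, sub_zero] at h3
    refine h3.trans ?_
    nlinarith

lemma rho_cont {v : ℝ → ℝ} (hv : Continuous v) (h0 : ∀ x, 0 < v x) (b : ℝ) : Continuous (fun x => (v x) ^ b) :=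
  hv.rpow_const (fun x => Or.inl (h0 x).ne')

lemma rho_phi_zero {p α : ℝ} {v : ℝ → ℝ} (hv : Continuous v) (h0 : ∀ x, 0 < v x) {A B : ℝ}
    (horth : p = 2 * π → (∫ x in (0:ℝ)..p, (v x) ^ (-(1/α)) * cos x = 0) ∧ ∫ x in (0:ℝ)..p, (v x) ^ (-(1/α)) * sin x = 0)
    (hAB : (A = 0 ∧ B = 0) ∨ p = 2 * π) :
    ∫ x in (0:ℝ)..p, (v x) ^ (-(1/α)) * (A * cos x + B * sin x) = 0 := by
  rcases hAB with ⟨rfl, rfl⟩ | h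
  · simp
  · obtain ⟨h1, h2⟩ := horth h
    have hc := rho_cont hv h0 (-(1/α))
    have : ∀ x, (v x) ^ (-(1/α)) * (A * cos x + B * sin x) = A * ((v x) ^ (-(1/α)) * cos x) + B * ((v x) ^ (-(1/α)) * sin x) := fun x => by ring
    simp only [this]
    rw [int_lin2 (by fun_prop) (by fun_prop), h1, h2]; ring

lemma stat_upper {p α : ℝ} (hp : 0 < p) (hα : 0 < α) {v : ℝ → ℝ} (hv : Continuous v) (h0 : ∀ x, 0 < v x)
    {l A B G vs : ℝ} (hvs : 0 < vs) (hG : 0 ≤ G)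
    (hd : ∀ x, |v x - l - (A * cos x + B * sin x)| ≤ G)
    (hyInt : ∫ x in (0:ℝ)..p, (v x) ^ (-(1/α)) = p * vs ^ (-(1/α)))
    (hz : ∫ x in (0:ℝ)..p, (v x) ^ (-(1/α)) * (A * cos x + B * sin x) = 0) :
    ∀ x, v x ≤ 2 * max (4 * G) (2 * (6 ^ α * vs)) + 2 * G := by
  have hphi : ∀ x, A * cos x + B * sin x ≤ l + G := by
    intro x
    have h1 := (abs_le.1 (hd (x + π))).2
    have h2 := h0 (x + π)
    rw [cos_add_pi, sin_add_pi] at h1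
    linarith
  have hl : l ≤ max (4 * G) (2 * (6 ^ α * vs)) := by
    by_contra hcon
    push Not at hcon
    rw [max_lt_iff] at hcon
    obtain ⟨hl1, hl2⟩ := hcon
    have hl0 : 0 < l := by linarith
    set R := (l / 2) ^ (-(1/α)) with hR
    have hR0 : 0 < R := by positivity
    have hb : 0 < 1 / α := by positivity
    have hpt : ∀ x, (v x) ^ (-(1/α)) * (A * cos x + B * sin x) ≤ (-(l/2 - G)) * (v x) ^ (-(1/α)) + R * (3 * l / 2) * 1 := by
      intro x
      have hr0 : 0 < (v x) ^ (-(1/α)) := rpow_pos_of_pos (h0 x) _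
      rcases le_or_gt (l/2) (v x) with hc | hc
      · have hr : (v x) ^ (-(1/α)) ≤ R := rpow_le_rpow_of_nonpos (by positivity) hc (by linarith)
        have h1 := hphi x
        rcases le_or_gt 0 (A * cos x + B * sin x + (l/2 - G)) with h2 | h2
        · nlinarith [mul_le_mul hr (show A * cos x + B * sin x + (l/2 - G) ≤ 3 * l / 2 by linarith) h2 hR0.le]
        · nlinarith
      · have h1 := (abs_le.1 (hd x)).1
        have h2 : A * cos x + B * sin x + (l/2 - G) ≤ 0 := by linarith
        nlinarith
    have hc := rho_cont hv h0 (-(1/α))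
    have := int_le_of_le hp (by fun_prop) (by fun_prop) hpt
    rw [hz, int_lin2 (by fun_prop) (by fun_prop), hyInt] at this
    simp at this
    have h3 : (6 ^ α * vs) ^ (-(1/α)) = vs ^ (-(1/α)) / 6 := by
      rw [mul_rpow (by positivity) hvs.le, ← rpow_mul (by norm_num)]
      have : α * -(1/α) = -1 := by field_simp
      rw [this, rpow_neg_one]; ring
    have h4 : R < vs ^ (-(1/α)) / 6 := by
      rw [← h3, hR]
      exact rpow_lt_rpow_of_neg (by positivity) (by linarith) (by linarith)
    have hrs : 0 < vs ^ (-(1/α)) := by positivity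
    have e : vs ^ (-α⁻¹) = vs ^ (-(1/α)) := by simp
    rw [e] at this
    have h5 : p * ((l/2 - G) * vs ^ (-(1/α))) ≤ p * (R * (3 * l / 2)) := by linarith
    have h6 := le_of_mul_le_mul_left h5 hp
    nlinarith [mul_lt_mul_of_pos_right h4 hl0]
  intro x
  have h1 := (abs_le.1 (hd x)).2
  have h2 := hphi x
  linarith

lemma rho_mono {b M : ℝ} (hb : 0 < b) {s r : ℝ} (hs : 0 < s) (hsr : s ≤ r) (hr : r ≤ M) :
    b * M ^ (-b - 1) * (r - s) ≤ s ^ (-b) - r ^ (-b) := by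
  have hM : 0 < M := by linarith
  have hd : ∀ x ∈ Set.Ioc 0 M, HasDerivAt (fun x => x ^ (-b) + b * M ^ (-b-1) * x) ((-b) * x ^ (-b-1) + b * M ^ (-b-1) * 1) x :=
    fun x hx => (hasDerivAt_rpow_const (Or.inl hx.1.ne')).fun_add ((hasDerivAt_id x).const_mul _)
  have : AntitoneOn (fun x => x ^ (-b) + b * M ^ (-b-1) * x) (Set.Ioc 0 M) := by
    apply antitoneOn_of_deriv_nonpos (convex_Ioc 0 M)
    · exact fun x hx => (hd x hx).continuousAt.continuousWithinAt
    · intro x hx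
      rw [interior_Ioc] at hx
      exact (hd x ⟨hx.1, hx.2.le⟩).differentiableAt.differentiableWithinAt
    · intro x hx
      rw [interior_Ioc] at hx
      rw [(hd x ⟨hx.1, hx.2.le⟩).deriv]
      have : M ^ (-b-1) ≤ x ^ (-b-1) := rpow_le_rpow_of_nonpos hx.1 hx.2.le (by linarith)
      nlinarith
  have := this ⟨hs, by linarith⟩ ⟨by linarith, hr⟩ hsr
  simp only at this
  linarith

lemma rho_mono2 {b M : ℝ} (hb : 0 < b) {s r : ℝ} (hs : 0 < s) (hs' : s ≤ M) (hr : 0 < r) (hr' : r ≤ M) :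
    b * M ^ (-b - 1) * (r - s)^2 ≤ (s ^ (-b) - r ^ (-b)) * (r - s) := by
  rcases le_total s r with h | h
  · have := rho_mono hb hs h hr'
    nlinarith [mul_le_mul_of_nonneg_right this (sub_nonneg.2 h)]
  · have := rho_mono hb hr h hs'
    nlinarith [mul_le_mul_of_nonneg_right this (sub_nonneg.2 h)]

lemma stat_conv {p α : ℝ} (hp : 0 < p) (hα : 0 < α) {v : ℝ → ℝ} (hv : Continuous v) (h0 : ∀ x, 0 < v x)
    {l A B G vs M : ℝ} (hvs : 0 < vs) (hG : 0 ≤ G)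
    (hd : ∀ x, |v x - l - (A * cos x + B * sin x)| ≤ G)
    (hyInt : ∫ x in (0:ℝ)..p, (v x) ^ (-(1/α)) = p * vs ^ (-(1/α)))
    (hz : ∫ x in (0:ℝ)..p, (v x) ^ (-(1/α)) * (A * cos x + B * sin x) = 0)
    (hz0 : ∫ x in (0:ℝ)..p, (A * cos x + B * sin x) = 0) (hM : vs ≤ M) (hvM : ∀ x, v x ≤ M) :
    ∫ x in (0:ℝ)..p, (v x - vs)^2 ≤ p * (2 * vs ^ (-(1/α)) * G / (1/α * M ^ (-(1/α)-1))) := by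
  have hM0 : 0 < M := by linarith
  have hb : 0 < 1 / α := by positivity
  have hc := rho_cont hv h0 (-(1/α))
  set c := 1/α * M ^ (-(1/α)-1) with hcdef
  have hc0 : 0 < c := by positivity
  set rs := vs ^ (-(1/α)) with hrs
  have hrs0 : 0 < rs := by positivity
  have h1 : c * (∫ x in (0:ℝ)..p, (v x - vs)^2) ≤ ∫ x in (0:ℝ)..p, (rs - v x ^ (-(1/α))) * (v x - vs) := by
    rw [← intervalIntegral.integral_const_mul]
    exact int_le_of_le hp (by fun_prop) (by fun_prop) (fun x => rho_mono2 hb hvs hM (h0 x) (hvM x))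
  have h2 : ∫ x in (0:ℝ)..p, (rs - v x ^ (-(1/α))) * (v x - vs)
      = ∫ x in (0:ℝ)..p, (rs - v x ^ (-(1/α))) * (v x - l - (A * cos x + B * sin x)) := by
    have e : ∀ x, (rs - v x ^ (-(1/α))) * (v x - vs) = 1 * ((rs - v x ^ (-(1/α))) * (v x - l - (A * cos x + B * sin x)))
        + (l - vs) * (rs + (-1) * v x ^ (-(1/α))) + 1 * (rs * (A * cos x + B * sin x) + (-1) * ( v x ^ (-(1/α)) * (A * cos x + B * sin x))) :=
      fun x => by ring
    simp only [e]
    rw [int_lin3 (by fun_prop) (by fun_prop) (by fun_prop), int_lin2 (by fun_prop) (by fun_prop), hz, hz0,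
      intervalIntegral.integral_add (ii_cont (by fun_prop) _ _) (ii_cont (by fun_prop) _ _),
      intervalIntegral.integral_const_mul, hyInt]
    simp
  have h3 : ∫ x in (0:ℝ)..p, (rs - v x ^ (-(1/α))) * (v x - l - (A * cos x + B * sin x))
      ≤ ∫ x in (0:ℝ)..p, (G * rs + G * v x ^ (-(1/α))) := by
    refine int_le_of_le hp (by fun_prop) (by fun_prop) (fun x => ?_)
    have a1 := abs_le.1 (hd x)
    have a2 : 0 < v x ^ (-(1/α)) := rpow_pos_of_pos (h0 x) _
    nlinarith
  have h4 : ∫ x in (0:ℝ)..p, (G * rs + G * v x ^ (-(1/α))) = p * (2 * rs * G) := by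
    rw [int_lin2 (by fun_prop) (by fun_prop), hyInt]
    simp; ring
  rw [← mul_div_assoc, le_div_iff₀ hc0]
  linarith

lemma static_main {p α vs : ℝ} (hp : 0 < p) (hp2 : p ≤ 2 * π) (hα : 0 < α) (hvs : 0 < vs) :
    ∃ Cp, 0 ≤ Cp ∧ ∀ v, SP p v → 0 ≤ Dd p v ∧ ((∀ x, 0 < v x) → 
      (∫ x in (0:ℝ)..p, (v x) ^ (-(1/α)) = p * vs ^ (-(1/α))) →
      (p = 2 * π → (∫ x in (0:ℝ)..p, (v x) ^ (-(1/α)) * cos x = 0) ∧ ∫ x in (0:ℝ)..p, (v x) ^ (-(1/α)) * sin x = 0) →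
      (∀ x, v x ≤ 2 * max (4 * (Cp * √(Dd p v))) (2 * (6 ^ α * vs)) + 2 * (Cp * √(Dd p v))) ∧
      ∀ M, vs ≤ M → (∀ x, v x ≤ M) →
        ∫ x in (0:ℝ)..p, (v x - vs)^2 ≤ p * (2 * vs ^ (-(1/α)) * (Cp * √(Dd p v)) / (1/α * M ^ (-(1/α)-1))) ∧
        ∀ x, |v x - vs| ≤ 5 * √(2 * vs ^ (-(1/α)) * (Cp * √(Dd p v)) / (1/α * M ^ (-(1/α)-1))) + Cp * √(Dd p v)) := by
  obtain ⟨Cp, hCp, H⟩ := static_dec hp hp2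
  refine ⟨Cp, hCp, fun v hv => ?_⟩
  obtain ⟨hD, A, B, hd, hA, hB, hAB⟩ := H v hv
  refine ⟨hD, fun h0 hyInt horth => ?_⟩
  have hz := rho_phi_zero hv.cont h0 horth hAB
  have hz0 : ∫ x in (0:ℝ)..p, (A * cos x + B * sin x) = 0 := by
    rcases hAB with ⟨rfl, rfl⟩ | rfl
    · simp
    · rw [int_lin2 (by fun_prop) (by fun_prop)]; simp
  set G := Cp * √(Dd p v) with hG
  have hG0 : 0 ≤ G := by positivity
  refine ⟨stat_upper hp hα hv.cont h0 hvs hG0 hd hyInt hz, fun M hM hvM => ?_⟩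
  have h1 := stat_conv hp hα hv.cont h0 hvs hG0 hd hyInt hz hz0 hM hvM
  refine ⟨h1, fun x => ?_⟩
  set Q := 2 * vs ^ (-(1/α)) * G / (1/α * M ^ (-(1/α)-1)) with hQ
  have hM0 : 0 < M := by linarith
  have hQ0 : 0 ≤ Q := by positivity
  have h4 : ∀ {A : ℝ}, (∀ c, A^2 ≤ 4 / p * ∫ x in (0:ℝ)..p, (v x - c)^2) → |A| ≤ 2 * √Q := by
    intro A hA
    have : A ^ 2 ≤ 2^2 * Q := by
      refine (hA vs).trans ?_
      calc _ ≤ 4 / p * (p * Q) := by gcongr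
        _ = _ := by field_simp; ring
    have := Real.abs_le_sqrt this
    rwa [Real.sqrt_mul (by norm_num), Real.sqrt_sq (by norm_num)] at this
  have h5 := h4 hA
  have h6 := h4 hB
  have h7 : |mean p v - vs| ≤ √Q := by
    apply Real.abs_le_sqrt
    have := mean_sq_le hp (hv.sub (SP.const vs))
    rw [mean_sub hv.cont continuous_const, mean_const hp] at this
    refine this.trans ?_
    simp only [Y, iteratedDeriv_zero]
    calc _ ≤ 1 / p * (p * Q) := by gcongr
      _ = Q := by field_simp
  have h8 : |A * cos x| ≤ 2 * √Q := by
    rw [abs_mul]; nlinarith [abs_cos_le_one x, abs_nonneg A, abs_nonneg (cos x)]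
  have h9 : |B * sin x| ≤ 2 * √Q := by
    rw [abs_mul]; nlinarith [abs_sin_le_one x, abs_nonneg B, abs_nonneg (sin x)]
  have h10 := hd x
  rw [abs_le] at *
  constructor <;> linarith [h7.1, h7.2, h8.1, h8.2, h9.1, h9.2, h10.1, h10.2]

lemma dec_of_deriv {f f' : ℝ → ℝ} (hf : ∀ t, 0 ≤ t → HasDerivAt f (f' t) t) (h : ∀ t, 0 ≤ t → f' t ≤ 0) {t : ℝ} (ht : 0 ≤ t) :
    f t ≤ f 0 := by
  have := gron (K := 0) (T := t) (fun s h1 _ => hf s h1) (fun s h1 _ => by simpa using h s h1) ht le_rfl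
  simpa using this

lemma const_of_deriv {f : ℝ → ℝ} (hf : ∀ t, 0 ≤ t → HasDerivAt f 0 t) {t : ℝ} (ht : 0 ≤ t) : f t = f 0 := by
  apply le_antisymm
  · exact dec_of_deriv hf (fun _ _ => le_rfl) ht
  · have := dec_of_deriv (f := fun t => - f t) (f' := fun _ => -0) (fun t ht => (hf t ht).neg) (fun _ _ => by simp) ht
    simpa using this

lemma Dd_eq {p : ℝ} (hp : 0 < p) {v : ℝ → ℝ} (hv : SP p v) : Dd p v = Y p 1 v - (Y p 0 v - p * (mean p v)^2) := by
  unfold Dd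
  congr 1
  have c := hv.cont
  have e : ∀ x, (v x - mean p v)^2 = 1 * v x ^ 2 + (-2 * mean p v) * v x + (mean p v)^2 * 1 := fun x => by ring
  simp only [e]
  rw [int_lin3 (by fun_prop) (by fun_prop) (by fun_prop), int_eq_mean hp v]
  simp [Y]; ring

/-- second derivative plus deviation from the mean -/
noncomputable def zop (p : ℝ) (v : ℝ → ℝ) (x : ℝ) : ℝ := iteratedDeriv 2 v x + (v x - mean p v)

lemma zop_cont {p : ℝ} {v : ℝ → ℝ} (hv : SP p v) : Continuous (zop p v) := by
  have := hv.cont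
  have := (hv.iter 2).cont
  unfold zop; fun_prop

lemma int_zop {p : ℝ} (hp : 0 < p) {v : ℝ → ℝ} (hv : SP p v) : ∫ x in (0:ℝ)..p, zop p v x = 0 := by
  have c1 := hv.cont
  have c2 := (hv.iter 2).cont
  unfold zop
  rw [intervalIntegral.integral_add (ii_cont (by fun_prop) _ _) (ii_cont (by fun_prop) _ _), int_dev_zero hp c1,
    iteratedDeriv_succ, int_deriv_zero (hv.iter 1)]; simp

lemma int_zop_w {v w : ℝ → ℝ} (hv : SP (2*π) v) (hw : SP (2*π) w) (h2 : ∀ x, iteratedDeriv 2 w x = - w x)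
    (h0 : ∫ x in (0:ℝ)..(2*π), w x = 0) : ∫ x in (0:ℝ)..(2*π), zop (2*π) v x * w x = 0 := by
  have c1 := hv.cont
  have c2 := (hv.iter 2).cont
  have c3 := hw.cont
  have e1 : ∫ x in (0:ℝ)..(2*π), iteratedDeriv 2 v x * w x = ∫ x in (0:ℝ)..(2*π), v x * iteratedDeriv 2 w x := by
    have a1 := ibp_iter hv hw 0
    have a2 := ibp_iter hw hv 0
    simp only [zero_add, iteratedDeriv_zero] at a1 a2
    have : ∫ x in (0:ℝ)..(2*π), iteratedDeriv 1 v x * iteratedDeriv 1 w x = ∫ x in (0:ℝ)..(2*π), iteratedDeriv 1 w x * iteratedDeriv 1 v x := by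
      simp only [mul_comm]
    have h3 : ∫ x in (0:ℝ)..(2*π), v x * iteratedDeriv 2 w x = ∫ x in (0:ℝ)..(2*π), iteratedDeriv 2 w x * v x := by
      simp only [mul_comm]
    rw [h3]; linarith
  have e : ∀ x, zop (2*π) v x * w x = 1 * (iteratedDeriv 2 v x * w x) + 1 * (v x * w x) + (- mean (2*π) v) * w x := fun x => by
    unfold zop; ring
  simp only [e]
  rw [int_lin3 (by fun_prop) (by fun_prop) (by fun_prop), e1, h0]
  simp [h2]

lemma iter2_cos (x : ℝ) : iteratedDeriv 2 cos x = - cos x := by simp [iteratedDeriv_succ]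
lemma iter2_sin (x : ℝ) : iteratedDeriv 2 sin x = - sin x := by simp [iteratedDeriv_succ]

section dyn
variable {p c C : ℝ} {a v0 : ℝ → ℝ} {g : ℝ → ℝ → ℝ}

lemma int_G_t (hv0 : SP p v0) (hg : XS p g) {G G' w : ℝ → ℝ} (hG : ∀ s, HasDerivAt G (G' s) s) (hG' : Continuous G')
    (hw : Continuous w) (t : ℝ) :
    HasDerivAt (fun t => ∫ x in (0:ℝ)..p, G (tint v0 g t x) * w x)
      (∫ x in (0:ℝ)..p, G' (tint v0 g t x) * g t x * w x) t := by
  have hv := tint_xs hv0 hg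
  have c1 := hv.ct0
  have c2 := hg.ct0
  have c3 : Continuous G := continuous_iff_continuousAt.2 fun s => (hG s).continuousAt
  refine hasDeriv_param (f := fun t x => G (tint v0 g t x) * w x) (f' := fun t x => G' (tint v0 g t x) * g t x * w x) ?_ ?_ ?_ 0 p t
  · change Continuous fun q : ℝ × ℝ => G (tint v0 g q.1 q.2) * w q.2
    fun_prop
  · change Continuous fun q : ℝ × ℝ => G' (tint v0 g q.1 q.2) * g q.1 q.2 * w q.2
    fun_prop
  · intro s y
    exact (((hG _).comp s (tint_t0 hv0 hg y s)).mul_const (w y))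

lemma mean_t (hv0 : SP p v0) (hg : XS p g) (t : ℝ) :
    HasDerivAt (fun t => mean p (tint v0 g t)) (mean p (g t)) t := by
  have := int_G_t (p := p) hv0 hg (G := fun s => s) (G' := fun _ => 1) (w := fun _ => 1) (fun s => hasDerivAt_id s) continuous_const continuous_const t
  unfold mean
  simpa using this.const_mul (1/p)

lemma Dd_t (hp : 0 < p) (hv0 : SP p v0) (hg : XS p g) (t : ℝ) :
    HasDerivAt (fun t => Dd p (tint v0 g t)) (-(2 * ∫ x in (0:ℝ)..p, zop p (tint v0 g t) x * g t x)) t := by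
  have hv := tint_xs hv0 hg
  have e : (fun t => Dd p (tint v0 g t)) = fun t => Y p 1 (tint v0 g t) - (Y p 0 (tint v0 g t) - p * (mean p (tint v0 g t))^2) := by
    ext t; exact Dd_eq hp (hv.sp t)
  rw [e]
  have c1 := (hv.sp t).cont
  have c2 := ((hv.sp t).iter 2).cont
  have c3 := (hg.sp t).cont
  refine ((Y_t hv0 hg 1 t).fun_sub ((Y_t hv0 hg 0 t).fun_sub (((mean_t hv0 hg t).fun_pow 2).const_mul p))).congr_deriv ?_
  have h1 := ibp_iter (hv.sp t) (hg.sp t) 0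
  simp only [zero_add, iteratedDeriv_zero] at h1 ⊢
  rw [h1]
  have e : ∀ x, zop p (tint v0 g t) x * g t x = 1 * (iteratedDeriv 2 (tint v0 g t) x * g t x) + 1 * (tint v0 g t x * g t x)
    + (- mean p (tint v0 g t)) * g t x := fun x => by unfold zop; ring
  simp only [e]
  rw [int_lin3 (by fun_prop) (by fun_prop) (by fun_prop), int_eq_mean hp (g t)]
  push_cast; ring

lemma Dd_dec (hp : 0 < p) (ha : Coef a c C) (hv0 : SP p v0) (hg : XS p g) (hsol : ∀ t, 0 ≤ t → g t = Fop p a (tint v0 g t))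
    {t : ℝ} (ht : 0 ≤ t) : -(2 * ∫ x in (0:ℝ)..p, zop p (tint v0 g t) x * g t x) ≤ 0 := by
  have : 0 ≤ ∫ x in (0:ℝ)..p, zop p (tint v0 g t) x * g t x := by
    apply intervalIntegral.integral_nonneg hp.le
    intro x _
    rw [hsol t ht]
    unfold Fop
    have : zop p (tint v0 g t) x * (a (tint v0 g t x) * (iteratedDeriv 2 (tint v0 g t) x + (tint v0 g t x - mean p (tint v0 g t))))
      = a (tint v0 g t x) * (zop p (tint v0 g t) x)^2 := by unfold zop; ring
    rw [this]
    have := ha.lo (tint v0 g t x)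
    have := ha.pos
    exact mul_nonneg (by linarith) (sq_nonneg _)
  linarith

lemma prim_hd {f : ℝ → ℝ} (hf : Continuous f) (s0 s : ℝ) : HasDerivAt (fun s => ∫ r in s0..s, f r) (f s) s :=
  intervalIntegral.integral_hasDerivAt_right (ii_cont hf _ _) hf.aestronglyMeasurable.stronglyMeasurableAtFilter hf.continuousAt

lemma Coef.inv_cont (ha : Coef a c C) : Continuous fun r => 1 / a r := by
  have h1 := ha.smooth.continuous
  have h2 : ∀ r, a r ≠ 0 := fun r => (lt_of_lt_of_le ha.pos (ha.lo r)).ne'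
  exact continuous_const.div h1 h2

/-- entropy density -/
noncomputable def Gd (a : ℝ → ℝ) (vs s : ℝ) : ℝ := ∫ r in vs..s, (r - vs) * (1 / a r)

/-- radius function -/
noncomputable def Pd (a : ℝ → ℝ) (rs vs s : ℝ) : ℝ := rs - ∫ r in vs..s, 1 / a r

lemma Gd_nonneg (ha : Coef a c C) (vs s : ℝ) : 0 ≤ Gd a vs s := by
  have h2 : ∀ r, 0 < 1 / a r := fun r => by
    have := lt_of_lt_of_le ha.pos (ha.lo r); positivity
  unfold Gd
  rcases le_total vs s with h | h
  · exact intervalIntegral.integral_nonneg h (fun r hr => mul_nonneg (by linarith [hr.1]) (h2 r).le)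
  · rw [intervalIntegral.integral_symm, ← intervalIntegral.integral_neg]
    exact intervalIntegral.integral_nonneg h (fun r hr => by nlinarith [hr.2, h2 r])

lemma Gd_hd (ha : Coef a c C) (vs s : ℝ) : HasDerivAt (Gd a vs) ((s - vs) * (1 / a s)) s :=
  prim_hd (f := fun r => (r - vs) * (1 / a r)) (by have := ha.inv_cont; fun_prop) vs s

lemma Pd_hd (ha : Coef a c C) (rs vs s : ℝ) : HasDerivAt (Pd a rs vs) (-(1 / a s)) s :=
  ((prim_hd ha.inv_cont vs s).const_sub rs)

lemma g_zop (ha : Coef a c C) (hsol : ∀ t, 0 ≤ t → g t = Fop p a (tint v0 g t)) {t : ℝ} (ht : 0 ≤ t) (x : ℝ) :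
    1 / a (tint v0 g t x) * g t x = zop p (tint v0 g t) x := by
  have := lt_of_lt_of_le ha.pos (ha.lo (tint v0 g t x))
  rw [hsol t ht]
  unfold Fop zop; field_simp

lemma E_t (hp : 0 < p) (ha : Coef a c C) (hv0 : SP p v0) (hg : XS p g) (hsol : ∀ t, 0 ≤ t → g t = Fop p a (tint v0 g t)) (vs : ℝ)
    {t : ℝ} (ht : 0 ≤ t) : HasDerivAt (fun t => ∫ x in (0:ℝ)..p, Gd a vs (tint v0 g t x)) (- Dd p (tint v0 g t)) t := by
  have hv := tint_xs hv0 hg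
  have := int_G_t (p := p) hv0 hg (w := fun _ => 1) (Gd_hd ha vs) (by have := ha.inv_cont; fun_prop) continuous_const t
  simp only [mul_one] at this
  refine this.congr_deriv ?_
  have e : ∀ x, (tint v0 g t x - vs) * (1 / a (tint v0 g t x)) * g t x = 
     1 * (iteratedDeriv 2 (tint v0 g t) x * tint v0 g t x) + 1 * (tint v0 g t x - mean p (tint v0 g t))^2
       + 1 * (mean p (tint v0 g t) * (tint v0 g t x - mean p (tint v0 g t)) + (- vs) * zop p (tint v0 g t) x) := by
    intro x
    rw [mul_assoc, g_zop ha hsol ht]; unfold zop; ring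
  have c1 := (hv.sp t).cont
  have c2 := ((hv.sp t).iter 2).cont
  have c3 := zop_cont (hv.sp t)
  simp only [e]
  rw [int_lin3 (by fun_prop) (by fun_prop) (by fun_prop), int_lin2 (by fun_prop) (by fun_prop), int_zop hp (hv.sp t), int_dev_zero hp c1]
  have h1 := ibp_iter (hv.sp t) (hv.sp t) 0
  simp only [zero_add, iteratedDeriv_zero] at h1
  unfold Dd Y
  simp only [pow_two (iteratedDeriv 1 (tint v0 g t) _)]
  rw [h1]; ring

lemma D_decay (hp : 0 < p) (ha : Coef a c C) (hv0 : SP p v0) (hg : XS p g) (hsol : ∀ t, 0 ≤ t → g t = Fop p a (tint v0 g t)) (vs : ℝ)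
    {t : ℝ} (ht : 0 ≤ t) : Dd p (tint v0 g t) ≤ Dd p v0 ∧ t * Dd p (tint v0 g t) ≤ ∫ x in (0:ℝ)..p, Gd a vs (v0 x) := by
  have z0 : tint v0 g 0 = v0 := tint_zero
  constructor
  · have := dec_of_deriv (fun t _ => Dd_t hp hv0 hg t) (fun t ht => Dd_dec hp ha hv0 hg hsol ht) ht
    simpa only [z0] using this
  · have := dec_of_deriv (f := fun t => (∫ x in (0:ℝ)..p, Gd a vs (tint v0 g t x)) + t * Dd p (tint v0 g t)) 
      (fun t ht => (E_t hp ha hv0 hg hsol vs ht).fun_add ((hasDerivAt_id t).fun_mul (Dd_t hp hv0 hg t))) 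
      (fun t ht => ?_) ht
    · simp only [z0, zero_mul, add_zero] at this
      have h2 : 0 ≤ ∫ x in (0:ℝ)..p, Gd a vs (tint v0 g t x) :=
        intervalIntegral.integral_nonneg hp.le (fun x _ => Gd_nonneg ha _ _)
      linarith
    · have := mul_nonneg ht (neg_nonneg.2 (Dd_dec hp ha hv0 hg hsol ht))
      simp only [id] at *
      linarith

lemma P_cons (hp : 0 < p) (ha : Coef a c C) (hv0 : SP p v0) (hg : XS p g) (hsol : ∀ t, 0 ≤ t → g t = Fop p a (tint v0 g t)) (rs vs : ℝ)
    {w : ℝ → ℝ} (hw : Continuous w) (hz : ∀ v, SP p v → ∫ x in (0:ℝ)..p, zop p v x * w x = 0)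
    {t : ℝ} (ht : 0 ≤ t) : ∫ x in (0:ℝ)..p, Pd a rs vs (tint v0 g t x) * w x = ∫ x in (0:ℝ)..p, Pd a rs vs (v0 x) * w x := by
  have hv := tint_xs hv0 hg
  have := const_of_deriv (f := fun t => ∫ x in (0:ℝ)..p, Pd a rs vs (tint v0 g t x) * w x) (fun t ht => ?_) ht
  · have z0 : tint v0 g 0 = v0 := tint_zero
    simpa only [z0] using this
  · refine (int_G_t (p := p) hv0 hg (w := w) (Pd_hd ha rs vs) (by have := ha.inv_cont; fun_prop) hw t).congr_deriv ?_
    have : ∀ x, -(1 / a (tint v0 g t x)) * g t x * w x = - (zop p (tint v0 g t) x * w x) := fun x => by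
      rw [← g_zop ha hsol ht]; ring
    simp only [this, intervalIntegral.integral_neg, hz _ (hv.sp t), neg_zero]

lemma Yk_unif (hp : 0 < p) (ha : Coef a c C) (hv0 : SP p v0) (hg : XS p g) (hsol : ∀ t, 0 ≤ t → g t = Fop p a (tint v0 g t)) {B : ℝ}
    (hB : ∀ t, 0 ≤ t → Y p 1 (tint v0 g t) ≤ B) (k : ℕ) :
    ∃ B', 0 ≤ B' ∧ ∀ t, 0 ≤ t → ∀ j, 1 ≤ j → j ≤ k + 1 → Y p j (tint v0 g t) ≤ B' := by
  have hv := tint_xs hv0 hg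
  induction k with
  | zero =>
    refine ⟨B, (Y_nonneg hp _ _).trans (hB 0 le_rfl), fun t ht j h1 h2 => ?_⟩
    obtain rfl : j = 1 := by omega
    exact hB t ht
  | succ k ih =>
    obtain ⟨B1, hB1, h1⟩ := ih
    obtain ⟨Φ, hΦ⟩ := energy hp ha k B1 hB1
    have hc := ha.pos
    set R := 2 * Φ * p^2 / c with hR
    have key : ∀ t, 0 ≤ t → Y p (k+2) (tint v0 g t) ≤ R + |Y p (k+2) (tint v0 g 0) - R| := by
      intro t ht
      have := gron (f := fun t => Y p (k+2) (tint v0 g t) - R) (K := -(c/p^2)) (T := t)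
        (fun s _ _ => (Y_t hv0 hg (k+2) s).sub_const R) (fun s h0 _ => ?_) ht le_rfl
      · have h3 : Real.exp (-(c/p^2) * t) ≤ 1 := by
          rw [Real.exp_le_one_iff]
          have : 0 ≤ c/p^2 * t := by positivity
          linarith
        have h4 := Real.exp_pos (-(c/p^2) * t)
        have h5 : (Y p (k+2) (tint v0 g 0) - R) * Real.exp (-(c/p^2) * t) ≤ |Y p (k+2) (tint v0 g 0) - R| := by
          nlinarith [le_abs_self (Y p (k+2) (tint v0 g 0) - R), abs_nonneg (Y p (k+2) (tint v0 g 0) - R)]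
        linarith
      · have h2 := hΦ _ (hv.sp s) (h1 s h0)
        have h3 := ibp_iter (hv.sp s) (hg.sp s) (k+1)
        rw [← hsol s h0] at h2
        have h4 := poincare hp (hv.sp s) (show 1 ≤ k+2 by omega)
        have e1 : k + 1 + 1 = k + 2 := rfl
        have e2 : k + 1 + 2 = k + 3 := rfl
        have e3 : k + 2 + 1 = k + 3 := rfl
        rw [e1, e2] at h3
        rw [e3] at h4
        rw [h3]
        have h5 : -(c/p^2) * (Y p (k+2) (tint v0 g s) - R) = 2 * Φ - c / p^2 * Y p (k+2) (tint v0 g s) := by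
          rw [hR]; field_simp; ring
        rw [h5]
        have h6 : c / p^2 * Y p (k+2) (tint v0 g s) ≤ c * Y p (k+3) (tint v0 g s) := by
          calc _ ≤ c / p^2 * (p^2 * Y p (k+3) (tint v0 g s)) := by gcongr
            _ = _ := by field_simp
        linarith
    refine ⟨max B1 (R + |Y p (k+2) (tint v0 g 0) - R|), le_max_of_le_left hB1, fun t ht j hj1 hj2 => ?_⟩
    rcases Nat.lt_or_ge j (k+2) with h | h
    · exact le_max_of_le_left (h1 t ht j hj1 (by omega))
    · obtain rfl : j = k + 2 := by omega
      exact le_max_of_le_right (key t ht)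
end dyn

lemma Coef_of_compact {a : ℝ → ℝ} {e c : ℝ} (ha : ContDiff ℝ ∞ a) (hc : 0 < c) (hlo : ∀ x, c ≤ a x)
    (hs : HasCompactSupport (fun x => a x - e)) : ∃ C, Coef a c C := by
  have hb : ∀ j, HasCompactSupport (iteratedDeriv j (fun x => a x - e)) := by
    intro j
    induction j with
    | zero => simpa using hs
    | succ j ih => rw [iteratedDeriv_succ]; exact ih.deriv
  have hsm : ContDiff ℝ ∞ (fun x => a x - e) := ha.sub contDiff_const
  have hB : ∀ j, ∃ K, ∀ x, ‖iteratedDeriv j (fun x => a x - e) x‖ ≤ K := fun j =>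
    (smooth_iter hsm j).continuous.bounded_above_of_compact_support (hb j)
  obtain ⟨K0, hK0⟩ := hB 0
  simp only [iteratedDeriv_zero, Real.norm_eq_abs] at hK0
  refine ⟨K0 + e, ha, hc, hlo, fun x => by linarith [(abs_le.1 (hK0 x)).2], fun j => ?_⟩
  cases j with
  | zero => exact ⟨K0 + |e|, fun x => by
      rw [iteratedDeriv_zero]
      have h1 := abs_le.1 (hK0 x)
      have h2 := abs_le.1 (le_refl |e|)
      rw [abs_le]; constructor <;> linarith [h1.1, h1.2, h2.1, h2.2]⟩
  | succ j =>
    obtain ⟨K, hK⟩ := hB (j+1)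
    refine ⟨K, fun x => ?_⟩
    have := hK x
    rw [iteratedDeriv_succ', deriv_sub_const_fun] at this
    rw [iteratedDeriv_succ']
    exact this

lemma cutoff {α δ M : ℝ} (hα : 0 < α) (hδ : 0 < δ) (hM : δ ≤ M) :
    ∃ a c C, Coef a c C ∧ ∀ s, δ ≤ s → s ≤ M → a s = α * s ^ (1 + 1/α) := by
  let χ : ContDiffBump ((δ+M)/2) := ⟨(M-δ)/2 + δ/4, (M-δ)/2 + δ/2, by linarith, by linarith⟩
  have hsm : ContDiff ℝ ∞ χ := χ.contDiff
  set τ := fun s : ℝ => 1 + χ s * (s - 1) with hτ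
  have hχ0 : ∀ s, 0 ≤ χ s := fun s => χ.nonneg
  have hχ1 : ∀ s, χ s ≤ 1 := fun s => χ.le_one
  have hout : ∀ s, s ≤ δ/2 → χ s = 0 := fun s hs => by
    apply χ.zero_of_le_dist
    rw [Real.dist_eq]
    show (M-δ)/2 + δ/2 ≤ _
    rw [abs_sub_comm]
    exact le_trans (by linarith) (le_abs_self _)
  have hτpos : ∀ s, min 1 (δ/2) ≤ τ s := by
    intro s
    rcases le_or_gt s (δ/2) with h | h
    · simp [hτ, hout s h]
    · have h1 := min_le_left 1 (δ/2)
      have h2 := min_le_right 1 (δ/2)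
      have e : τ s = (1 - χ s) * 1 + χ s * s := by simp only [hτ]; ring
      rw [e]
      nlinarith [hχ0 s, hχ1 s]
  have hm : 0 < min 1 (δ/2) := lt_min one_pos (by linarith)
  have hτsm : ContDiff ℝ ∞ τ := contDiff_const.add (hsm.mul (contDiff_id.sub contDiff_const))
  have hasm : ContDiff ℝ ∞ (fun s => α * (τ s) ^ (1 + 1/α)) :=
    contDiff_const.mul (hτsm.rpow_const_of_ne (fun s => (lt_of_lt_of_le hm (hτpos s)).ne'))
  have hcs : HasCompactSupport (fun s => α * (τ s) ^ (1 + 1/α) - α) := by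
    refine HasCompactSupport.mono (f := χ) χ.hasCompactSupport ?_
    intro s hs
    rw [Function.mem_support] at hs ⊢
    intro h; apply hs
    simp [hτ, h]
  obtain ⟨C, hC⟩ := Coef_of_compact (c := α * (min 1 (δ/2)) ^ (1 + 1/α)) hasm (by positivity) (fun s => by
    have := hτpos s
    gcongr) hcs
  refine ⟨_, _, C, hC, fun s h1 h2 => ?_⟩
  have : χ s = 1 := by
    apply χ.one_of_mem_closedBall
    rw [Metric.mem_closedBall, Real.dist_eq, abs_le]
    show -((M-δ)/2 + δ/4) ≤ _ ∧ _ ≤ ((M-δ)/2 + δ/4)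
    constructor <;> linarith
  simp [hτ, this]

lemma bootstrap {V : ℝ → ℝ → ℝ} {p δ M δ1 M1 : ℝ} (hp : 0 < p) (hV : Continuous fun q : ℝ × ℝ => V q.1 q.2)
    (hper : ∀ t, Function.Periodic (V t) p) (h1 : δ < δ1) (h2 : M1 < M)
    (hinit : ∀ x, δ ≤ V 0 x ∧ V 0 x ≤ M)
    (himp : ∀ T, 0 ≤ T → (∀ t, 0 ≤ t → t ≤ T → ∀ x, δ ≤ V t x ∧ V t x ≤ M) → ∀ x, δ1 ≤ V T x ∧ V T x ≤ M1) :
    ∀ t, 0 ≤ t → ∀ x, δ ≤ V t x ∧ V t x ≤ M := by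
  by_contra hcon
  push Not at hcon
  set B := {t | 0 ≤ t ∧ ¬ ∀ x, δ ≤ V t x ∧ V t x ≤ M} with hB
  have hne : B.Nonempty := by
    obtain ⟨t, ht, x, hx⟩ := hcon
    exact ⟨t, ht, fun h => absurd (h x).2 (not_le.2 (hx (h x).1))⟩
  have hbd : BddBelow B := ⟨0, fun t ht => ht.1⟩
  set T := sInf B with hT
  have hT0 : 0 ≤ T := le_csInf hne fun t ht => ht.1
  have hlt : ∀ t, 0 ≤ t → t < T → ∀ x, δ ≤ V t x ∧ V t x ≤ M := by
    intro t ht htT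
    by_contra h
    exact absurd (csInf_le hbd ⟨ht, h⟩) (not_le.2 htT)
  have hTgood : ∀ x, δ ≤ V T x ∧ V T x ≤ M := by
    intro x
    rcases hT0.eq_or_lt with h | h
    · rw [← h]; exact hinit x
    · have hc : Tendsto (fun t => V t x) (nhdsWithin T (Set.Iio T)) (nhds (V T x)) :=
        ((hV.comp (Continuous.prodMk_left x)).tendsto T).mono_left nhdsWithin_le_nhds
      have hev : ∀ᶠ t in nhdsWithin T (Set.Iio T), δ ≤ V t x ∧ V t x ≤ M := by
        filter_upwards [Ioo_mem_nhdsLT h] with t ht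
        exact hlt t ht.1.le ht.2 x
      exact ⟨ge_of_tendsto hc (hev.mono fun _ h => h.1), le_of_tendsto hc (hev.mono fun _ h => h.2)⟩
  have himpT := himp T hT0 (fun t ht htT => by
    rcases htT.eq_or_lt with h | h
    · rw [h]; exact hTgood
    · exact hlt t ht h)
  have hev : ∀ᶠ t in nhds T, ∀ x ∈ Set.Icc 0 p, δ < V t x ∧ V t x < M := by
    apply isCompact_Icc.eventually_forall_of_forall_eventually
    intro x _
    have hc := hV.tendsto (T, x)
    have := himpT x
    exact (hc.eventually (lt_mem_nhds (lt_of_lt_of_le h1 this.1))).and (hc.eventually (gt_mem_nhds (lt_of_le_of_lt this.2 h2)))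
  obtain ⟨ε, hε, hball⟩ := Metric.eventually_nhds_iff.1 hev
  obtain ⟨b, hb, hbT⟩ := exists_lt_of_csInf_lt hne (show sInf B < T + ε by rw [← hT]; linarith)
  have hTb : T ≤ b := csInf_le hbd hb
  refine hb.2 fun x => ?_
  obtain ⟨y, hy, hxy⟩ := (hper b).exists_mem_Ico₀ hp x
  have := hball (y := b) (by rw [Real.dist_eq, abs_of_nonneg (by linarith)]; linarith) y ⟨hy.1, hy.2.le⟩
  rw [hxy]
  exact ⟨this.1.le, this.2.le⟩

noncomputable def Q1 (s : ℝ) : ℝ := ∫ r in (0:ℝ)..s, max r 0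
noncomputable def Q0 (s : ℝ) : ℝ := ∫ r in (0:ℝ)..s, Q1 r

lemma Q1_hd (s : ℝ) : HasDerivAt Q1 (max s 0) s := prim_hd (f := fun r => max r 0) (by fun_prop) 0 s
lemma Q1_cont : Continuous Q1 := continuous_iff_continuousAt.2 fun s => (Q1_hd s).continuousAt
lemma Q0_hd (s : ℝ) : HasDerivAt Q0 (Q1 s) s := prim_hd Q1_cont 0 s
lemma Q0_cont : Continuous Q0 := continuous_iff_continuousAt.2 fun s => (Q0_hd s).continuousAt
lemma Q1_zero {s : ℝ} (hs : s ≤ 0) : Q1 s = 0 := by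
  unfold Q1
  rw [intervalIntegral.integral_symm, intervalIntegral.integral_congr (g := fun _ => (0:ℝ))]
  · simp
  · intro r hr
    rw [Set.uIcc_of_le hs] at hr
    exact max_eq_right hr.2
lemma Q0_zero {s : ℝ} (hs : s ≤ 0) : Q0 s = 0 := by
  unfold Q0
  rw [intervalIntegral.integral_symm, intervalIntegral.integral_congr (g := fun _ => (0:ℝ))]
  · simp
  · intro r hr
    rw [Set.uIcc_of_le hs] at hr
    exact Q1_zero hr.2
lemma Q1_pos {s : ℝ} (hs : 0 < s) : 0 < Q1 s :=
  intervalIntegral.intervalIntegral_pos_of_pos_on (ii_cont (by fun_prop) _ _) (fun x hx => lt_max_of_lt_left hx.1) hs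
lemma Q0_pos {s : ℝ} (hs : 0 < s) : 0 < Q0 s :=
  intervalIntegral.intervalIntegral_pos_of_pos_on (ii_cont Q1_cont _ _) (fun x hx => Q1_pos hx.1) hs
lemma Q1_nonneg (s : ℝ) : 0 ≤ Q1 s := by
  rcases le_or_gt s 0 with h | h
  · rw [Q1_zero h]
  · exact (Q1_pos h).le
lemma Q0_nonneg (s : ℝ) : 0 ≤ Q0 s := by
  rcases le_or_gt s 0 with h | h
  · rw [Q0_zero h]
  · exact (Q0_pos h).le

/-- integration by parts with a C¹ weight -/
lemma ibp_C1 {p : ℝ} {v w w' : ℝ → ℝ} (hv : SP p v) (hw : ∀ x, HasDerivAt w (w' x) x) (hw' : Continuous w') (hper : w p = w 0) :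
    ∫ x in (0:ℝ)..p, w x * iteratedDeriv 2 v x = - ∫ x in (0:ℝ)..p, w' x * iteratedDeriv 1 v x := by
  have h1 := hv.hasDeriv_iter 1
  have cw : Continuous w := continuous_iff_continuousAt.2 fun s => (hw s).continuousAt
  have c1 := (hv.iter 1).cont
  have c2 := (hv.iter 2).cont
  have := intervalIntegral.integral_mul_deriv_eq_deriv_mul (a := 0) (b := p) (u := w) (v := iteratedDeriv 1 v) (u' := w') (v' := iteratedDeriv 2 v)
    (fun x _ => hw x) (fun x _ => h1 x) (ii_cont hw' _ _) (ii_cont c2 _ _)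
  rw [this, hper]
  have := (hv.iter 1).per 0
  rw [zero_add] at this
  rw [this]; ring

lemma max_princ {p c C : ℝ} {a v0 : ℝ → ℝ} {g : ℝ → ℝ → ℝ} (hp : 0 < p) (ha : Coef a c C) (hv0 : SP p v0) (hg : XS p g)
    (hsol : ∀ t, 0 ≤ t → g t = Fop p a (tint v0 g t)) (rs vs : ℝ) {R0 M T : ℝ} 
    (hb : ∀ t, 0 ≤ t → t ≤ T → ∀ x, 0 ≤ tint v0 g t x ∧ tint v0 g t x ≤ M)
    (hinit : ∀ x, Pd a rs vs (v0 x) ≤ R0) {t : ℝ} (ht : 0 ≤ t) (htT : t ≤ T) (x : ℝ) :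
    Pd a rs vs (tint v0 g t x) ≤ R0 + M * t := by
  have hv := tint_xs hv0 hg
  have cP : Continuous (Pd a rs vs) := continuous_iff_continuousAt.2 fun s => (Pd_hd ha rs vs s).continuousAt
  have cQ1 := Q1_cont
  have cQ0 := Q0_cont
  have cV := hv.ct0
  have cg := hg.ct0
  have ci := ha.inv_cont
  have hd : ∀ s, HasDerivAt (fun s => ∫ x in (0:ℝ)..p, Q0 (Pd a rs vs (tint v0 g s x) - (R0 + M * s)))
      (∫ x in (0:ℝ)..p, Q1 (Pd a rs vs (tint v0 g s x) - (R0 + M * s)) * (-(1 / a (tint v0 g s x)) * g s x - M)) s := by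
    intro s
    refine hasDeriv_param (f := fun s x => Q0 (Pd a rs vs (tint v0 g s x) - (R0 + M * s)))
      (f' := fun s x => Q1 (Pd a rs vs (tint v0 g s x) - (R0 + M * s)) * (-(1 / a (tint v0 g s x)) * g s x - M)) ?_ ?_ ?_ 0 p s
    · change Continuous fun q : ℝ × ℝ => Q0 (Pd a rs vs (tint v0 g q.1 q.2) - (R0 + M * q.1))
      fun_prop
    · change Continuous fun q : ℝ × ℝ => Q1 (Pd a rs vs (tint v0 g q.1 q.2) - (R0 + M * q.1)) * (-(1 / a (tint v0 g q.1 q.2)) * g q.1 q.2 - M)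
      have c2 : Continuous fun q : ℝ × ℝ => 1 / a (tint v0 g q.1 q.2) := ci.comp cV
      fun_prop
    · intro s y
      have h1 : HasDerivAt (fun s => Pd a rs vs (tint v0 g s y) - (R0 + M * s)) (-(1 / a (tint v0 g s y)) * g s y - M) s := by
        have := (((Pd_hd ha rs vs _).comp s (tint_t0 hv0 hg y s))).fun_sub (((hasDerivAt_id s).const_mul M).const_add R0)
        exact this.congr_deriv (by ring)
      exact (Q0_hd _).comp s h1
  have hle : ∀ s, 0 ≤ s → s ≤ T → (∫ x in (0:ℝ)..p, Q1 (Pd a rs vs (tint v0 g s x) - (R0 + M * s)) * (-(1 / a (tint v0 g s x)) * g s x - M))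
      ≤ 0 * ∫ x in (0:ℝ)..p, Q0 (Pd a rs vs (tint v0 g s x) - (R0 + M * s)) := by
    intro s h0 hT
    rw [zero_mul]
    have cv := (hv.sp s).cont
    have cv1 := ((hv.sp s).iter 1).cont
    have cv2 := ((hv.sp s).iter 2).cont
    have ci2 : Continuous fun x => 1 / a (tint v0 g s x) := ci.comp cv
    set W := fun x => Q1 (Pd a rs vs (tint v0 g s x) - (R0 + M * s)) with hW
    set W' := fun x => max (Pd a rs vs (tint v0 g s x) - (R0 + M * s)) 0 * (-(1 / a (tint v0 g s x)) * iteratedDeriv 1 (tint v0 g s) x) with hW'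
    have cW : Continuous W := by fun_prop
    have cW' : Continuous W' := by fun_prop
    have hdW : ∀ x, HasDerivAt W (W' x) x := by
      intro x
      have h1 : HasDerivAt (fun x => Pd a rs vs (tint v0 g s x) - (R0 + M * s)) (-(1 / a (tint v0 g s x)) * iteratedDeriv 1 (tint v0 g s) x) x := by
        have := ((Pd_hd ha rs vs _).comp x ((hv.sp s).hasDeriv_iter 0 x |>.congr_deriv rfl))
        simp only [iteratedDeriv_zero] at this
        exact this.sub_const _
      exact (Q1_hd _).comp x h1
    have hper : W p = W 0 := by
      have := (hv.sp s).per 0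
      rw [zero_add] at this
      simp only [hW, this]
    have hi := ibp_C1 (hv.sp s) hdW cW' hper
    have e : ∀ x, W x * (-(1 / a (tint v0 g s x)) * g s x - M) = (-1) * (W x * iteratedDeriv 2 (tint v0 g s) x)
        + 1 * (W x * (mean p (tint v0 g s) - M - tint v0 g s x)) := fun x => by
      have := g_zop ha hsol h0 x
      rw [neg_mul, this]; unfold zop; ring
    have e' : (fun x => W x * (-(1 / a (tint v0 g s x)) * g s x - M)) = _ := funext e
    rw [e', int_lin2 (by fun_prop) (by fun_prop), hi]
    have i1 : ∫ x in (0:ℝ)..p, W' x * iteratedDeriv 1 (tint v0 g s) x ≤ 0 := by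
      have := int_le_const (C := 0) hp (f := fun x => W' x * iteratedDeriv 1 (tint v0 g s) x) (by fun_prop) (fun x => by
        have h1 : 0 ≤ max (Pd a rs vs (tint v0 g s x) - (R0 + M * s)) 0 := le_max_right _ _
        have h2 : 0 < 1 / a (tint v0 g s x) := by
          have := lt_of_lt_of_le ha.pos (ha.lo (tint v0 g s x)); positivity
        have h3 : 0 ≤ max (Pd a rs vs (tint v0 g s x) - (R0 + M * s)) 0 * (1 / a (tint v0 g s x)) * (iteratedDeriv 1 (tint v0 g s) x)^2 := by positivity
        simp only [hW']; linarith)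
      simpa using this
    have hmean : mean p (tint v0 g s) ≤ M := by
      have := int_le_const hp cv (fun x => (hb s h0 hT x).2)
      rw [int_eq_mean hp] at this
      exact le_of_mul_le_mul_left this hp
    have i2 : ∫ x in (0:ℝ)..p, W x * (mean p (tint v0 g s) - M - tint v0 g s x) ≤ 0 := by
      have := int_le_const (C := 0) hp (f := fun x => W x * (mean p (tint v0 g s) - M - tint v0 g s x)) (by fun_prop) (fun x => by
        have h1 : 0 ≤ W x := Q1_nonneg _
        have h2 := (hb s h0 hT x).1
        exact mul_nonpos_of_nonneg_of_nonpos h1 (by linarith))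
      simpa using this
    linarith
  have h1 := gron (fun s _ _ => hd s) hle ht htT
  have z0 : tint v0 g 0 = v0 := tint_zero
  have h2 : ∫ x in (0:ℝ)..p, Q0 (Pd a rs vs (tint v0 g 0 x) - (R0 + M * 0)) = 0 := by
    have : ∀ x, Q0 (Pd a rs vs (tint v0 g 0 x) - (R0 + M * 0)) = 0 := fun x => by
      rw [z0]; exact Q0_zero (by linarith [hinit x])
    simp only [this, intervalIntegral.integral_zero]
  rw [h2, zero_mul] at h1
  by_contra hx
  push Not at hx
  have cv := (hv.sp t).cont
  obtain ⟨y, hy, hxy⟩ := ((hv.sp t).per).exists_mem_Ico₀ hp x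
  have := intervalIntegral.integral_pos (f := fun x => Q0 (Pd a rs vs (tint v0 g t x) - (R0 + M * t))) hp
    (by fun_prop) (fun x _ => Q0_nonneg _) ⟨y, ⟨hy.1, hy.2.le⟩, by
      rw [← hxy]; exact Q0_pos (by linarith)⟩
  linarith

lemma Pd_eq {a : ℝ → ℝ} {α δ M vs s : ℝ} (hα : 0 < α) (hδ : 0 < δ) (haeq : ∀ s, δ ≤ s → s ≤ M → a s = α * s ^ (1 + 1/α))
    (h1 : δ ≤ vs) (h2 : vs ≤ M) (h3 : δ ≤ s) (h4 : s ≤ M) : Pd a (vs ^ (-(1/α))) vs s = s ^ (-(1/α)) := by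
  unfold Pd
  have hmem : ∀ r ∈ Set.uIcc vs s, δ ≤ r ∧ r ≤ M := fun r hr => by
    rw [Set.mem_uIcc] at hr
    rcases hr with hr | hr <;> constructor <;> linarith [hr.1, hr.2]
  have hd : ∀ r ∈ Set.uIcc vs s, HasDerivAt (fun r : ℝ => - r ^ (-(1/α))) (1 / a r) r := by
    intro r hr
    obtain ⟨k1, k2⟩ := hmem r hr
    have hr0 : 0 < r := by linarith
    refine (hasDerivAt_rpow_const (p := -(1/α)) (Or.inl hr0.ne')).fun_neg.congr_deriv ?_
    rw [haeq r k1 k2, show -(1/α) - 1 = -(1 + 1/α) by ring, rpow_neg hr0.le]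
    have : 0 < r ^ (1 + 1/α) := by positivity
    field_simp
  rw [intervalIntegral.integral_eq_sub_of_hasDerivAt hd]
  · ring
  · apply ContinuousOn.intervalIntegrable
    have : Set.EqOn (fun r => 1 / a r) (fun r => 1 / (α * r ^ (1 + 1/α))) (Set.uIcc vs s) := fun r hr => by
      obtain ⟨k1, k2⟩ := hmem r hr
      simp only [haeq r k1 k2]
    refine ContinuousOn.congr ?_ this
    intro r hr
    have hr0 : 0 < r := by linarith [(hmem r hr).1]
    apply ContinuousAt.continuousWithinAt
    have : ContinuousAt (fun r : ℝ => r ^ (1 + 1/α)) r := continuousAt_rpow_const _ _ (Or.inl hr0.ne')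
    refine continuousAt_const.div (continuousAt_const.mul this) (by positivity)

lemma Gd_eq {a : ℝ → ℝ} {α δ M vs s : ℝ} (haeq : ∀ s, δ ≤ s → s ≤ M → a s = α * s ^ (1 + 1/α))
    (h1 : δ ≤ vs) (h2 : vs ≤ M) (h3 : δ ≤ s) (h4 : s ≤ M) : Gd a vs s = Gd (fun s => α * s ^ (1 + 1/α)) vs s := by
  unfold Gd
  apply intervalIntegral.integral_congr
  intro r hr
  rw [Set.mem_uIcc] at hr
  have : δ ≤ r ∧ r ≤ M := by
    rcases hr with hr | hr <;> constructor <;> linarith [hr.1, hr.2]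
  simp only [haeq r this.1 this.2]

lemma psi_small (K Cp : ℝ) {η : ℝ} (hη : 0 < η) : ∃ d, 0 < d ∧ ∀ D, 0 ≤ D → D ≤ d →
    5 * √(K * (Cp * √D)) + Cp * √D ≤ η := by
  have hc : Continuous fun D : ℝ => 5 * √(K * (Cp * √D)) + Cp * √D := by fun_prop
  have ht := hc.tendsto 0
  simp only [sqrt_zero, mul_zero, add_zero] at ht
  obtain ⟨d, hd, h⟩ := Metric.eventually_nhds_iff.1 (ht.eventually (gt_mem_nhds hη))
  refine ⟨d/2, by linarith, fun D h1 h2 => (h (y := D) ?_).le⟩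
  rw [Real.dist_eq, sub_zero, abs_of_nonneg h1]; linarith

theorem main_v {p α vs : ℝ} (hp : 0 < p) (hp2 : p ≤ 2 * π) (hα : 0 < α) (hvs : 0 < vs) {v0 : ℝ → ℝ} (hv0 : SP p v0)
    (h0 : ∀ x, 0 < v0 x) (hyInt : ∫ x in (0:ℝ)..p, (v0 x) ^ (-(1/α)) = p * vs ^ (-(1/α)))
    (horth : p = 2 * π → (∫ x in (0:ℝ)..p, (v0 x) ^ (-(1/α)) * cos x = 0) ∧ ∫ x in (0:ℝ)..p, (v0 x) ^ (-(1/α)) * sin x = 0) :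
    ∃ (a : ℝ → ℝ) (c C δ M : ℝ) (g : ℝ → ℝ → ℝ), Coef a c C ∧ 0 < δ ∧ δ ≤ vs ∧ vs ≤ M ∧ (∀ s, δ ≤ s → s ≤ M → a s = α * s ^ (1 + 1/α)) ∧
      XS p g ∧ (∀ t, 0 ≤ t → g t = Fop p a (tint v0 g t)) ∧ (∀ t, 0 ≤ t → ∀ x, δ ≤ tint v0 g t x ∧ tint v0 g t x ≤ M) ∧
      (∀ η > 0, ∀ᶠ t in atTop, ∀ x, |tint v0 g t x - vs| ≤ η) ∧
      (∀ k, 1 ≤ k → ∀ η > 0, ∀ᶠ t in atTop, ∀ x, |iteratedDeriv k (tint v0 g t) x| ≤ η) := by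
  obtain ⟨Cp, hCp, hstat⟩ := static_main hp hp2 hα hvs
  -- extrema of the initial datum
  obtain ⟨mx, hmx⟩ : ∃ mx, ∀ x, v0 x ≤ mx := by
    obtain ⟨S, _, hS⟩ := hv0.bdd hp
    exact ⟨S, fun x => (le_abs_self _).trans (hS x)⟩
  obtain ⟨m0, hm0, hm0v⟩ : ∃ m0, 0 < m0 ∧ ∀ x, m0 ≤ v0 x := by
    obtain ⟨y, hy, hmin⟩ := isCompact_Icc.exists_isMinOn (s := Set.Icc 0 p) ⟨0, le_rfl, hp.le⟩ hv0.cont.continuousOn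
    refine ⟨v0 y, h0 y, fun x => ?_⟩
    obtain ⟨z, hz, hxz⟩ := hv0.per.exists_mem_Ico₀ hp x
    rw [hxz]; exact hmin ⟨hz.1, hz.2.le⟩
  set D0 := Dd p v0
  set M1 := 2 * max (4 * (Cp * √D0)) (2 * (6 ^ α * vs)) + 2 * (Cp * √D0) with hM1
  set M := max M1 (max mx vs) + 1 with hM
  have hM1M : M1 < M := by have := le_max_left M1 (max mx vs); linarith
  have hmxM : mx ≤ M := by have := (le_max_left mx vs).trans (le_max_right M1 (max mx vs)); linarith
  have hvsM : vs ≤ M := by have := (le_max_right mx vs).trans (le_max_right M1 (max mx vs)); linarith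
  have hM0 : 0 < M := by linarith
  set rs := vs ^ (-(1/α)) with hrs
  set cM := 1/α * M ^ (-(1/α)-1) with hcM
  have hcM0 : 0 < cM := by positivity
  have hpsi_eq : ∀ D, 2 * rs * (Cp * √D) / cM = (2 * rs / cM) * (Cp * √D) := fun D => by ring
  set E0 := ∫ x in (0:ℝ)..p, Gd (fun s => α * s ^ (1 + 1/α)) vs (v0 x) with hE0
  obtain ⟨d, hd, hdpsi⟩ := psi_small (2 * rs / cM) Cp (show 0 < vs/2 by linarith)
  set T1 := max (E0 / d) 1 with hT1
  have hT10 : 0 < T1 := lt_of_lt_of_le one_pos (le_max_right _ _)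
  set R0 := m0 ^ (-(1/α)) with hR0
  have hR00 : 0 < R0 := by positivity
  set δ1 := min m0 (min (vs/2) ((R0 + M * T1) ^ (-α))) with hδ1
  have hδ10 : 0 < δ1 := lt_min hm0 (lt_min (by linarith) (by positivity))
  have hδa : δ1 ≤ m0 := min_le_left _ _
  have hδb : δ1 ≤ vs/2 := (min_le_right _ _).trans (min_le_left _ _)
  have hδc : δ1 ≤ (R0 + M * T1) ^ (-α) := (min_le_right _ _).trans (min_le_right _ _)
  set δ := δ1 / 2 with hδ
  have hδ0 : 0 < δ := by linarith
  have hδvs : δ ≤ vs := by linarith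
  obtain ⟨a, c, C, ha, haeq⟩ := cutoff hα hδ0 (hδvs.trans hvsM)
  obtain ⟨g, hg, hsol⟩ := exists_global hp ha hv0
  have hv := tint_xs hv0 hg
  have z0 : tint v0 g 0 = v0 := tint_zero
  have hv0mem : ∀ x, δ ≤ v0 x ∧ v0 x ≤ M := fun x => ⟨by linarith [hm0v x], (hmx x).trans hmxM⟩
  have hPeq : ∀ s, δ ≤ s → s ≤ M → Pd a rs vs s = s ^ (-(1/α)) := fun s h1 h2 => Pd_eq hα hδ0 haeq hδvs hvsM h1 h2
  have hGE : ∫ x in (0:ℝ)..p, Gd a vs (v0 x) = E0 := by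
    rw [hE0]; congr 1; ext x
    exact Gd_eq haeq hδvs hvsM (hv0mem x).1 (hv0mem x).2
  have hDdec : ∀ t, 0 ≤ t → Dd p (tint v0 g t) ≤ D0 ∧ t * Dd p (tint v0 g t) ≤ E0 := fun t ht => by
    rw [← hGE]; exact D_decay hp ha hv0 hg hsol vs ht
  have hcons : ∀ {w : ℝ → ℝ}, Continuous w → (∀ v, SP p v → ∫ x in (0:ℝ)..p, zop p v x * w x = 0) → ∀ t, 0 ≤ t →
      (∀ x, δ ≤ tint v0 g t x ∧ tint v0 g t x ≤ M) →
      ∫ x in (0:ℝ)..p, (tint v0 g t x) ^ (-(1/α)) * w x = ∫ x in (0:ℝ)..p, (v0 x) ^ (-(1/α)) * w x := by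
    intro w hw hz t ht hb
    have := P_cons hp ha hv0 hg hsol rs vs hw hz ht
    have e1 : ∀ x, Pd a rs vs (tint v0 g t x) = (tint v0 g t x) ^ (-(1/α)) := fun x => hPeq _ (hb x).1 (hb x).2
    have e2 : ∀ x, Pd a rs vs (v0 x) = (v0 x) ^ (-(1/α)) := fun x => hPeq _ (hv0mem x).1 (hv0mem x).2
    simpa only [e1, e2] using this
  -- consequences of the static estimates at a time where bounds hold
  have hst : ∀ t, 0 ≤ t → (∀ x, δ ≤ tint v0 g t x ∧ tint v0 g t x ≤ M) →
      (∀ x, tint v0 g t x ≤ M1) ∧ ∀ x, |tint v0 g t x - vs| ≤ 5 * √((2 * rs / cM) * (Cp * √(Dd p (tint v0 g t)))) + Cp * √(Dd p (tint v0 g t)) := by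
    intro t ht hb
    obtain ⟨hDn, H⟩ := hstat _ (hv.sp t)
    obtain ⟨H1, H2⟩ := H (fun x => lt_of_lt_of_le hδ0 (hb x).1) (by
        have := hcons (w := fun _ => 1) continuous_const (fun v hv => by simpa using int_zop hp hv) t ht hb
        simp only [mul_one] at this
        rw [this, hyInt]) (by
        intro hpp
        obtain ⟨o1, o2⟩ := horth hpp
        subst hpp
        rw [hcons continuous_cos (fun v hv => int_zop_w hv cos_sp iter2_cos (by simp)) t ht hb,
          hcons continuous_sin (fun v hv => int_zop_w hv sin_sp iter2_sin (by simp)) t ht hb]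
        exact ⟨o1, o2⟩)
    constructor
    · intro x
      refine (H1 x).trans ?_
      have : √(Dd p (tint v0 g t)) ≤ √D0 := Real.sqrt_le_sqrt (hDdec t ht).1
      rw [hM1]
      gcongr
    · intro x
      have := (H2 M hvsM (fun x => (hb x).2)).2 x
      rwa [hpsi_eq] at this
  have hbounds : ∀ t, 0 ≤ t → ∀ x, δ ≤ tint v0 g t x ∧ tint v0 g t x ≤ M := by
    refine bootstrap hp hv.ct0 (fun t => (hv.sp t).per) (show δ < δ1 by linarith) hM1M (by rw [z0]; exact hv0mem) ?_
    intro T hT hb x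
    obtain ⟨s1, s2⟩ := hst T hT (hb T hT le_rfl)
    refine ⟨?_, s1 x⟩
    rcases le_or_gt T1 T with h | h
    · have hD := (hDdec T hT).2
      have hDn := (hstat _ (hv.sp T)).1
      have hDd : Dd p (tint v0 g T) ≤ d := by
        have h1 : E0 ≤ d * T := by
          have : E0 / d ≤ T := (le_max_left _ _).trans h
          rw [div_le_iff₀ hd] at this; linarith
        have h2 : T * Dd p (tint v0 g T) ≤ T * d := by linarith
        exact le_of_mul_le_mul_left h2 (by linarith)
      have := (s2 x).trans (hdpsi _ hDn hDd)
      have := (abs_le.1 this).1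
      linarith
    · have hmp := max_princ hp ha hv0 hg hsol rs vs (R0 := R0) (M := M) (T := T)
        (fun t h1 h2 x => ⟨hδ0.le.trans (hb t h1 h2 x).1, (hb t h1 h2 x).2⟩) (fun y => by
          rw [hPeq _ (hv0mem y).1 (hv0mem y).2, hR0]
          exact rpow_le_rpow_of_nonpos hm0 (hm0v y) (by simp; positivity)) hT le_rfl x
      have hbx := hb T hT le_rfl x
      rw [hPeq _ hbx.1 hbx.2] at hmp
      have hpos : 0 < tint v0 g T x := lt_of_lt_of_le hδ0 hbx.1
      have h1 : (tint v0 g T x) ^ (-(1/α)) ≤ R0 + M * T1 := hmp.trans (by gcongr)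
      refine hδc.trans ?_
      have h2 : (R0 + M * T1) ^ (-α) ≤ ((tint v0 g T x) ^ (-(1/α))) ^ (-α) :=
        rpow_le_rpow_of_nonpos (by positivity) h1 (by linarith)
      rw [← rpow_mul hpos.le] at h2
      have e : -(1/α) * -α = 1 := by field_simp
      rwa [e, rpow_one] at h2
  have hDsmall : ∀ η > 0, ∀ᶠ t in atTop, Dd p (tint v0 g t) ≤ η := by
    intro η hη
    filter_upwards [eventually_ge_atTop (max (E0/η) 1)] with t ht
    have ht1 : 1 ≤ t := (le_max_right _ _).trans ht
    have hD := (hDdec t (by linarith)).2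
    have h1 : E0 ≤ η * t := by
      have : E0 / η ≤ t := (le_max_left _ _).trans ht
      rw [div_le_iff₀ hη] at this; linarith
    have h2 : t * Dd p (tint v0 g t) ≤ t * η := by linarith
    exact le_of_mul_le_mul_left h2 (by linarith)
  have hconv : ∀ η > 0, ∀ᶠ t in atTop, ∀ x, |tint v0 g t x - vs| ≤ η := by
    intro η hη
    obtain ⟨d', hd', h'⟩ := psi_small (2 * rs / cM) Cp hη
    filter_upwards [hDsmall d' hd', eventually_ge_atTop 0] with t h1 h2 x
    exact ((hst t h2 (hbounds t h2)).2 x).trans (h' _ (hstat _ (hv.sp t)).1 h1)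
  -- Y 1
  have hY1 : ∀ t, Y p 1 (tint v0 g t) = Dd p (tint v0 g t) + ∫ x in (0:ℝ)..p, (tint v0 g t x - mean p (tint v0 g t))^2 := fun t => by
    unfold Dd; ring
  have hdev : ∀ t η, 0 ≤ η → (∀ x, |tint v0 g t x - vs| ≤ η) → ∫ x in (0:ℝ)..p, (tint v0 g t x - mean p (tint v0 g t))^2 ≤ p * (2 * η)^2 := by
    intro t η hη h
    have cv := (hv.sp t).cont
    have hm := abs_mean_le hp h
    rw [mean_sub cv continuous_const, mean_const hp] at hm
    refine int_le_const hp (by fun_prop) (fun x => ?_)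
    have h3 := abs_le.1 (h x)
    have h4 := abs_le.1 hm
    exact sq_le_sq' (by linarith [h3.1, h3.2, h4.1, h4.2]) (by linarith [h3.1, h3.2, h4.1, h4.2])
  have hYB : ∀ t, 0 ≤ t → Y p 1 (tint v0 g t) ≤ D0 + p * (2 * M)^2 := by
    intro t ht
    rw [hY1]
    have := hdev t M hM0.le (fun x => by
      have := hbounds t ht x
      rw [abs_le]; constructor <;> linarith)
    linarith [(hDdec t ht).1]
  have hY1small : ∀ η > 0, ∀ᶠ t in atTop, Y p 1 (tint v0 g t) ≤ η := by
    intro η hη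
    set e := √(η / (8 * p)) with he
    have he0 : 0 < e := by positivity
    have he2 : e^2 = η / (8 * p) := Real.sq_sqrt (by positivity)
    filter_upwards [hDsmall (η/2) (by linarith), hconv e he0] with t h1 h2
    rw [hY1]
    have := hdev t e he0.le h2
    rw [mul_pow, he2] at this
    have e3 : p * (2^2 * (η / (8*p))) = η/2 := by field_simp; norm_num
    linarith
  have hYk := interp_small hp (S := fun t : ℝ => 0 ≤ t) atTop (fun t _ => tint v0 g t) (τ := {0}) (fun t _ _ _ => hv.sp t) (eventually_ge_atTop 0) 1
    (fun k hk => by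
      obtain ⟨B', hB', h⟩ := Yk_unif hp ha hv0 hg hsol hYB k
      exact ⟨B', hB', fun t ht _ _ => h t ht (k+1) (by omega) le_rfl⟩)
    (fun η hη => (hY1small η hη).mono fun t h _ _ => h)
  refine ⟨a, c, C, δ, M, g, ha, hδ0, hδvs, hvsM, haeq, hg, hsol, hbounds, hconv, fun k hk η hη => ?_⟩
  filter_upwards [hYk (k+1) (by omega) (η^2/p) (by positivity)] with t h x
  have h1 := sup_iter hp (hv.sp t) hk x
  have h2 : p * Y p (k+1) (tint v0 g t) ≤ η^2 := by
    calc _ ≤ p * (η^2/p) := by gcongr; exact h 0 rfl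
      _ = _ := by field_simp
  exact abs_le_of_sq_le_sq (h1.trans h2) hη.le

lemma XS.mul {p : ℝ} {f g : ℝ → ℝ → ℝ} (hf : XS p f) (hg : XS p g) : XS p (fun t x => f t x * g t x) := by
  refine ⟨fun t => (hf.sp t).mul (hg.sp t), fun k => ?_⟩
  have : (fun q : ℝ × ℝ => iteratedDeriv k (fun x => f q.1 x * g q.1 x) q.2) = fun q : ℝ × ℝ =>
      ∑ i ∈ Finset.range (k + 1), (k.choose i : ℝ) * iteratedDeriv i (f q.1) q.2 * iteratedDeriv (k - i) (g q.1) q.2 := by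
    ext q
    exact iteratedDeriv_mul ((hf.sp q.1).smooth.contDiffAt.of_le (by norm_cast; exact le_top))
      ((hg.sp q.1).smooth.contDiffAt.of_le (by norm_cast; exact le_top))
  rw [this]
  refine continuous_finsetSum _ fun i _ => ?_
  have c1 := hf.ct i
  have c2 := hg.ct (k - i)
  fun_prop

lemma XS.add {p : ℝ} {f g : ℝ → ℝ → ℝ} (hf : XS p f) (hg : XS p g) : XS p (fun t x => f t x + g t x) := by
  refine ⟨fun t => (hf.sp t).add (hg.sp t), fun k => ?_⟩
  have : (fun q : ℝ × ℝ => iteratedDeriv k (fun x => f q.1 x + g q.1 x) q.2) = fun q : ℝ × ℝ =>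
      iteratedDeriv k (f q.1) q.2 + iteratedDeriv k (g q.1) q.2 := by
    ext q
    exact iteratedDeriv_add ((hf.sp q.1).smooth.contDiffAt.of_le (by norm_cast; exact le_top))
      ((hg.sp q.1).smooth.contDiffAt.of_le (by norm_cast; exact le_top))
  rw [this]
  exact (hf.ct k).add (hg.ct k)

lemma XS.timeonly {p : ℝ} {f : ℝ → ℝ} (hf : Continuous f) : XS p (fun t _ => f t) := by
  refine ⟨fun t => SP.const _, fun k => ?_⟩
  simp only [iteratedDeriv_const]
  split_ifs <;> fun_prop

lemma XS.comp {p : ℝ} {f : ℝ → ℝ → ℝ} (hf : XS p f) {a : ℝ → ℝ} (ha : ContDiff ℝ ∞ a) : XS p (fun t x => a (f t x)) := by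
  have := (Loc.coef (p := p) (a := a) 0 0).xs ha hf
  simpa only [iteratedDeriv_zero] using this

lemma hasFD_of_partial {F F1 F2 : ℝ → ℝ → ℝ} (h1 : ∀ x t, HasDerivAt (fun x => F x t) (F1 x t) x)
    (h2 : ∀ x t, HasDerivAt (fun t => F x t) (F2 x t) t) (c1 : Continuous fun q : ℝ × ℝ => F1 q.1 q.2)
    (c2 : Continuous fun q : ℝ × ℝ => F2 q.1 q.2) (x t : ℝ) :
    HasFDerivAt (fun q : ℝ × ℝ => F q.1 q.2) ((ContinuousLinearMap.toSpanSingleton ℝ (F1 x t)).coprod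
      (ContinuousLinearMap.toSpanSingleton ℝ (F2 x t))) (x, t) := by
  have key := hasStrictFDerivAt_uncurry_coprod (𝕜 := ℝ) (u := (x, t)) (f := F)
    (f₁ := fun x t => ContinuousLinearMap.toSpanSingleton ℝ (F1 x t))
    (f₂ := fun x t => ContinuousLinearMap.toSpanSingleton ℝ (F2 x t))
    (Eventually.of_forall fun v => (h1 v.1 v.2).hasFDerivAt)
    (Eventually.of_forall fun v => (h2 v.1 v.2).hasFDerivAt)
    ?_ ?_
  · exact key.hasFDerivAt
  · apply Continuous.continuousAt
    have : Continuous fun q : ℝ × ℝ => F1 q.1 q.2 • ContinuousLinearMap.toSpanSingleton ℝ (1:ℝ) := c1.smul continuous_const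
    refine this.congr fun q => ?_
    ext; simp [Function.HasUncurry.uncurry]
  · apply Continuous.continuousAt
    have : Continuous fun q : ℝ × ℝ => F2 q.1 q.2 • ContinuousLinearMap.toSpanSingleton ℝ (1:ℝ) := c2.smul continuous_const
    refine this.congr fun q => ?_
    ext; simp [Function.HasUncurry.uncurry]

lemma XS.swp {p : ℝ} {f : ℝ → ℝ → ℝ} (hf : XS p f) : Continuous fun q : ℝ × ℝ => f q.2 q.1 :=
  hf.ct0.comp continuous_swap

/-- families with `n` one-sided time derivatives, all space-smooth -/
def TS (p : ℝ) : ℕ → (ℝ → ℝ → ℝ) → Prop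
  | 0, f => XS p f
  | n+1, f => XS p f ∧ ∃ f', TS p n f' ∧ ∀ t, 0 ≤ t → ∀ x, HasDerivWithinAt (fun s => f s x) (f' t x) (Set.Ici 0) t

namespace TS
variable {p : ℝ} {n : ℕ} {f g : ℝ → ℝ → ℝ}

lemma xs (hf : TS p n f) : XS p f := by
  cases n with
  | zero => exact hf
  | succ n => exact hf.1

lemma pred (hf : TS p (n+1) f) : TS p n f := by
  induction n generalizing f with
  | zero => exact hf.1
  | succ n ih =>
    obtain ⟨h1, f', h2, h3⟩ := hf
    exact ⟨h1, f', ih h2, h3⟩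

lemma eq_tint {f' : ℝ → ℝ → ℝ} (hf : XS p f) (hf' : XS p f')
    (h : ∀ t, 0 ≤ t → ∀ x, HasDerivWithinAt (fun s => f s x) (f' t x) (Set.Ici 0) t) {t : ℝ} (ht : 0 ≤ t) :
    f t = tint (f 0) f' t := by
  ext x
  have c1 : Continuous fun s => f s x := hf.ct0.comp (by fun_prop : Continuous fun s : ℝ => (s, x))
  have c2 : Continuous fun s => tint (f 0) f' s x := (tint_xs (hf.sp 0) hf').ct0.comp (by fun_prop : Continuous fun s : ℝ => (s, x))
  have := constant_of_has_deriv_right_zero (f := fun s => f s x - tint (f 0) f' s x) (a := 0) (b := t)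
    (c1.sub c2).continuousOn (fun s hs => by
      have h1 := (h s hs.1 x).mono (Set.Ici_subset_Ici.2 hs.1)
      have h2 := (tint_t0 (hf.sp 0) hf' x s).hasDerivWithinAt (s := Set.Ici s)
      exact (h1.fun_sub h2).congr_deriv (by ring)) t ⟨ht, le_rfl⟩
  simp only [tint_zero, sub_self] at this
  linarith

lemma der (hf : TS p n f) (k : ℕ) : TS p n (fun t => iteratedDeriv k (f t)) := by
  induction n generalizing f with
  | zero => exact XS.der hf k
  | succ n ih =>
    obtain ⟨h1, f', h2, h3⟩ := hf
    refine ⟨h1.der k, _, ih h2, fun t ht x => ?_⟩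
    refine (tint_t (h1.sp 0) h2.xs k x t).hasDerivWithinAt.congr (fun s hs => ?_) ?_
    · exact congrArg (fun u => iteratedDeriv k u x) (eq_tint h1 h2.xs h3 hs)
    · exact congrArg (fun u => iteratedDeriv k u x) (eq_tint h1 h2.xs h3 ht)

lemma meanT (hf : TS p n f) : TS p n (fun t _ => mean p (f t)) := by
  induction n generalizing f with
  | zero => exact XS.timeonly (cont_mean (XS.ct0 hf))
  | succ n ih =>
    obtain ⟨h1, f', h2, h3⟩ := hf
    refine ⟨XS.timeonly (cont_mean (XS.ct0 h1)), _, ih h2, fun t ht x => ?_⟩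
    refine (mean_t (h1.sp 0) h2.xs t).hasDerivWithinAt.congr (fun s hs => ?_) ?_
    · exact congrArg (mean p) (eq_tint h1 h2.xs h3 hs)
    · exact congrArg (mean p) (eq_tint h1 h2.xs h3 ht)

lemma add (hf : TS p n f) (hg : TS p n g) : TS p n (fun t x => f t x + g t x) := by
  induction n generalizing f g with
  | zero => exact XS.add hf hg
  | succ n ih =>
    obtain ⟨h1, f', h2, h3⟩ := hf
    obtain ⟨k1, g', k2, k3⟩ := hg
    exact ⟨h1.add k1, _, ih h2 k2, fun t ht x => (h3 t ht x).fun_add (k3 t ht x)⟩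

lemma mul (hf : TS p n f) (hg : TS p n g) : TS p n (fun t x => f t x * g t x) := by
  induction n generalizing f g with
  | zero => exact XS.mul hf hg
  | succ n ih =>
    have p1 := hf.pred
    have p2 := hg.pred
    obtain ⟨h1, f', h2, h3⟩ := hf
    obtain ⟨k1, g', k2, k3⟩ := hg
    exact ⟨h1.mul k1, _, (ih h2 p2).add (ih p1 k2), fun t ht x => (h3 t ht x).fun_mul (k3 t ht x)⟩

lemma const (c : ℝ) : TS p n (fun _ _ => c) := by
  induction n generalizing c with
  | zero => exact XS.timeonly continuous_const
  | succ n ih => exact ⟨XS.timeonly continuous_const, _, ih 0, fun t _ x => hasDerivWithinAt_const _ _ _⟩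

lemma comp {a : ℝ → ℝ} (ha : ContDiff ℝ ∞ a) (hf : TS p n f) : TS p n (fun t x => a (f t x)) := by
  induction n generalizing f a with
  | zero => exact XS.comp hf ha
  | succ n ih =>
    have p1 := hf.pred
    obtain ⟨h1, f', h2, h3⟩ := hf
    refine ⟨h1.comp ha, _, (ih (smooth_iter ha 1) p1).mul h2, fun t ht x => ?_⟩
    have := hasDeriv_iter ha 0 (f t x)
    simp only [iteratedDeriv_zero] at this
    exact this.comp_hasDerivWithinAt t (h3 t ht x)

lemma contDiffOn (hf : TS p n f) : ContDiffOn ℝ n (fun q : ℝ × ℝ => f q.2 q.1) (Set.univ ×ˢ Set.Ici (0:ℝ)) := by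
  induction n generalizing f with
  | zero =>
    simp only [CharP.cast_eq_zero, contDiffOn_zero]
    exact ((XS.ct0 hf).comp continuous_swap).continuousOn
  | succ n ih =>
    have p1 := ih (hf.pred.der 1)
    obtain ⟨h1, f', h2, h3⟩ := hf
    have p2 := ih h2
    have hu : UniqueDiffOn ℝ ((Set.univ : Set ℝ) ×ˢ Set.Ici (0:ℝ)) := uniqueDiffOn_univ.prod (uniqueDiffOn_Ici 0)
    push_cast
    rw [contDiffOn_succ_iff_hasFDerivWithinAt_of_uniqueDiffOn hu]
    refine ⟨by simp, fun q => (ContinuousLinearMap.toSpanSingleton ℝ (iteratedDeriv 1 (f q.2) q.1)).coprod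
      (ContinuousLinearMap.toSpanSingleton ℝ (f' q.2 q.1)), ?_, ?_⟩
    · have e : (fun q : ℝ × ℝ => (ContinuousLinearMap.toSpanSingleton ℝ (iteratedDeriv 1 (f q.2) q.1)).coprod
          (ContinuousLinearMap.toSpanSingleton ℝ (f' q.2 q.1))) = fun q : ℝ × ℝ =>
          (iteratedDeriv 1 (f q.2) q.1) • ContinuousLinearMap.fst ℝ ℝ ℝ + (f' q.2 q.1) • ContinuousLinearMap.snd ℝ ℝ ℝ := by
        ext q <;> simp
      rw [e]
      exact (p1.smul contDiffOn_const).add (p2.smul contDiffOn_const)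
    · rintro ⟨x, t⟩ ⟨-, ht⟩
      have ht : 0 ≤ t := ht
      have hx := tint_xs (h1.sp 0) h2.xs
      have d1 : Continuous fun q : ℝ × ℝ => iteratedDeriv 1 (tint (f 0) f' q.2) q.1 := XS.swp (hx.der 1)
      have d2 : Continuous fun q : ℝ × ℝ => f' q.2 q.1 := XS.swp h2.xs
      have key := hasFD_of_partial (F := fun x t => tint (f 0) f' t x)
        (F1 := fun x t => iteratedDeriv 1 (tint (f 0) f' t) x) (F2 := fun x t => f' t x)
        (fun x t => by
          have := (hx.sp t).hasDeriv_iter 0 x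
          simp only [iteratedDeriv_zero] at this
          exact this)
        (fun x t => tint_t0 (h1.sp 0) h2.xs x t) d1 d2 x t
      have key2 := key.hasFDerivWithinAt (s := (Set.univ : Set ℝ) ×ˢ Set.Ici (0:ℝ))
      have e1 : iteratedDeriv 1 (f t) x = iteratedDeriv 1 (tint (f 0) f' t) x := by
        conv_lhs => rw [eq_tint h1 h2.xs h3 ht]
      simp only [e1]
      refine key2.congr (fun q hq => ?_) ?_
      · exact congrFun (eq_tint h1 h2.xs h3 hq.2) q.1
      · exact congrFun (eq_tint h1 h2.xs h3 ht) x
end TS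

lemma conv_comp {p vs : ℝ} {V : ℝ → ℝ → ℝ} (hV : ∀ t, SP p (V t))
    (hk : ∀ k, Tendsto (fun q : ℝ × ℝ => iteratedDeriv k (V q.1) q.2) (atTop ×ˢ ⊤) (nhds (if k = 0 then vs else 0)))
    (k : ℕ) : ∀ {G : ℝ → ℝ}, ContDiff ℝ ∞ G →
    Tendsto (fun q : ℝ × ℝ => iteratedDeriv k (fun x => G (V q.1 x)) q.2) (atTop ×ˢ ⊤) (nhds (if k = 0 then G vs else 0)) := by
  induction k using Nat.strong_induction_on with
  | _ k ih =>
    intro G hG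
    cases k with
    | zero =>
      have := hk 0
      simp only [iteratedDeriv_zero, if_true] at this ⊢
      exact (hG.continuous.tendsto vs).comp this
    | succ k =>
      have e : (fun q : ℝ × ℝ => iteratedDeriv (k+1) (fun x => G (V q.1 x)) q.2) = fun q : ℝ × ℝ =>
          ∑ i ∈ Finset.range (k + 1), (k.choose i : ℝ) * iteratedDeriv i (fun x => iteratedDeriv 1 G (V q.1 x)) q.2
            * iteratedDeriv (k - i + 1) (V q.1) q.2 := by
        ext q
        have d : deriv (fun x => G (V q.1 x)) = (fun x => iteratedDeriv 1 G (V q.1 x)) * (iteratedDeriv 1 (V q.1)) := by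
          ext x
          have h1 := hasDeriv_iter hG 0 (V q.1 x)
          have h2 := (hV q.1).hasDeriv_iter 0 x
          simp only [iteratedDeriv_zero, zero_add] at h1 h2
          exact (h1.comp x h2).deriv
        rw [iteratedDeriv_succ', d, iteratedDeriv_mul]
        · refine Finset.sum_congr rfl fun i _ => ?_
          congr 1
          simp only [iteratedDeriv_eq_iterate, Function.iterate_add_apply]
        · exact (SP.comp (smooth_iter hG 1) (hV q.1)).smooth.contDiffAt.of_le (by norm_cast; exact le_top)
        · exact ((hV q.1).iter 1).smooth.contDiffAt.of_le (by norm_cast; exact le_top)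
      rw [e]
      have z : (if k + 1 = 0 then G vs else 0) = ∑ i ∈ Finset.range (k+1), (k.choose i : ℝ) * (if i = 0 then iteratedDeriv 1 G vs else 0) * 0 := by
        simp
      rw [z]
      refine tendsto_finsetSum _ fun i hi => ?_
      have h1 := ih i (Finset.mem_range.1 hi) (smooth_iter hG 1)
      have h2 := hk (k - i + 1)
      simp only [Nat.succ_ne_zero, if_false, Nat.add_eq_zero_iff, one_ne_zero, and_false] at h2
      exact (h1.const_mul _).mul h2

lemma int_periods {p : ℝ} (hp : 0 < p) {f : ℝ → ℝ} (hc : Continuous f) (hf : Function.Periodic f p) (n : ℕ) :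
    ∫ x in (0:ℝ)..(n * p), f x = n * ∫ x in (0:ℝ)..p, f x := by
  have := hf.intervalIntegral_add_zsmul_eq (n : ℤ) 0 (fun a b => ii_cont hc a b)
  simpa using this

lemma orth_w {p : ℝ} {u w : ℝ → ℝ} (hpe : p = 2 * π) (hu : SP p u) (hw : SP (2*π) w) (h2 : ∀ x, iteratedDeriv 2 w x = - w x)
    (h0 : ∫ x in (0:ℝ)..(2*π), w x = 0) : ∫ x in (0:ℝ)..p, (u x + iteratedDeriv 2 u x) * w x = 0 := by
  subst hpe
  have := int_zop_w hu hw h2 h0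
  have c1 := zop_cont hu
  have c2 := hw.cont
  have e : ∀ x, (u x + iteratedDeriv 2 u x) * w x = 1 * (zop (2*π) u x * w x) + mean (2*π) u * w x := fun x => by
    unfold zop; ring
  simp only [e]
  rw [int_lin2 (by fun_prop) (by fun_prop), this, h0]; simp

lemma G_ex {α δ M : ℝ} (hα : 0 < α) (hδ : 0 < δ) {a : ℝ → ℝ} {c C : ℝ} (ha : Coef a c C)
    (haeq : ∀ s, δ ≤ s → s ≤ M → a s = α * s ^ (1 + 1/α)) :
    ∃ G : ℝ → ℝ, ContDiff ℝ ∞ G ∧ ∀ s, δ ≤ s → s ≤ M → G s = s ^ (1/α) := by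
  have hap : ∀ s, 0 < a s := fun s => lt_of_lt_of_le ha.pos (ha.lo s)
  refine ⟨fun s => (a s / α) ^ ((1/α) / (1 + 1/α)), ?_, fun s h1 h2 => ?_⟩
  · exact (ha.smooth.div_const α).rpow_const_of_ne fun s => (div_pos (hap s) hα).ne'
  · have hs : 0 ≤ s := by linarith
    show (a s / α) ^ _ = _
    rw [haeq s h1 h2, mul_div_cancel_left₀ _ hα.ne', ← rpow_mul hs, mul_div_cancel₀]
    positivity

lemma V_TS {p : ℝ} {a v0 : ℝ → ℝ} {g : ℝ → ℝ → ℝ} (ha : ContDiff ℝ ∞ a) (hv0 : SP p v0) (hg : XS p g)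
    (hsol : ∀ t, 0 ≤ t → g t = Fop p a (tint v0 g t)) (n : ℕ) : TS p n (tint v0 g) := by
  have hV := tint_xs hv0 hg
  induction n with
  | zero => exact hV
  | succ n ih =>
    refine ⟨hV, fun t x => a (tint v0 g t x) * (iteratedDeriv 2 (tint v0 g t) x + (tint v0 g t x + (-1) * mean p (tint v0 g t))),
      (ih.comp ha).mul ((ih.der 2).add (ih.add ((TS.const (-1)).mul ih.meanT))), fun t ht x => ?_⟩
    refine (tint_t0 hv0 hg x t).hasDerivWithinAt.congr_deriv ?_
    rw [hsol t ht]; unfold Fop; ring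

lemma eventually_prod_top_iff_aux {P : ℝ × ℝ → Prop} :
    (∀ᶠ q in (atTop : Filter ℝ) ×ˢ (⊤ : Filter ℝ), P q) ↔ ∀ᶠ t in atTop, ∀ x, P (t, x) := by
  rw [eventually_prod_iff]
  constructor
  · rintro ⟨pa, ha, pb, hb, h⟩
    rw [eventually_top] at hb
    filter_upwards [ha] with t ht x
    exact h ht (hb x)
  · intro h
    exact ⟨_, h, fun _ => True, by simp, fun {t} ht {x} _ => ht x⟩

/-- the flow on the fundamental period -/
lemma flow_core {p α : ℝ} (hp : 0 < p) (hp2 : p ≤ 2 * π) (hα : 0 < α) {h0 : ℝ → ℝ} (hh : SP p h0)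
    (hpos : ∀ x, 0 < h0 x + iteratedDeriv 2 h0 x) :
    ∃ H V : ℝ → ℝ → ℝ, (∀ n, TS p n H) ∧ H 0 = h0 ∧ (∀ t, SP p (V t)) ∧ (∀ t, 0 ≤ t → ∀ x, 0 < V t x) ∧
      (∀ t, 0 ≤ t → ∀ x, H t x + iteratedDeriv 2 (H t) x = (V t x) ^ (-(1/α))) ∧
      (∀ t x, HasDerivAt (fun s => H s x) (mean p (V t) - V t x) t) ∧
      ∀ k, Tendsto (fun q : ℝ × ℝ => iteratedDeriv k (fun x => (H q.1 x + iteratedDeriv 2 (H q.1) x)⁻¹) q.2) (atTop ×ˢ ⊤)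
        (nhds (if k = 0 then (mean p h0)⁻¹ else 0)) := by
  set ρ : ℝ → ℝ := fun x => h0 x + iteratedDeriv 2 h0 x with hρ
  have hρs : SP p ρ := hh.add (hh.iter 2)
  have hρc := hρs.cont
  have hmean : mean p ρ = mean p h0 := by
    have c1 := hh.cont
    have c2 := (hh.iter 2).cont
    unfold mean
    rw [hρ, intervalIntegral.integral_add (ii_cont c1 _ _) (ii_cont c2 _ _), iteratedDeriv_succ, int_deriv_zero (hh.iter 1), add_zero]
  have hr : 0 < mean p h0 := by
    rw [← hmean]
    unfold mean
    have := intervalIntegral.intervalIntegral_pos_of_pos (ii_cont hρc 0 p) hpos hp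
    positivity
  set r := mean p h0 with hrdef
  have hinv : ∀ y : ℝ, 0 < y → (y ^ (-α)) ^ (-(1/α)) = y := fun y hy => by
    rw [← rpow_mul hy.le]
    have : -α * -(1/α) = 1 := by field_simp
    rw [this, rpow_one]
  set v0 : ℝ → ℝ := fun x => (ρ x) ^ (-α) with hv0
  have hv0s : SP p v0 := ⟨hρs.smooth.rpow_const_of_ne fun x => (hpos x).ne', fun x => by simp only [hv0, hρs.per x]⟩
  have hv0p : ∀ x, 0 < v0 x := fun x => rpow_pos_of_pos (hpos x) _
  have hvs : 0 < r ^ (-α) := rpow_pos_of_pos hr _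
  have hvi : ∀ x, (v0 x) ^ (-(1/α)) = h0 x + iteratedDeriv 2 h0 x := fun x => hinv _ (hpos x)
  have hyInt : ∫ x in (0:ℝ)..p, (v0 x) ^ (-(1/α)) = p * (r ^ (-α)) ^ (-(1/α)) := by
    simp only [hvi, hinv _ hr]
    rw [← hmean, int_eq_mean hp]
  have horth : p = 2 * π → (∫ x in (0:ℝ)..p, (v0 x) ^ (-(1/α)) * cos x = 0) ∧ ∫ x in (0:ℝ)..p, (v0 x) ^ (-(1/α)) * sin x = 0 := by
    intro hpe
    simp only [hvi]
    exact ⟨orth_w hpe hh cos_sp iter2_cos (by simp), orth_w hpe hh sin_sp iter2_sin (by simp)⟩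
  obtain ⟨a, c, C, δ, M, g, ha, hδ, hδv, hvM, haeq, hg, hsol, hbd, hcv, hcvk⟩ := main_v hp hp2 hα hvs hv0s hv0p hyInt horth
  set V := tint v0 g with hVdef
  set vs := r ^ (-α) with hvsdef
  have hVx : XS p V := tint_xs hv0s hg
  have hVT : ∀ n, TS p n V := V_TS ha.smooth hv0s hg hsol
  set W : ℝ → ℝ → ℝ := fun t x => mean p (V t) + (-1) * V t x with hW
  have hWT : ∀ n, TS p n W := fun n => (hVT n).meanT.add ((TS.const (-1)).mul (hVT n))
  have hWx : XS p W := hWT 0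
  have hHx : XS p (tint h0 W) := tint_xs hh hWx
  have hVp : ∀ t, 0 ≤ t → ∀ x, 0 < V t x := fun t ht x => lt_of_lt_of_le hδ (hbd t ht x).1
  have hW2 : ∀ t x, iteratedDeriv 2 (W t) x = - iteratedDeriv 2 (V t) x := fun t x => by
    have e : W t = fun x => mean p (V t) + (-1) * V t x := rfl
    rw [e, iteratedDeriv_const_add (by norm_num), iteratedDeriv_const_mul_field]
    ring
  have key : ∀ t, 0 ≤ t → ∀ x, tint h0 W t x + iteratedDeriv 2 (tint h0 W t) x = (V t x) ^ (-(1/α)) := by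
    intro t ht x
    have hP : ∀ s, 0 ≤ s → Pd a (vs ^ (-(1/α))) vs (V s x) = (V s x) ^ (-(1/α)) := fun s hs =>
      Pd_eq hα hδ haeq hδv hvM (hbd s hs x).1 (hbd s hs x).2
    have := const_of_deriv (f := fun s => tint h0 W s x + iteratedDeriv 2 (tint h0 W s) x - Pd a (vs ^ (-(1/α))) vs (V s x))
      (fun s hs => by
        have d1 := tint_t0 hh hWx x s
        have d2 := tint_t hh hWx 2 x s
        have d3 := (Pd_hd ha (vs ^ (-(1/α))) vs (V s x)).comp s (tint_t0 hv0s hg x s)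
        have z := g_zop ha hsol hs x
        refine ((d1.fun_add d2).fun_sub d3).congr_deriv ?_
        rw [hW2]
        have z' : -(1 / a (V s x)) * g s x = - zop p (V s) x := by rw [← z]; ring
        rw [z']
        simp only [hW]; unfold zop; ring) ht
    have e0 : V 0 x = v0 x := by rw [hVdef, tint_zero]
    have q0 := hP 0 le_rfl
    rw [e0, hvi] at q0
    simp only [tint_zero] at this
    rw [hP t ht, e0, q0] at this
    linarith
  refine ⟨tint h0 W, V, ?_, tint_zero, hVx.sp, hVp, key, fun t x => ?_, fun k => ?_⟩
  · intro n
    cases n with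
    | zero => exact hHx
    | succ n => exact ⟨hHx, W, hWT n, fun t ht x => (tint_t0 hh hWx x t).hasDerivWithinAt⟩
  · refine (tint_t0 hh hWx x t).congr_deriv ?_
    simp only [hW]; ring
  · obtain ⟨G, hG, hGeq⟩ := G_ex hα hδ ha haeq
    have hVk : ∀ k, Tendsto (fun q : ℝ × ℝ => iteratedDeriv k (V q.1) q.2) (atTop ×ˢ ⊤) (nhds (if k = 0 then vs else 0)) := by
      intro k
      rw [Metric.tendsto_nhds]
      intro ε hε
      rw [eventually_prod_top_iff_aux]
      by_cases h : k = 0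
      · subst h
        filter_upwards [hcv (ε/2) (by linarith)] with t ht x
        simp only [iteratedDeriv_zero, if_true, Real.dist_eq]
        linarith [ht x]
      · filter_upwards [hcvk k (by omega) (ε/2) (by linarith)] with t ht x
        simp only [h, if_false, Real.dist_eq, sub_zero]
        linarith [ht x]
    have hfin := conv_comp hVx.sp hVk k hG
    have e0 : G vs = (mean p h0)⁻¹ := by
      rw [hGeq vs hδv hvM, hvsdef, ← rpow_mul hr.le]
      have : -α * (1/α) = -1 := by field_simp
      rw [this, rpow_neg_one]
    rw [e0] at hfin
    refine hfin.congr' ?_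
    have : ∀ᶠ q : ℝ × ℝ in atTop ×ˢ ⊤, 0 ≤ q.1 := (eventually_ge_atTop 0).prod_inl _
    filter_upwards [this] with q hq
    congr 1
    ext x
    rw [key q.1 hq x, hGeq _ (hbd _ hq x).1 (hbd _ hq x).2, rpow_neg (hVp _ hq x).le, inv_inv]

/-- For an initial locally convex curve of total curvature `2mπ` with `n`-fold
rotational symmetry and `m ≤ n`, the LP flow exists globally and the curvature
converges, with all its `θ`-derivatives, uniformly to the constant `2mπ/L₀`, i.e. the
flow converges in the `C^∞` metric to an `m`-fold circle of length `L₀ = ∫₀^{2mπ} h₀`. -/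
theorem lp_flow_rotationally_symmetric_global_convergence
    (m n : ℕ) (hm : 1 ≤ m) (hn : 1 ≤ n) (hmn : m ≤ n)
    (α : ℝ) (hα : 0 < α) (h₀ : ℝ → ℝ)
    (h₀smooth : ContDiff ℝ (⊤ : ℕ∞) h₀)
    (h₀per : ∀ θ, h₀ (θ + 2 * m * π / n) = h₀ θ)
    (h₀conv : ∀ θ, 0 < h₀ θ + iteratedDeriv 2 h₀ θ) :
    ∃ h : ℝ → ℝ → ℝ,
      ContDiffOn ℝ (⊤ : ℕ∞) (Function.uncurry h) (Set.univ ×ˢ Set.Ici (0:ℝ)) ∧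
      (∀ θ, h θ 0 = h₀ θ) ∧
      (∀ θ t, 0 ≤ t → h (θ + 2 * m * π) t = h θ t) ∧
      (∀ θ t, 0 ≤ t → 0 < h θ t + hpp h θ t) ∧
      (∀ θ t, 0 ≤ t →
        derivWithin (fun s => h θ s) (Set.Ici 0) t
          = -(h θ t + hpp h θ t) ^ (-α) + lamLP m α h t) ∧
      (∀ k : ℕ,
        TendstoUniformly
          (fun t θ => iteratedDeriv k (fun x => (h x t + hpp h x t)⁻¹) θ)
          (fun _ => if k = 0 then 2 * m * π / (∫ θ in (0:ℝ)..(2 * m * π), h₀ θ) else 0)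
          atTop) := by
  have hm' : (0:ℝ) < m := by exact_mod_cast hm
  have hn' : (0:ℝ) < n := by exact_mod_cast hn
  have hmn' : (m:ℝ) ≤ n := by exact_mod_cast hmn
  have hπ := pi_pos
  obtain ⟨p, hpdef⟩ : ∃ p : ℝ, p = 2 * m * π / n := ⟨_, rfl⟩
  have hnp : (n:ℝ) * p = 2 * m * π := by rw [hpdef]; field_simp
  have hp : 0 < p := by rw [hpdef]; positivity
  have hp2 : p ≤ 2 * π := by
    rw [hpdef, div_le_iff₀ hn']
    nlinarith
  have hh : SP p h₀ := ⟨h₀smooth, fun x => by rw [hpdef]; exact h₀per x⟩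
  obtain ⟨H, V, hT, hH0, hVs, hVp, key, hHt, hconv⟩ := flow_core hp hp2 hα hh h₀conv
  have hpow : ∀ t, 0 ≤ t → ∀ x, (H t x + iteratedDeriv 2 (H t) x) ^ (-α) = V t x := fun t ht x => by
    rw [key t ht x, ← rpow_mul (hVp t ht x).le]
    have : -(1/α) * -α = 1 := by field_simp
    rw [this, rpow_one]
  have hlam : ∀ t, 0 ≤ t → lamLP m α (fun θ t => H t θ) t = mean p (V t) := fun t ht => by
    unfold lamLP hpp
    simp only [hpow t ht]
    rw [← hnp, int_periods hp (hVs t).cont (hVs t).per]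
    unfold mean
    field_simp
  refine ⟨fun θ t => H t θ, ?_, ?_, ?_, ?_, ?_, ?_⟩
  · rw [contDiffOn_infty]
    exact fun k => (hT k).contDiffOn
  · intro θ; simp only [hH0]
  · intro θ t _
    have := ((hT 0).xs.sp t).per.nat_mul n θ
    rwa [hnp] at this
  · intro θ t ht
    have := key t ht θ
    unfold hpp
    rw [this]
    exact rpow_pos_of_pos (hVp t ht θ) _
  · intro θ t ht
    rw [hlam t ht]
    have : (H t θ + hpp (fun θ t => H t θ) θ t) ^ (-α) = V t θ := hpow t ht θ
    rw [this, (hHt t θ).hasDerivWithinAt.derivWithin ((uniqueDiffOn_Ici 0) t ht)]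
    ring
  · intro k
    have e : 2 * m * π / (∫ θ in (0:ℝ)..(2 * m * π), h₀ θ) = (mean p h₀)⁻¹ := by
      rw [← hnp, int_periods hp hh.cont hh.per]
      unfold mean
      rw [mul_div_mul_left _ _ hn'.ne']
      simp [div_eq_mul_inv, mul_comm]
    rw [e, Metric.tendstoUniformly_iff]
    intro ε hε
    have := (Metric.tendsto_nhds.1 (hconv k)) ε hε
    rw [eventually_prod_top_iff_aux] at this
    filter_upwards [this] with t ht x
    rw [dist_comm]
    exact ht x
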